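/- (Corollary 6.6.) Assume p = 2, W is continuous and satisfies (H1)–(H4), the wells are A = −B with columns (a, 0, 0) for some a ∈ ℝ³∖{0} (the supercritical wells with λ = 0), and W(ξ₁,ξ₂,ξ₃) = W(ξ₁,ξ₂,−ξ₃) for all ξ ∈ ℝ^{3×3}. Then K*_∞ ≥ K_∞. -/

import Mathlib

open MeasureTheory Filter Topology ENNReal NNReal Set

noncomputable section

/-- Vectors in ℝ³. -/
abbrev V3 := Fin 3 → ℝ

/-- 3×3 matrices, represented as the triple of their columns. -/
abbrev M33 := Fin 3 → V3

/-- Euclidean norm on ℝ³. -/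
def vnorm (v : V3) : ℝ := Real.sqrt (∑ i, (v i) ^ 2)

/-- Frobenius (Euclidean) norm on 3×3 matrices. -/
def mnorm (ξ : M33) : ℝ := Real.sqrt (∑ j, ∑ i, (ξ j i) ^ 2)

/-- dist(ξ,{A,B}). -/
def mdist (A B ξ : M33) : ℝ := min (mnorm (ξ - A)) (mnorm (ξ - B))

/-- Spatial points of ℝ³ = ℝ × ℝ × ℝ. -/
abbrev Pt := ℝ × ℝ × ℝ

/-- Directional partial derivative of a map `u : ℝ³ → ℝ³`. -/
def pd (e : Pt) (u : Pt → V3) (x : Pt) : V3 := fderiv ℝ u x e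

def e1 : Pt := (1, 0, 0)
def e2 : Pt := (0, 1, 0)
def e3 : Pt := (0, 0, 1)

/-- Rescaled gradient ∇_h u = (∂₁u, ∂₂u, h⁻¹ ∂₃u), as a 3×3 matrix of columns. -/
def gradh (h : ℝ) (u : Pt → V3) (x : Pt) : M33 :=
  ![pd e1 u x, pd e2 u x, h⁻¹ • pd e3 u x]

/-- Squared rescaled Hessian |∇²_h u|². -/
def hessh (h : ℝ) (u : Pt → V3) (x : Pt) : ℝ :=
  (vnorm (pd e1 (pd e1 u) x)) ^ 2 + (vnorm (pd e2 (pd e2 u) x)) ^ 2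
    + (h⁻¹) ^ 4 * (vnorm (pd e3 (pd e3 u) x)) ^ 2
    + 2 * (vnorm (pd e2 (pd e1 u) x)) ^ 2
    + 2 * (h⁻¹) ^ 2 * (vnorm (pd e3 (pd e1 u) x)) ^ 2
    + 2 * (h⁻¹) ^ 2 * (vnorm (pd e3 (pd e2 u) x)) ^ 2

/-- The energy F^h_ε(u, S) = ∫_S (1/ε) W(∇_h u) + ε |∇²_h u|², valued in [0,∞]. -/
def F (W : M33 → ℝ) (h ε : ℝ) (u : Pt → V3) (S : Set Pt) : ℝ≥0∞ :=
  ∫⁻ x in S, ENNReal.ofReal (ε⁻¹ * W (gradh h u x) + ε * hessh h u x)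

/-- Hypothesis (H1): W ≥ 0, {W = 0} = {A, B}, A ≠ B, and A' − B' = 2 a ⊗ ν̄ for
some a ∈ ℝ³ and a unit vector ν̄ ∈ ℝ². -/
def H1 (W : M33 → ℝ) (A B : M33) : Prop :=
  (∀ ξ, 0 ≤ W ξ) ∧ (∀ ξ, W ξ = 0 ↔ ξ = A ∨ ξ = B) ∧ A ≠ B ∧
    ∃ (a : V3) (ν : ℝ × ℝ), ν.1 ^ 2 + ν.2 ^ 2 = 1 ∧
      A 0 - B 0 = (2 * ν.1) • a ∧ A 1 - B 1 = (2 * ν.2) • a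

/-- Hypothesis (H2): p-growth from above and below. -/
def H2 (W : M33 → ℝ) (p : ℝ) : Prop :=
  ∃ C > (0 : ℝ), ∀ ξ, C⁻¹ * (mnorm ξ) ^ p - C ≤ W ξ ∧ W ξ ≤ C * (mnorm ξ) ^ p + C

/-- Hypothesis (H3): non-degeneracy near the wells. -/
def H3 (W : M33 → ℝ) (A B : M33) (p : ℝ) : Prop :=
  ∃ ϱ > (0 : ℝ), ∃ C > (0 : ℝ), ∀ ξ, mdist A B ξ ≤ ϱ →
    C⁻¹ * (mdist A B ξ) ^ p ≤ W ξ ∧ W ξ ≤ C * (mdist A B ξ) ^ p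

/-- Hypothesis (H4): W(ξ₁, 0, ξ₃) ≤ W(ξ). -/
def H4 (W : M33 → ℝ) : Prop := ∀ ξ : M33, W ![ξ 0, 0, ξ 2] ≤ W ξ

/-- Normalization of the wells: A = −B, first column of A is a, second column is 0. -/
def Wells (A B : M33) (a : V3) : Prop := A = -B ∧ A 0 = a ∧ A 1 = 0

/-- ū₀(t) = |t| a. -/
def ub0 (a : V3) (t : ℝ) : V3 := |t| • a

/-- b̄₀(t) = A₃ for t ≥ 0, −A₃ (= B₃) for t < 0. -/
def bb0 (A3 : V3) (t : ℝ) : V3 := if 0 ≤ t then A3 else -A3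

/-- u₀(x) = ū₀(x₁). -/
def u0 (a : V3) (x : Pt) : V3 := ub0 a x.1

/-- b₀(x) = b̄₀(x₁). -/
def b0 (A3 : V3) (x : Pt) : V3 := bb0 A3 x.1

/-- The interval I = (−1/2, 1/2). -/
def II : Set ℝ := Set.Ioo (-(1 / 2 : ℝ)) (1 / 2)

/-- The unit cube Q = I × I × I. -/
def Q3 : Set Pt := II ×ˢ (II ×ˢ II)

/-- J_ρ = (ρ I) × J × I. -/
def Jrho (J : Set ℝ) (ρ : ℝ) : Set Pt := (Set.Ioo (-(ρ / 2)) (ρ / 2)) ×ˢ (J ×ˢ II)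

/-- The rescaled thin domain Ω = ω × I. -/
def Om (ω : Set (ℝ × ℝ)) : Set Pt := {x | (x.1, x.2.1) ∈ ω ∧ x.2.2 ∈ II}

/-- L¹ convergence on a set U. -/
def TendsL1 (U : Set Pt) (f : ℕ → Pt → V3) (g : Pt → V3) : Prop :=
  Tendsto (fun n => ∫⁻ x in U, ENNReal.ofReal (vnorm (f n x - g x))) atTop (nhds 0)

/-- L^q convergence on a set U. -/
def TendsLp (U : Set Pt) (q : ℝ) (f : ℕ → Pt → V3) (g : Pt → V3) : Prop :=
  Tendsto (fun n => ∫⁻ x in U, ENNReal.ofReal ((vnorm (f n x - g x)) ^ q)) atTop (nhds 0)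

/-- The localized asymptotic energy 𝓔_γ(J, ρ). -/
def Egam (W : M33 → ℝ) (a A3 : V3) (γ : ℝ) (J : Set ℝ) (ρ : ℝ) : ℝ≥0∞ :=
  sInf { L : ℝ≥0∞ | ∃ (h ε : ℕ → ℝ) (u : ℕ → Pt → V3),
    (∀ n, 0 < h n) ∧ (∀ n, 0 < ε n) ∧
    Tendsto h atTop (nhds 0) ∧ Tendsto ε atTop (nhds 0) ∧
    Tendsto (fun n => h n / ε n) atTop (nhds γ) ∧
    (∀ n, ContDiffOn ℝ 2 (u n) (Jrho J ρ)) ∧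
    TendsL1 (Jrho J ρ) u (u0 a) ∧
    TendsL1 (Jrho J ρ) (fun n x => (h n)⁻¹ • pd e3 (u n) x) (b0 A3) ∧
    L = Filter.liminf (fun n => F W (h n) (ε n) (u n) (Jrho J ρ)) atTop }

/-- K*_γ = 𝓔_γ(I, 1). -/
def Kstar (W : M33 → ℝ) (a A3 : V3) (γ : ℝ) : ℝ≥0∞ := Egam W a A3 γ II 1

/-- K*_∞ : the analogue of K*_γ for h/ε → ∞, on the unit cube Q. -/
def KstarInf (W : M33 → ℝ) (a A3 : V3) : ℝ≥0∞ :=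
  sInf { L : ℝ≥0∞ | ∃ (h ε : ℕ → ℝ) (u : ℕ → Pt → V3),
    (∀ n, 0 < h n) ∧ (∀ n, 0 < ε n) ∧
    Tendsto h atTop (nhds 0) ∧ Tendsto ε atTop (nhds 0) ∧
    Tendsto (fun n => h n / ε n) atTop atTop ∧
    (∀ n, ContDiffOn ℝ 2 (u n) Q3) ∧
    TendsL1 Q3 u (u0 a) ∧
    TendsL1 Q3 (fun n x => (h n)⁻¹ • pd e3 (u n) x) (b0 A3) ∧
    L = Filter.liminf (fun n => F W (h n) (ε n) (u n) Q3) atTop }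

open Classical in
/-- The phase matrix: B on E, A off E. -/
def Mfun (A B : M33) (E : Set (ℝ × ℝ)) (x' : ℝ × ℝ) : M33 := if x' ∈ E then B else A

/-! ### Two-dimensional objects -/

abbrev Pt2 := ℝ × ℝ

/-- Directional partial derivative of a map `v : ℝ² → ℝ³`. -/
def qd (e : Pt2) (v : Pt2 → V3) (y : Pt2) : V3 := fderiv ℝ v y e

def f1 : Pt2 := (1, 0)
def f2 : Pt2 := (0, 1)

/-- 𝒲(∇v) = W(∂₁v, 0, ∂₂v). -/
def W2 (W : M33 → ℝ) (v : Pt2 → V3) (y : Pt2) : ℝ := W ![qd f1 v y, 0, qd f2 v y]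

/-- Squared 2D Hessian |∇²v|². -/
def hess2d (v : Pt2 → V3) (y : Pt2) : ℝ :=
  (vnorm (qd f1 (qd f1 v) y)) ^ 2 + 2 * (vnorm (qd f2 (qd f1 v) y)) ^ 2
    + (vnorm (qd f2 (qd f2 v) y)) ^ 2

/-- The rectangle ℓI × γI. -/
def Rect (ℓ γ : ℝ) : Set Pt2 := Set.Ioo (-(ℓ / 2)) (ℓ / 2) ×ˢ Set.Ioo (-(γ / 2)) (γ / 2)

/-- The optimal-profile constant K_γ of the critical regime. -/
def Kgam (W : M33 → ℝ) (a A3 : V3) (γ : ℝ) : ℝ≥0∞ :=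
  sInf { L : ℝ≥0∞ | ∃ ℓ > (0 : ℝ), ∃ v : Pt2 → V3,
    ContDiffOn ℝ 2 v (Rect ℓ γ) ∧
    (∃ δ > (0 : ℝ), ∀ y ∈ Rect ℓ γ, ℓ / 2 - δ < y.1 → qd f1 v y = a ∧ qd f2 v y = A3) ∧
    (∃ δ > (0 : ℝ), ∀ y ∈ Rect ℓ γ, y.1 < -(ℓ / 2) + δ → qd f1 v y = -a ∧ qd f2 v y = -A3) ∧
    L = ENNReal.ofReal γ⁻¹ *
      ∫⁻ y in Rect ℓ γ, ENNReal.ofReal (W2 W v y + hess2d v y) }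

/-- The 2D subcritical functional F⁰_ε(u, b, D). -/
def F0 (W : M33 → ℝ) (ε : ℝ) (u b : Pt2 → V3) (D : Set Pt2) : ℝ≥0∞ :=
  ∫⁻ y in D, ENNReal.ofReal (ε⁻¹ * W ![qd f1 u y, qd f2 u y, b y]
    + ε * ((vnorm (qd f1 (qd f1 u) y)) ^ 2 + 2 * (vnorm (qd f2 (qd f1 u) y)) ^ 2
      + (vnorm (qd f2 (qd f2 u) y)) ^ 2
      + 2 * (vnorm (qd f1 b y)) ^ 2 + 2 * (vnorm (qd f2 b y)) ^ 2))

/-- K*₀: the subcritical cell constant. -/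
def Kstar0 (W : M33 → ℝ) (a A3 : V3) : ℝ≥0∞ :=
  sInf { L : ℝ≥0∞ | ∃ (ε : ℕ → ℝ) (u b : ℕ → Pt2 → V3),
    (∀ n, 0 < ε n) ∧ Tendsto ε atTop (nhds 0) ∧
    (∀ n, ContDiffOn ℝ 2 (u n) (II ×ˢ II)) ∧ (∀ n, ContDiffOn ℝ 1 (b n) (II ×ˢ II)) ∧
    Tendsto (fun n => ∫⁻ y in II ×ˢ II,
      ENNReal.ofReal (vnorm (u n y - ub0 a y.1) + vnorm (b n y - bb0 A3 y.1)))
      atTop (nhds 0) ∧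
    L = Filter.liminf (fun n => F0 W (ε n) (u n) (b n) (II ×ˢ II)) atTop }

/-- K₀: the subcritical optimal-profile constant. -/
def K0 (W : M33 → ℝ) (a A3 : V3) : ℝ≥0∞ :=
  sInf { L : ℝ≥0∞ | ∃ ℓ > (0 : ℝ), ∃ φ1 φ2 : ℝ → V3,
    ContDiffOn ℝ 1 φ1 (Set.Icc (-ℓ) ℓ) ∧ ContDiffOn ℝ 1 φ2 (Set.Icc (-ℓ) ℓ) ∧
    φ1 ℓ = a ∧ φ2 ℓ = A3 ∧ φ1 (-ℓ) = -a ∧ φ2 (-ℓ) = -A3 ∧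
    L = ∫⁻ t in Set.Ioo (-ℓ) ℓ, ENNReal.ofReal (W ![φ1 t, 0, φ2 t]
      + (vnorm (derivWithin φ1 (Set.Icc (-ℓ) ℓ) t)) ^ 2
      + 2 * (vnorm (derivWithin φ2 (Set.Icc (-ℓ) ℓ) t)) ^ 2) }

/-- K_∞ in the case λ = 0. -/
def KinfZero (W : M33 → ℝ) (a : V3) : ℝ≥0∞ :=
  sInf { L : ℝ≥0∞ | ∃ ℓ > (0 : ℝ), ∃ v : Pt2 → V3,
    ContDiff ℝ 2 v ∧ (∀ y : Pt2, v (y.1, y.2 + 1) = v y) ∧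
    (∃ δ > (0 : ℝ), ∀ y : Pt2, |y.1 - 1 / 2| < δ → qd f1 v y = a ∧ qd f2 v y = 0) ∧
    (∃ δ > (0 : ℝ), ∀ y : Pt2, |y.1 + 1 / 2| < δ → qd f1 v y = -a ∧ qd f2 v y = 0) ∧
    L = ∫⁻ y in II ×ˢ II, ENNReal.ofReal (ℓ * W2 W v y + ℓ⁻¹ * hess2d v y) }

/-- The unit normal ν_λ = (1+λ²)^{-1/2} (1, λ). -/
def nuv (lam : ℝ) : Pt2 := (1 / Real.sqrt (1 + lam ^ 2), lam / Real.sqrt (1 + lam ^ 2))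

/-- The orthogonal direction ν_λ^⊥ = (1+λ²)^{-1/2} (−λ, 1). -/
def nupv (lam : ℝ) : Pt2 := (-lam / Real.sqrt (1 + lam ^ 2), 1 / Real.sqrt (1 + lam ^ 2))

/-- Dot product on ℝ². -/
def dotp (w y : Pt2) : ℝ := w.1 * y.1 + w.2 * y.2

/-- The unit square Q'_λ centered at 0 with two sides orthogonal to ν_λ. -/
def Qlam (lam : ℝ) : Set Pt2 := {y | |dotp (nuv lam) y| < 1 / 2 ∧ |dotp (nupv lam) y| < 1 / 2}

/-- K_∞ for general λ. -/
def KinfL (W : M33 → ℝ) (a : V3) (lam : ℝ) : ℝ≥0∞ :=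
  ENNReal.ofReal (Real.sqrt (1 + lam ^ 2)) *
    sInf { L : ℝ≥0∞ | ∃ ℓ > (0 : ℝ), ∃ v : Pt2 → V3,
      ContDiff ℝ 2 v ∧ (∀ y : Pt2, v (y + nupv lam) = v y) ∧
      (∃ δ > (0 : ℝ), ∀ y : Pt2, |dotp (nuv lam) y - 1 / 2| < δ →
        qd f1 v y = a ∧ qd f2 v y = lam • a) ∧
      (∃ δ > (0 : ℝ), ∀ y : Pt2, |dotp (nuv lam) y + 1 / 2| < δ →
        qd f1 v y = -a ∧ qd f2 v y = -(lam • a)) ∧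
      L = ∫⁻ y in Qlam lam, ENNReal.ofReal (ℓ * W2 W v y + ℓ⁻¹ * hess2d v y) }

/-- Number of interfaces strictly below t. -/
def cnt (m : ℕ) (α : Fin m → ℝ) (t : ℝ) : ℕ := (Finset.univ.filter (fun i => α i < t)).card

end

/-- Squared Euclidean norm on ℝ³. -/
def sqn (v : V3) : ℝ := ∑ i, (v i) ^ 2

/-- Squared Frobenius norm on 3×3 matrices. -/
def sqm (ξ : M33) : ℝ := ∑ j, sqn (ξ j)

theorem sqn_nonneg (v : V3) : 0 ≤ sqn v := Finset.sum_nonneg fun _ _ => sq_nonneg _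

theorem sqm_nonneg (ξ : M33) : 0 ≤ sqm ξ := Finset.sum_nonneg fun _ _ => sqn_nonneg _

theorem vnorm_sq (v : V3) : vnorm v ^ 2 = sqn v := Real.sq_sqrt (sqn_nonneg v)

theorem vnorm_nonneg (v : V3) : 0 ≤ vnorm v := Real.sqrt_nonneg _

theorem mnorm_sq (ξ : M33) : mnorm ξ ^ 2 = sqm ξ := Real.sq_sqrt (sqm_nonneg ξ)

@[fun_prop]
theorem continuous_sqn : Continuous sqn := by unfold sqn; fun_prop

@[fun_prop]
theorem continuous_vnorm : Continuous vnorm := by unfold vnorm; fun_prop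

@[fun_prop]
theorem continuous_sqm : Continuous sqm := by unfold sqm; fun_prop

@[fun_prop]
theorem continuous_mnorm : Continuous mnorm := by unfold mnorm; fun_prop

theorem sqn_neg (v : V3) : sqn (-v) = sqn v := by simp [sqn]

theorem sqn_zero : sqn 0 = 0 := by simp [sqn]

theorem sqn_smul (r : ℝ) (v : V3) : sqn (r • v) = r ^ 2 * sqn v := by
  simp [sqn, mul_pow, Finset.mul_sum]

theorem sqn_add_le (v w : V3) : sqn (v + w) ≤ 2 * sqn v + 2 * sqn w := by
  simp only [sqn, Finset.mul_sum, ← Finset.sum_add_distrib, Pi.add_apply]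
  exact Finset.sum_le_sum fun i _ => by nlinarith [sq_nonneg (v i - w i)]

theorem sqn_pos {v : V3} (h : v ≠ 0) : 0 < sqn v := by
  refine (sqn_nonneg v).lt_of_ne fun h0 => h ?_
  have := (Finset.sum_eq_zero_iff_of_nonneg (fun i _ => sq_nonneg (v i))).1 h0.symm
  ext i
  simpa using this i (Finset.mem_univ i)

theorem sqm_add_le (ξ η : M33) : sqm (ξ + η) ≤ 2 * sqm ξ + 2 * sqm η := by
  simp only [sqm, Finset.mul_sum, ← Finset.sum_add_distrib, Pi.add_apply]
  exact Finset.sum_le_sum fun j _ => sqn_add_le _ _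

theorem sqm_neg (ξ : M33) : sqm (-ξ) = sqm ξ := by simp [sqm, sqn_neg]

theorem mdist_sq (A B ξ : M33) : mdist A B ξ ^ 2 = min (sqm (ξ - A)) (sqm (ξ - B)) := by
  have h1 : 0 ≤ mnorm (ξ - A) := Real.sqrt_nonneg _
  have h2 : 0 ≤ mnorm (ξ - B) := Real.sqrt_nonneg _
  rw [← mnorm_sq, ← mnorm_sq, mdist]
  rcases le_total (mnorm (ξ - A)) (mnorm (ξ - B)) with h | h
  · rw [min_eq_left h, min_eq_left (by gcongr)]
  · rw [min_eq_right h, min_eq_right (by gcongr)]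

theorem mdist_sq_le (A ξ : M33) : mdist A (-A) ξ ^ 2 ≤ 2 * sqm ξ + 2 * sqm A := by
  rw [mdist_sq]
  refine (min_le_right _ _).trans ?_
  rw [sub_neg_eq_add]
  exact sqm_add_le ξ A

theorem sqm_le_mdist_sq (A ξ : M33) : sqm ξ ≤ 2 * mdist A (-A) ξ ^ 2 + 2 * sqm A := by
  rw [mdist_sq]
  have h1 := sqm_add_le (ξ - A) A
  have h2 := sqm_add_le (ξ - -A) (-A)
  rw [sub_add_cancel] at h1 h2
  rw [sqm_neg] at h2
  rcases min_choice (sqm (ξ - A)) (sqm (ξ - -A)) with h | h <;> rw [h] <;> assumption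

/-- The density is comparable to the squared distance from the wells. -/
theorem exists_mdist_bounds {A : M33} {W : M33 → ℝ} (hWc : Continuous W) (h1 : H1 W A (-A))
    (h2 : H2 W 2) (h3 : H3 W A (-A) 2) :
    ∃ c > 0, ∃ C > 0, ∀ ξ, c * mdist A (-A) ξ ^ 2 ≤ W ξ ∧ W ξ ≤ C * mdist A (-A) ξ ^ 2 := by
  obtain ⟨hW0, hWz, -, -⟩ := h1
  obtain ⟨C, hC, hg⟩ := h2
  obtain ⟨r, hr, D, hD, hn⟩ := h3
  simp only [Real.rpow_two] at hg hn
  simp only [mnorm_sq] at hg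
  have hcont : Continuous (mdist A (-A)) := by unfold mdist; fun_prop
  set N : ℝ := 2 * C ^ 2 + sqm A + 1 with hN
  have hA := sqm_nonneg A
  have hNpos : 0 < N := by positivity
  let K : Set M33 := {ξ | sqm ξ ≤ N ∧ r ≤ mdist A (-A) ξ}
  have hK : IsCompact K := by
    refine Metric.isCompact_of_isClosed_isBounded ?_ ?_
    · exact (isClosed_le continuous_sqm continuous_const).inter
        (isClosed_le continuous_const hcont)
    · refine (Metric.isBounded_closedBall (x := (0 : M33)) (r := Real.sqrt N)).subset ?_
      rintro ξ ⟨hξ, -⟩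
      rw [mem_closedBall_zero_iff, pi_norm_le_iff_of_nonneg (Real.sqrt_nonneg _)]
      intro j
      rw [pi_norm_le_iff_of_nonneg (Real.sqrt_nonneg _)]
      intro i
      apply Real.abs_le_sqrt
      calc (ξ j i) ^ 2 ≤ sqn (ξ j) :=
            Finset.single_le_sum (f := fun i => (ξ j i) ^ 2) (fun _ _ => sq_nonneg _)
              (Finset.mem_univ i)
        _ ≤ sqm ξ :=
            Finset.single_le_sum (f := fun j => sqn (ξ j)) (fun _ _ => sqn_nonneg _)
              (Finset.mem_univ j)
        _ ≤ N := hξ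
  obtain ⟨w, hw, hwK⟩ : ∃ w > 0, ∀ ξ ∈ K, w ≤ W ξ := by
    rcases K.eq_empty_or_nonempty with h | h
    · exact ⟨1, one_pos, by simp [h]⟩
    · obtain ⟨x, hx, hmin⟩ := hK.exists_isMinOn h hWc.continuousOn
      refine ⟨W x, (hW0 x).lt_of_ne fun h0 => ?_, fun ξ hξ => hmin hξ⟩
      have : mdist A (-A) x ^ 2 = 0 := by
        rw [mdist_sq]
        rcases (hWz x).1 h0.symm with h | h
        · subst h
          have := sqm_nonneg (x - -x)
          simp [sqm, sqn_zero] at this ⊢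
          exact this
        · rw [h]
          have := sqm_nonneg (-A - A)
          simp [sqm, sqn_zero] at this ⊢
          exact this
      have h2 := hx.2
      nlinarith
  refine ⟨min D⁻¹ (min (8 * C)⁻¹ (w / (2 * N + 2 * sqm A))), by positivity,
    max D (2 * C + (2 * C * sqm A + C) / r ^ 2), by positivity, fun ξ => ⟨?_, ?_⟩⟩
  · have hd := sq_nonneg (mdist A (-A) ξ)
    rcases le_total (mdist A (-A) ξ) r with h | h
    · refine le_trans ?_ (hn ξ h).1
      gcongr
      exact min_le_left _ _
    · have hle := mdist_sq_le A ξ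
      rcases le_total (sqm ξ) N with hξ | hξ
      · refine le_trans ?_ (hwK ξ ⟨hξ, h⟩)
        calc _ ≤ w / (2 * N + 2 * sqm A) * (2 * N + 2 * sqm A) := by
              gcongr
              · exact (min_le_right _ _).trans (min_le_right _ _)
              · linarith
          _ = w := by field_simp
      · refine le_trans ?_ (hg ξ).1
        calc _ ≤ (8 * C)⁻¹ * (4 * sqm ξ) := by
              gcongr
              · exact (min_le_right _ _).trans (min_le_left _ _)
              · nlinarith
          _ ≤ C⁻¹ * sqm ξ - C := by
              have : C ≤ C⁻¹ * sqm ξ / 2 := by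
                rw [le_div_iff₀ two_pos, inv_mul_eq_div, le_div_iff₀ hC]
                nlinarith
              have e : (8 * C)⁻¹ * (4 * sqm ξ) = C⁻¹ * sqm ξ / 2 := by field_simp; ring
              linarith
  · rcases le_total (mdist A (-A) ξ) r with h | h
    · refine (hn ξ h).2.trans ?_
      gcongr
      exact le_max_left _ _
    · refine (hg ξ).2.trans ?_
      have h1 := sqm_le_mdist_sq A ξ
      have h2 : r ^ 2 ≤ mdist A (-A) ξ ^ 2 := by gcongr
      calc C * sqm ξ + C ≤ C * (2 * mdist A (-A) ξ ^ 2 + 2 * sqm A) + C := by gcongr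
        _ = 2 * C * mdist A (-A) ξ ^ 2 + (2 * C * sqm A + C) / r ^ 2 * r ^ 2 := by
            field_simp; ring
        _ ≤ 2 * C * mdist A (-A) ξ ^ 2 + (2 * C * sqm A + C) / r ^ 2 * mdist A (-A) ξ ^ 2 := by
            gcongr
        _ = (2 * C + (2 * C * sqm A + C) / r ^ 2) * mdist A (-A) ξ ^ 2 := by ring
        _ ≤ _ := by gcongr; exact le_max_right _ _

/-- The reduced density `(p, q) ↦ W(p, 0, q)` is continuous and comparable to the squared distance
of `(p, q)` from `{(a, 0), (-a, 0)}`. -/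
structure QuadBounds (W : M33 → ℝ) (a : V3) (c C : ℝ) : Prop where
  cont : Continuous W
  c_pos : 0 < c
  C_pos : 0 < C
  lower : ∀ p q : V3, c * (min (sqn (p - a)) (sqn (p + a)) + sqn q) ≤ W ![p, 0, q]
  upper : ∀ p q : V3, W ![p, 0, q] ≤ C * (min (sqn (p - a)) (sqn (p + a)) + sqn q)

theorem exists_quadBounds {A : M33} {W : M33 → ℝ} {a : V3} (hWc : Continuous W)
    (h1 : H1 W A (-A)) (h2 : H2 W 2) (h3 : H3 W A (-A) 2) (hA0 : A 0 = a) (hA1 : A 1 = 0)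
    (hA2 : A 2 = 0) : ∃ c C, QuadBounds W a c C := by
  obtain ⟨c, hc, C, hC, h⟩ := exists_mdist_bounds hWc h1 h2 h3
  have key : ∀ p q : V3, mdist A (-A) ![p, 0, q] ^ 2
      = min (sqn (p - a)) (sqn (p + a)) + sqn q := by
    intro p q
    rw [mdist_sq, ← min_add_add_right]
    congr 1 <;> simp [sqm, Fin.sum_univ_three, hA0, hA1, hA2, sqn_zero]
  exact ⟨c, C, hWc, hc, hC, fun p q => key p q ▸ (h _).1, fun p q => key p q ▸ (h _).2⟩

namespace QuadBounds

variable {W : M33 → ℝ} {a : V3} {c C : ℝ}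

theorem nonneg (h : QuadBounds W a c C) (p q : V3) : 0 ≤ W ![p, 0, q] :=
  (mul_nonneg h.c_pos.le (add_nonneg (le_min (sqn_nonneg _) (sqn_nonneg _)) (sqn_nonneg _))).trans
    (h.lower p q)

theorem sqn_le (h : QuadBounds W a c C) (p q : V3) : sqn q ≤ c⁻¹ * W ![p, 0, q] := by
  rw [inv_mul_eq_div, le_div_iff₀' h.c_pos]
  refine le_trans ?_ (h.lower p q)
  have := h.c_pos
  gcongr
  have : 0 ≤ min (sqn (p - a)) (sqn (p + a)) := le_min (sqn_nonneg _) (sqn_nonneg _)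
  linarith

theorem le_of_pos (h : QuadBounds W a c C) {p q : V3} :
    W ![p, 0, q] ≤ C * (sqn (p - a) + sqn q) := by
  have := h.C_pos
  refine (h.upper p q).trans ?_
  gcongr
  exact min_le_left _ _

theorem le_of_neg (h : QuadBounds W a c C) {p q : V3} :
    W ![p, 0, q] ≤ C * (sqn (p + a) + sqn q) := by
  have := h.C_pos
  refine (h.upper p q).trans ?_
  gcongr
  exact min_le_right _ _

theorem well_pos (h : QuadBounds W a c C) : W ![a, 0, 0] = 0 := by
  refine le_antisymm ?_ (h.nonneg _ _)
  simpa [sqn_zero] using h.le_of_pos (p := a) (q := 0)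

theorem well_neg (h : QuadBounds W a c C) : W ![-a, 0, 0] = 0 := by
  refine le_antisymm ?_ (h.nonneg _ _)
  simpa [sqn_zero] using h.le_of_neg (p := -a) (q := 0)

end QuadBounds

/-! ### Partial derivatives in the plane -/

theorem hasDerivAt_fst {v : Pt2 → V3} {s t : ℝ} (h : DifferentiableAt ℝ v (s, t)) :
    HasDerivAt (fun x => v (x, t)) (qd f1 v (s, t)) s :=
  h.hasFDerivAt.comp_hasDerivAt s ((hasDerivAt_id s).prodMk (hasDerivAt_const s t))

theorem hasDerivAt_snd {v : Pt2 → V3} {s t : ℝ} (h : DifferentiableAt ℝ v (s, t)) :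
    HasDerivAt (fun x => v (s, x)) (qd f2 v (s, t)) t :=
  h.hasFDerivAt.comp_hasDerivAt t ((hasDerivAt_const t s).prodMk (hasDerivAt_id t))

theorem qd_f1_eq {v : Pt2 → V3} {s t : ℝ} {d : V3} (h : DifferentiableAt ℝ v (s, t))
    (hd : HasDerivAt (fun x => v (x, t)) d s) : qd f1 v (s, t) = d :=
  (hasDerivAt_fst h).unique hd

theorem qd_f2_eq {v : Pt2 → V3} {s t : ℝ} {d : V3} (h : DifferentiableAt ℝ v (s, t))
    (hd : HasDerivAt (fun x => v (s, x)) d t) : qd f2 v (s, t) = d :=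
  (hasDerivAt_snd h).unique hd

theorem contDiff_qd {v : Pt2 → V3} {m n : WithTop ℕ∞} (hv : ContDiff ℝ n v) (hmn : m + 1 ≤ n)
    (e : Pt2) : ContDiff ℝ m (qd e v) :=
  (hv.fderiv_right hmn).clm_apply contDiff_const

theorem contDiff_one_qd {v : Pt2 → V3} (hv : ContDiff ℝ 2 v) (e : Pt2) : ContDiff ℝ 1 (qd e v) :=
  contDiff_qd hv (by norm_num [one_add_one_eq_two]) e

theorem continuous_qd {v : Pt2 → V3} (hv : ContDiff ℝ 1 v) (e : Pt2) : Continuous (qd e v) :=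
  (contDiff_qd (m := 0) hv (by norm_num) e).continuous

theorem continuous_qd_qd {v : Pt2 → V3} (hv : ContDiff ℝ 2 v) (e e' : Pt2) :
    Continuous (qd e' (qd e v)) := continuous_qd (contDiff_one_qd hv e) e'

theorem qd_congr {v w : Pt2 → V3} {y : Pt2} (h : v =ᶠ[𝓝 y] w) (e : Pt2) :
    qd e v y = qd e w y := by
  simp only [qd, h.fderiv_eq]

theorem qd_const (e : Pt2) (d : V3) (y : Pt2) : qd e (fun _ => d) y = 0 := by
  simp [qd]

theorem qd_affine_f1 {v : Pt2 → V3} (hv : Differentiable ℝ v) (c k m k' m' : ℝ) (y : Pt2) :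
    qd f1 (fun y => c • v (k * y.1 + m, k' * y.2 + m')) y
      = (c * k) • qd f1 v (k * y.1 + m, k' * y.2 + m') := by
  have hd : DifferentiableAt ℝ (fun y : Pt2 => c • v (k * y.1 + m, k' * y.2 + m')) (y.1, y.2) := by
    fun_prop
  refine qd_f1_eq hd ?_
  have h1 : HasDerivAt (fun x : ℝ => k * x + m) k y.1 := by
    simpa using ((hasDerivAt_id y.1).const_mul k).add_const m
  have := ((hasDerivAt_fst (hv (k * y.1 + m, k' * y.2 + m'))).scomp y.1 h1).const_smul c
  rwa [smul_smul] at this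

theorem qd_affine_f2 {v : Pt2 → V3} (hv : Differentiable ℝ v) (c k m k' m' : ℝ) (y : Pt2) :
    qd f2 (fun y => c • v (k * y.1 + m, k' * y.2 + m')) y
      = (c * k') • qd f2 v (k * y.1 + m, k' * y.2 + m') := by
  have hd : DifferentiableAt ℝ (fun y : Pt2 => c • v (k * y.1 + m, k' * y.2 + m')) (y.1, y.2) := by
    fun_prop
  refine qd_f2_eq hd ?_
  have h1 : HasDerivAt (fun x : ℝ => k' * x + m') k' y.2 := by
    simpa using ((hasDerivAt_id y.2).const_mul k').add_const m'
  have := ((hasDerivAt_snd (hv (k * y.1 + m, k' * y.2 + m'))).scomp y.2 h1).const_smul c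
  rwa [smul_smul] at this

/-- Squared second derivatives, without square roots. -/
theorem hess2d_eq (v : Pt2 → V3) (y : Pt2) :
    hess2d v y = sqn (qd f1 (qd f1 v) y) + 2 * sqn (qd f2 (qd f1 v) y)
      + sqn (qd f2 (qd f2 v) y) := by
  simp only [hess2d, vnorm_sq]

theorem hess2d_nonneg (v : Pt2 → V3) (y : Pt2) : 0 ≤ hess2d v y := by
  rw [hess2d_eq]
  have h1 := sqn_nonneg (qd f1 (qd f1 v) y)
  have h2 := sqn_nonneg (qd f2 (qd f1 v) y)
  have h3 := sqn_nonneg (qd f2 (qd f2 v) y)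
  positivity

theorem continuous_hess2d {v : Pt2 → V3} (hv : ContDiff ℝ 2 v) : Continuous (hess2d v) := by
  simp only [funext (hess2d_eq v)]
  have h1 := continuous_qd_qd hv f1 f1
  have h2 := continuous_qd_qd hv f1 f2
  have h3 := continuous_qd_qd hv f2 f2
  fun_prop

/-- The energy density of a planar map at unit scale. -/
noncomputable def dens (W : M33 → ℝ) (v : Pt2 → V3) (y : Pt2) : ℝ := W2 W v y + hess2d v y

theorem continuous_W2 {W : M33 → ℝ} (hW : Continuous W) {v : Pt2 → V3} (hv : ContDiff ℝ 2 v) :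
    Continuous (W2 W v) := by
  have h1 := (contDiff_one_qd hv f1).continuous
  have h2 := (contDiff_one_qd hv f2).continuous
  refine hW.comp (continuous_pi fun j => ?_)
  fin_cases j
  · exact h1
  · exact continuous_const
  · exact h2

theorem continuous_dens {W : M33 → ℝ} (hW : Continuous W) {v : Pt2 → V3} (hv : ContDiff ℝ 2 v) :
    Continuous (dens W v) := (continuous_W2 hW hv).add (continuous_hess2d hv)

theorem QuadBounds.dens_nonneg {W : M33 → ℝ} {a : V3} {c C : ℝ} (h : QuadBounds W a c C)
    (v : Pt2 → V3) (y : Pt2) : 0 ≤ dens W v y :=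
  add_nonneg (h.nonneg _ _) (hess2d_nonneg v y)

theorem dens_eq_zero {W : M33 → ℝ} {v : Pt2 → V3} {p : V3} {U : Set Pt2} (hU : IsOpen U)
    (hW : W ![p, 0, 0] = 0) (hv : ∀ y ∈ U, qd f1 v y = p ∧ qd f2 v y = 0) {y : Pt2} (hy : y ∈ U) :
    dens W v y = 0 := by
  have h1 : qd f1 v =ᶠ[𝓝 y] fun _ => p :=
    Filter.eventually_of_mem (hU.mem_nhds hy) fun x hx => (hv x hx).1
  have h2 : qd f2 v =ᶠ[𝓝 y] fun _ => 0 :=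
    Filter.eventually_of_mem (hU.mem_nhds hy) fun x hx => (hv x hx).2
  simp [dens, W2, hess2d_eq, hv y hy, hW, qd_congr h1, qd_congr h2, qd_const, sqn_zero]

theorem qd_periodic {v : Pt2 → V3} {P : ℝ} (hv : ∀ s t, v (s, t + P) = v (s, t)) (e : Pt2)
    (s t : ℝ) : qd e v (s, t + P) = qd e v (s, t) := by
  have h : (fun y : Pt2 => v (y + (0, P))) = v := by
    ext1 ⟨s, t⟩
    simpa using hv s t
  have := fderiv_comp_add_right (𝕜 := ℝ) (f := v) (x := (s, t)) (0, P)
  rw [h] at this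
  simp only [qd, this, Prod.mk_add_mk, add_zero]

theorem dens_periodic (W : M33 → ℝ) {v : Pt2 → V3} {P : ℝ} (hv : ∀ s t, v (s, t + P) = v (s, t))
    (s t : ℝ) : dens W v (s, t + P) = dens W v (s, t) := by
  simp only [dens, W2, hess2d_eq, qd_periodic hv, qd_periodic (qd_periodic hv _)]

/-! ### Iterated integrals of continuous functions -/

theorem lintegral_rect_eq {g : Pt2 → ℝ} (hg : Continuous g) (h0 : ∀ y, 0 ≤ g y) {a b c d : ℝ}
    (hab : a ≤ b) (hcd : c ≤ d) :
    ∫⁻ y in Ioo a b ×ˢ Ioo c d, ENNReal.ofReal (g y)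
      = ENNReal.ofReal (∫ s in a..b, ∫ t in c..d, g (s, t)) := by
  have hint : IntegrableOn g (Ioo a b ×ˢ Ioo c d) :=
    (hg.continuousOn.integrableOn_compact (isCompact_Icc.prod isCompact_Icc)).mono_set
      (prod_mono Ioo_subset_Icc_self Ioo_subset_Icc_self)
  rw [← ofReal_integral_eq_lintegral_ofReal hint (Eventually.of_forall h0),
    Measure.volume_eq_prod, setIntegral_prod _ (by rwa [← Measure.volume_eq_prod])]
  simp only [intervalIntegral.integral_of_le hab, intervalIntegral.integral_of_le hcd,
    integral_Ioc_eq_integral_Ioo]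

theorem continuous_integral_snd {g : Pt2 → ℝ} (hg : Continuous g) (c d : ℝ) :
    Continuous fun s => ∫ t in c..d, g (s, t) :=
  intervalIntegral.continuous_parametric_intervalIntegral_of_continuous'
    (f := fun s t => g (s, t)) hg _ _

theorem integral_swap_of_continuous {g : Pt2 → ℝ} (hg : Continuous g) (a b c d : ℝ) :
    ∫ s in a..b, ∫ t in c..d, g (s, t) = ∫ t in c..d, ∫ s in a..b, g (s, t) := by
  refine MeasureTheory.intervalIntegral_intervalIntegral_swap (F := fun s t => g (s, t)) ?_
  refine ((hg.continuousOn.integrableOn_compact (isCompact_uIcc.prod isCompact_uIcc)).mono_set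
      (prod_mono uIoc_subset_uIcc uIoc_subset_uIcc))

/-! ### Competitors for the cell problem -/

theorem kinfZero_le_of_transition {W : M33 → ℝ} {a : V3} {c C : ℝ} (hW : QuadBounds W a c C)
    {z : Pt2 → V3} (hz : ContDiff ℝ 2 z) {P S₁ S₂ : ℝ} (hP : 0 < P) (hS : S₁ ≤ S₂)
    (hper : ∀ s t, z (s, t + P) = z (s, t))
    (hr : ∀ y : Pt2, S₂ < y.1 → qd f1 z y = a ∧ qd f2 z y = 0)
    (hl : ∀ y : Pt2, y.1 < S₁ → qd f1 z y = -a ∧ qd f2 z y = 0) :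
    KinfZero W a ≤ ENNReal.ofReal (P⁻¹ * ∫ s in S₁..S₂, ∫ t in 0..P, dens W z (s, t)) := by
  obtain ⟨M, hM⟩ := exists_nat_gt ((4 * (|S₁| + |S₂|) + 1) / P)
  rw [div_lt_iff₀ hP] at hM
  set l : ℝ := M * P with hl'
  have hS1 := neg_abs_le S₁
  have hS2 := le_abs_self S₂
  have h1 := abs_nonneg S₁
  have h2 := abs_nonneg S₂
  have hlpos : 0 < l := by linarith
  have hM0 : (M : ℝ) ≠ 0 := by rintro h; simp [hl', h] at hlpos
  set v : Pt2 → V3 := fun y => l⁻¹ • z (l * y.1 + 0, l * y.2 + 0) with hv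
  have hzd : Differentiable ℝ z := hz.differentiable (by norm_num)
  have hv1 : ∀ y, qd f1 v y = qd f1 z (l * y.1 + 0, l * y.2 + 0) := fun y => by
    rw [hv, qd_affine_f1 hzd, inv_mul_cancel₀ hlpos.ne', one_smul]
  have hv2 : ∀ y, qd f2 v y = qd f2 z (l * y.1 + 0, l * y.2 + 0) := fun y => by
    rw [hv, qd_affine_f2 hzd, inv_mul_cancel₀ hlpos.ne', one_smul]
  have hqd (e : Pt2) : Differentiable ℝ (qd e z) := (contDiff_one_qd hz e).differentiable (by simp)
  have hv1' : qd f1 v = fun y => (1 : ℝ) • qd f1 z (l * y.1 + 0, l * y.2 + 0) := by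
    ext1 y; rw [hv1, one_smul]
  have hv2' : qd f2 v = fun y => (1 : ℝ) • qd f2 z (l * y.1 + 0, l * y.2 + 0) := by
    ext1 y; rw [hv2, one_smul]
  have hdens : ∀ y, l * W2 W v y + l⁻¹ * hess2d v y = l * dens W z (l * y.1, l * y.2) := by
    intro y
    rw [hess2d_eq, dens, hess2d_eq, W2, W2, hv1, hv2, hv1', hv2', qd_affine_f1 (hqd _),
      qd_affine_f2 (hqd _), qd_affine_f2 (hqd _)]
    simp only [sqn_smul, add_zero, one_mul]
    field_simp
  have hgc := continuous_dens hW.cont hz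
  refine sInf_le ⟨l, hlpos, v, ?_, ?_, ?_, ?_, ?_⟩
  · have : ContDiff ℝ 2 fun y : Pt2 => (l * y.1 + 0, l * y.2 + 0) := by fun_prop
    exact (hz.comp this).const_smul l⁻¹
  · intro y
    have hp : Function.Periodic (fun t => z (l * y.1 + 0, t)) P := fun t => hper _ t
    have := (hp.nat_mul M) (l * y.2 + 0)
    simp only [hv]
    congr 1
    rw [← this]
    simp only [hl']
    ring_nf
  · refine ⟨1 / 4, by norm_num, fun y hy => ?_⟩
    have : S₂ < l * y.1 + 0 := by nlinarith [(abs_lt.1 hy).1]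
    rw [hv1, hv2]
    exact hr _ this
  · refine ⟨1 / 4, by norm_num, fun y hy => ?_⟩
    have : l * y.1 + 0 < S₁ := by nlinarith [(abs_lt.1 hy).2]
    rw [hv1, hv2]
    exact hl _ this
  · simp only [hdens, II]
    rw [lintegral_rect_eq (g := fun y : Pt2 => l * dens W z (l * y.1, l * y.2)) (by fun_prop)
      (fun y => mul_nonneg hlpos.le (hW.dens_nonneg _ _)) (by norm_num) (by norm_num)]
    congr 1
    set f : ℝ → ℝ := fun s => ∫ t in 0..P, dens W z (s, t) with hf
    have hfc : Continuous f := continuous_integral_snd hgc 0 P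
    have hin : ∀ s, ∫ t in (-(1 / 2 : ℝ))..(1 / 2), l * dens W z (l * s, l * t)
        = M * f (l * s) := by
      intro s
      rw [intervalIntegral.integral_const_mul,
        intervalIntegral.mul_integral_comp_mul_left (f := fun t => dens W z (l * s, t))]
      have hp : Function.Periodic (fun t => dens W z (l * s, t)) P := dens_periodic W hper _
      have h := hp.intervalIntegral_add_zsmul_eq (M : ℤ) (l * -(1 / 2)) (fun a b =>
        Continuous.intervalIntegrable (by fun_prop) _ _)
      rw [show l * -(1 / 2) + (M : ℤ) • P = l * (1 / 2) by simp [hl']; ring] at h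
      rw [h, hp.intervalIntegral_add_eq _ 0, zero_add, zsmul_eq_mul, Int.cast_natCast]
    simp only [hin]
    rw [intervalIntegral.integral_const_mul]
    have hout := intervalIntegral.mul_integral_comp_mul_left (f := f) (c := l) (a := -(1 / 2))
      (b := 1 / 2)
    have hf0 : ∀ s, s < S₁ ∨ S₂ < s → f s = 0 := by
      intro s hs
      have : ∀ t, dens W z (s, t) = 0 := by
        intro t
        rcases hs with hs | hs
        · exact dens_eq_zero (U := {y | y.1 < S₁}) (isOpen_lt continuous_fst continuous_const)
            hW.well_neg hl hs
        · exact dens_eq_zero (U := {y | S₂ < y.1}) (isOpen_lt continuous_const continuous_fst)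
            hW.well_pos hr hs
      simp [hf, this]
    have hii : ∀ x y, IntervalIntegrable f volume x y := fun x y => hfc.intervalIntegrable x y
    have e1 : ∫ s in (l * -(1 / 2))..S₁, f s = 0 := by
      rw [intervalIntegral.integral_congr_ae (g := fun _ => 0)]
      · simp
      · filter_upwards [compl_mem_ae_iff.2 (measure_singleton S₁)] with s hs hs'
        rw [uIoc_of_le (by linarith)] at hs'
        exact hf0 s (Or.inl (lt_of_le_of_ne hs'.2 hs))
    have e2 : ∫ s in S₂..(l * (1 / 2)), f s = 0 := by
      rw [intervalIntegral.integral_congr_ae (g := fun _ => 0)]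
      · simp
      · filter_upwards with s hs'
        rw [uIoc_of_le (by linarith)] at hs'
        exact hf0 s (Or.inr hs'.1)
    have e3 := intervalIntegral.integral_add_adjacent_intervals (hii (l * -(1 / 2)) S₁) (hii S₁ S₂)
    have e4 := intervalIntegral.integral_add_adjacent_intervals (hii (l * -(1 / 2)) S₂)
      (hii S₂ (l * (1 / 2)))
    have : l * ∫ x in -(1 / 2)..(1 / 2), f (l * x) = ∫ s in S₁..S₂, f s := by
      rw [hout]; linarith
    rw [← this, hl']
    field_simp

/-! ### Cutoffs -/

theorem exists_cutoff : ∃ (ψ ψ' ψ'' : ℝ → ℝ) (B : ℝ), ContDiff ℝ 2 ψ ∧ 1 ≤ B ∧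
    (∀ x, HasDerivAt ψ (ψ' x) x) ∧ (∀ x, HasDerivAt ψ' (ψ'' x) x) ∧
    (∀ x ≤ 0, ψ x = 1) ∧ (∀ x, 1 ≤ x → ψ x = 0 ∧ ψ' x = 0 ∧ ψ'' x = 0) ∧
    (∀ x, (ψ x) ^ 2 ≤ B ∧ (ψ' x) ^ 2 ≤ B ∧ (ψ'' x) ^ 2 ≤ B) := by
  set ψ : ℝ → ℝ := fun x => 1 - Real.smoothTransition x with hψ
  have hc : ContDiff ℝ 2 ψ := contDiff_const.sub Real.smoothTransition.contDiff
  have hc1 : ContDiff ℝ 1 (deriv ψ) := by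
    have : ContDiff ℝ (1 + 1) ψ := by simpa [one_add_one_eq_two] using hc
    exact (contDiff_succ_iff_deriv.1 this).2.2
  have hc0 : Continuous (deriv (deriv ψ)) := hc1.continuous_deriv (by simp)
  have hd : ∀ x, HasDerivAt ψ (deriv ψ x) x := fun x =>
    (hc.differentiable (by simp) x).hasDerivAt
  have hd1 : ∀ x, HasDerivAt (deriv ψ) (deriv (deriv ψ) x) x := fun x =>
    (hc1.differentiable (by simp) x).hasDerivAt
  have h0 : ∀ x ≤ 0, ψ x = 1 := fun x hx => by simp [hψ, Real.smoothTransition.zero_of_nonpos hx]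
  have h1 : ∀ x, 1 ≤ x → ψ x = 0 := fun x hx => by
    simp [hψ, Real.smoothTransition.one_of_one_le hx]
  have e0 : ∀ x < 0, deriv ψ x = 0 := fun x hx => by
    have : ψ =ᶠ[𝓝 x] fun _ => 1 := by
      filter_upwards [gt_mem_nhds hx] with y hy using h0 y hy.le
    simp [this.deriv_eq]
  have e1 : ∀ x, 1 < x → deriv ψ x = 0 := fun x hx => by
    have : ψ =ᶠ[𝓝 x] fun _ => 0 := by
      filter_upwards [lt_mem_nhds hx] with y hy using h1 y hy.le
    simp [this.deriv_eq]
  have e0' : ∀ x < 0, deriv (deriv ψ) x = 0 := fun x hx => by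
    have : deriv ψ =ᶠ[𝓝 x] fun _ => 0 := by
      filter_upwards [gt_mem_nhds hx] with y hy using e0 y hy
    simp [this.deriv_eq]
  have e1' : ∀ x, 1 < x → deriv (deriv ψ) x = 0 := fun x hx => by
    have : deriv ψ =ᶠ[𝓝 x] fun _ => 0 := by
      filter_upwards [lt_mem_nhds hx] with y hy using e1 y hy
    simp [this.deriv_eq]
  have ext (f : ℝ → ℝ) (hf : Continuous f) (h : ∀ x, 1 < x → f x = 0) : ∀ x, 1 ≤ x → f x = 0 := by
    have hcl : IsClosed {x | f x = 0} := isClosed_eq hf continuous_const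
    have : Ici (1 : ℝ) ⊆ {x | f x = 0} := by
      rw [← closure_Ioi (1 : ℝ)]
      exact closure_minimal h hcl
    exact this
  have bd (f : ℝ → ℝ) (hf : Continuous f) (h : ∀ x < 0, f x = 0) (h' : ∀ x, 1 < x → f x = 0) :
      ∃ B, ∀ x, (f x) ^ 2 ≤ B := by
    obtain ⟨M, hM⟩ := (isCompact_Icc (a := (0 : ℝ)) (b := 1)).exists_bound_of_continuousOn
      (f := fun x => (f x) ^ 2) (by fun_prop)
    refine ⟨max M 0, fun x => ?_⟩
    rcases lt_or_ge x 0 with hx | hx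
    · simp [h x hx]
    rcases lt_or_ge 1 x with hx' | hx'
    · simp [h' x hx']
    · exact (le_abs_self _).trans ((hM x ⟨hx, hx'⟩).trans (le_max_left _ _))
  obtain ⟨B1, hB1⟩ := bd _ hc1.continuous e0 e1
  obtain ⟨B2, hB2⟩ := bd _ hc0 e0' e1'
  refine ⟨ψ, deriv ψ, deriv (deriv ψ), max 1 (max B1 B2), hc, le_max_left _ _, hd, hd1, h0,
    fun x hx => ⟨h1 x hx, ext _ hc1.continuous e1 x hx, ext _ hc0 e1' x hx⟩, fun x => ⟨?_, ?_, ?_⟩⟩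
  · refine le_trans ?_ (le_max_left _ _)
    have h2 := Real.smoothTransition.nonneg x
    have h3 := Real.smoothTransition.le_one x
    simp only [hψ]
    nlinarith
  · exact (hB1 x).trans ((le_max_left _ _).trans (le_max_right _ _))
  · exact (hB2 x).trans ((le_max_right _ _).trans (le_max_right _ _))

/-! ### Elementary estimates for `sqn` -/

theorem sqn_sub_le (v w : V3) : sqn (v - w) ≤ 2 * sqn v + 2 * sqn w := by
  have := sqn_add_le v (-w)
  rwa [sqn_neg, ← sub_eq_add_neg] at this

theorem sq_integral_le {f : ℝ → ℝ} (hf : Continuous f) {L : ℝ} (hL : 0 ≤ L) :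
    (∫ x in 0..L, f x) ^ 2 ≤ L * ∫ x in 0..L, (f x) ^ 2 := by
  rcases hL.eq_or_lt with rfl | hL
  · simp
  set m := (∫ x in 0..L, f x) / L with hm
  have h0 : 0 ≤ ∫ x in 0..L, (f x - m) ^ 2 :=
    intervalIntegral.integral_nonneg hL.le fun x _ => sq_nonneg _
  have h1 : ∫ x in 0..L, (f x - m) ^ 2
      = (∫ x in 0..L, (f x) ^ 2) - 2 * m * (∫ x in 0..L, f x) + m ^ 2 * L := by
    have : ∀ x, (f x - m) ^ 2 = (f x) ^ 2 - 2 * m * f x + m ^ 2 := fun x => by ring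
    simp only [this]
    rw [intervalIntegral.integral_add, intervalIntegral.integral_sub,
      intervalIntegral.integral_const_mul, intervalIntegral.integral_const]
    · simp; ring
    all_goals exact Continuous.intervalIntegrable (by fun_prop) _ _
  have h2 : ∫ x in 0..L, f x = m * L := by rw [hm]; field_simp
  rw [h1, h2] at h0
  rw [h2]
  nlinarith

theorem sqn_sub_le_integral {f f' : ℝ → V3} (hf : ∀ x, HasDerivAt f (f' x) x)
    (hc : Continuous f') {x L : ℝ} (hx : 0 ≤ x) (hxL : x ≤ L) :
    sqn (f x - f 0) ≤ L * ∫ t in 0..L, sqn (f' t) := by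
  have hi : ∀ i, Continuous fun t => f' t i := fun i => by fun_prop
  have h1 : ∀ i, (f x i - f 0 i) ^ 2 ≤ x * ∫ t in 0..x, (f' t i) ^ 2 := by
    intro i
    have h := intervalIntegral.integral_eq_sub_of_hasDerivAt (a := 0) (b := x)
      (fun t _ => (hasDerivAt_pi.1 (hf t)) i) ((hi i).intervalIntegrable _ _)
    rw [← h]
    exact sq_integral_le (hi i) hx
  calc sqn (f x - f 0) ≤ ∑ i, x * ∫ t in 0..x, (f' t i) ^ 2 := Finset.sum_le_sum fun i _ => h1 i
    _ = x * ∫ t in 0..x, sqn (f' t) := by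
        rw [← Finset.mul_sum]
        simp only [sqn]
        rw [intervalIntegral.integral_finsetSum]
        exact fun i _ => Continuous.intervalIntegrable (by fun_prop) _ _
    _ ≤ L * ∫ t in 0..L, sqn (f' t) := by
        have h0 : 0 ≤ ∫ t in 0..x, sqn (f' t) :=
          intervalIntegral.integral_nonneg hx fun t _ => sqn_nonneg _
        refine mul_le_mul hxL ?_ h0 (hx.trans hxL)
        have hs : ∀ a b, IntervalIntegrable (fun t => sqn (f' t)) volume a b := fun a b =>
          Continuous.intervalIntegrable (by fun_prop) _ _
        rw [← intervalIntegral.integral_add_adjacent_intervals (hs 0 x) (hs x L)]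
        have : 0 ≤ ∫ t in x..L, sqn (f' t) :=
          intervalIntegral.integral_nonneg hxL fun t _ => sqn_nonneg _
        linarith

/-- The transversal part of the energy of a planar map. -/
noncomputable def transv (z : Pt2 → V3) (y : Pt2) : ℝ := sqn (qd f2 z y) + hess2d z y

theorem transv_nonneg (z : Pt2 → V3) (y : Pt2) : 0 ≤ transv z y :=
  add_nonneg (sqn_nonneg _) (hess2d_nonneg _ _)

theorem continuous_transv {z : Pt2 → V3} (hz : ContDiff ℝ 2 z) : Continuous (transv z) :=
  (continuous_sqn.comp (contDiff_one_qd hz f2).continuous).add (continuous_hess2d hz)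

/-- Interpolation between a planar map on the left half plane and an affine map further right. -/
noncomputable def interp (ψ : ℝ → ℝ) (P : ℝ) (α : V3) (z : Pt2 → V3) (y : Pt2) : V3 :=
  y.1 • α + z (0, 0) + ψ (y.1 / P) • (z (0, y.2) - z (0, 0))
    + ψ y.1 • (z y - y.1 • α - z (0, y.2))

section Interp

variable {ψ ψ' ψ'' : ℝ → ℝ} {z : Pt2 → V3} {P : ℝ} {α : V3}

theorem contDiff_interp (hψ : ContDiff ℝ 2 ψ) (hz : ContDiff ℝ 2 z) (P : ℝ) (α : V3) :
    ContDiff ℝ 2 (interp ψ P α z) := by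
  have h1 : ContDiff ℝ 2 fun y : Pt2 => z (0, y.2) := hz.comp (by fun_prop)
  have h2 : ContDiff ℝ 2 fun y : Pt2 => ψ (y.1 / P) := hψ.comp (by fun_prop)
  have h3 : ContDiff ℝ 2 fun y : Pt2 => ψ y.1 := hψ.comp (by fun_prop)
  unfold interp
  fun_prop

theorem qd_f1_interp (hψ : ContDiff ℝ 2 ψ) (hz : ContDiff ℝ 2 z)
    (hd : ∀ x, HasDerivAt ψ (ψ' x) x) (s t : ℝ) :
    qd f1 (interp ψ P α z) (s, t) = α + (P⁻¹ * ψ' (s / P)) • (z (0, t) - z (0, 0))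
      + ψ' s • (z (s, t) - s • α - z (0, t)) + ψ s • (qd f1 z (s, t) - α) := by
  refine qd_f1_eq ((contDiff_interp hψ hz P α).differentiable (by simp) _) ?_
  have hz1 := hasDerivAt_fst (hz.differentiable (by simp) (s, t))
  have hP : HasDerivAt (fun x => ψ (x / P)) (P⁻¹ * ψ' (s / P)) s := by
    have h : HasDerivAt (fun x : ℝ => x / P) P⁻¹ s := by
      simpa [one_div] using (hasDerivAt_id s).div_const P
    exact ((hd (s / P)).comp s h).congr_deriv (by ring)
  have hα : HasDerivAt (fun x : ℝ => x • α) α s := by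
    simpa using (hasDerivAt_id s).smul_const α
  have := ((hα.add_const (z (0, 0))).add (hP.smul_const (z (0, t) - z (0, 0)))).add
    ((hd s).smul ((hz1.sub hα).sub_const (z (0, t))))
  refine this.congr_deriv ?_
  ext i
  simp
  ring

theorem qd_f2_interp (hψ : ContDiff ℝ 2 ψ) (hz : ContDiff ℝ 2 z) (s t : ℝ) :
    qd f2 (interp ψ P α z) (s, t) = ψ (s / P) • qd f2 z (0, t)
      + ψ s • (qd f2 z (s, t) - qd f2 z (0, t)) := by
  refine qd_f2_eq ((contDiff_interp hψ hz P α).differentiable (by simp) _) ?_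
  have hz2 := hasDerivAt_snd (hz.differentiable (by simp) (s, t))
  have hz0 := hasDerivAt_snd (hz.differentiable (by simp) (0, t))
  have := (((hz0.sub_const (z (0, 0))).const_smul (ψ (s / P))).const_add (s • α + z (0, 0))).add
    (((hz2.sub_const (s • α)).sub hz0).const_smul (ψ s))
  exact this

theorem qd_f1_f1_interp (hψ : ContDiff ℝ 2 ψ) (hz : ContDiff ℝ 2 z)
    (hd : ∀ x, HasDerivAt ψ (ψ' x) x) (hd' : ∀ x, HasDerivAt ψ' (ψ'' x) x) (s t : ℝ) :
    qd f1 (qd f1 (interp ψ P α z)) (s, t) = (P⁻¹ ^ 2 * ψ'' (s / P)) • (z (0, t) - z (0, 0))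
      + ψ'' s • (z (s, t) - s • α - z (0, t)) + (2 * ψ' s) • (qd f1 z (s, t) - α)
      + ψ s • qd f1 (qd f1 z) (s, t) := by
  have hi := contDiff_interp hψ hz P α
  refine qd_f1_eq ((contDiff_one_qd hi f1).differentiable (by simp) _) ?_
  simp only [qd_f1_interp hψ hz hd]
  have hz1 := hasDerivAt_fst (hz.differentiable (by simp) (s, t))
  have hz11 := hasDerivAt_fst ((contDiff_one_qd hz f1).differentiable (by simp) (s, t))
  have hP : HasDerivAt (fun x => P⁻¹ * ψ' (x / P)) (P⁻¹ ^ 2 * ψ'' (s / P)) s := by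
    have h : HasDerivAt (fun x : ℝ => x / P) P⁻¹ s := by
      simpa [one_div] using (hasDerivAt_id s).div_const P
    exact (((hd' (s / P)).comp s h).const_mul P⁻¹).congr_deriv (by ring)
  have hα : HasDerivAt (fun x : ℝ => x • α) α s := by
    simpa using (hasDerivAt_id s).smul_const α
  have := (((hP.smul_const (z (0, t) - z (0, 0))).const_add α).add
    ((hd' s).smul ((hz1.sub hα).sub_const (z (0, t))))).add
    ((hd s).smul (hz11.sub_const α))
  refine this.congr_deriv ?_
  ext i
  simp
  ring

theorem qd_f2_f1_interp (hψ : ContDiff ℝ 2 ψ) (hz : ContDiff ℝ 2 z)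
    (hd : ∀ x, HasDerivAt ψ (ψ' x) x) (s t : ℝ) :
    qd f2 (qd f1 (interp ψ P α z)) (s, t) = (P⁻¹ * ψ' (s / P)) • qd f2 z (0, t)
      + ψ' s • (qd f2 z (s, t) - qd f2 z (0, t)) + ψ s • qd f2 (qd f1 z) (s, t) := by
  have hi := contDiff_interp hψ hz P α
  refine qd_f2_eq ((contDiff_one_qd hi f1).differentiable (by simp) _) ?_
  simp only [qd_f1_interp hψ hz hd]
  have hz2 := hasDerivAt_snd (hz.differentiable (by simp) (s, t))
  have hz0 := hasDerivAt_snd (hz.differentiable (by simp) (0, t))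
  have hz12 := hasDerivAt_snd ((contDiff_one_qd hz f1).differentiable (by simp) (s, t))
  exact ((((hz0.sub_const (z (0, 0))).const_smul (P⁻¹ * ψ' (s / P))).const_add α).add
    (((hz2.sub_const (s • α)).sub hz0).const_smul (ψ' s))).add
    ((hz12.sub_const α).const_smul (ψ s))

theorem qd_f2_f2_interp (hψ : ContDiff ℝ 2 ψ) (hz : ContDiff ℝ 2 z) (s t : ℝ) :
    qd f2 (qd f2 (interp ψ P α z)) (s, t) = ψ (s / P) • qd f2 (qd f2 z) (0, t)
      + ψ s • (qd f2 (qd f2 z) (s, t) - qd f2 (qd f2 z) (0, t)) := by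
  have hi := contDiff_interp hψ hz P α
  refine qd_f2_eq ((contDiff_one_qd hi f2).differentiable (by simp) _) ?_
  simp only [qd_f2_interp hψ hz]
  have hz2 := hasDerivAt_snd ((contDiff_one_qd hz f2).differentiable (by simp) (s, t))
  have hz0 := hasDerivAt_snd ((contDiff_one_qd hz f2).differentiable (by simp) (0, t))
  exact (hz0.const_smul (ψ (s / P))).add ((hz2.sub hz0).const_smul (ψ s))

end Interp

theorem add_four_sub (u v w x : V3) : u + v + w + x - u = v + w + x := by abel

theorem sqn_three_le (u v w : V3) : sqn (u + v + w) ≤ 4 * (sqn u + sqn v + sqn w) := by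
  have h1 := sqn_add_le (u + v) w
  have h2 := sqn_add_le u v
  have h3 := sqn_nonneg w
  linarith

theorem sqn_four_le (u v w x : V3) :
    sqn (u + v + w + x) ≤ 8 * (sqn u + sqn v + sqn w + sqn x) := by
  have h1 := sqn_add_le (u + v + w) x
  have h2 := sqn_three_le u v w
  have h3 := sqn_nonneg x
  linarith

/-- The distance of a planar map from an affine map, to second order. -/
noncomputable def devi (α : V3) (z : Pt2 → V3) (y : Pt2) : ℝ :=
  sqn (qd f1 z y - α) + transv z y

theorem devi_nonneg (α : V3) (z : Pt2 → V3) (y : Pt2) : 0 ≤ devi α z y :=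
  add_nonneg (sqn_nonneg _) (transv_nonneg _ _)

theorem continuous_devi (α : V3) {z : Pt2 → V3} (hz : ContDiff ℝ 2 z) : Continuous (devi α z) := by
  have h1 := (contDiff_one_qd hz f1).continuous
  have h2 := continuous_transv hz
  unfold devi
  fun_prop

section Bounds

variable {ψ ψ' ψ'' : ℝ → ℝ} {z : Pt2 → V3} {P B : ℝ} {α : V3}

/-- Pointwise bound in the region where only the trace at `0` matters. -/
theorem devi_interp_far (hψ : ContDiff ℝ 2 ψ) (hz : ContDiff ℝ 2 z) (hP : 1 ≤ P) (hB : 1 ≤ B)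
    (hd : ∀ x, HasDerivAt ψ (ψ' x) x) (hd' : ∀ x, HasDerivAt ψ' (ψ'' x) x)
    (hone : ∀ x, 1 ≤ x → ψ x = 0 ∧ ψ' x = 0 ∧ ψ'' x = 0)
    (hbd : ∀ x, (ψ x) ^ 2 ≤ B ∧ (ψ' x) ^ 2 ≤ B ∧ (ψ'' x) ^ 2 ≤ B) {s t : ℝ} (hs : 1 ≤ s) :
    devi α (interp ψ P α z) (s, t) ≤
      4 * B * (P⁻¹ * P⁻¹ * sqn (z (0, t) - z (0, 0)) + transv z (0, t)) := by
  obtain ⟨e1, e2, e3⟩ := hone s hs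
  obtain ⟨b1, b2, b3⟩ := hbd (s / P)
  have hP1 : P⁻¹ ≤ 1 := inv_le_one_of_one_le₀ hP
  have hP0 : 0 < P⁻¹ := by positivity
  have hB0 : 0 < B := by positivity
  rw [devi, transv, hess2d_eq, qd_f1_interp hψ hz hd, qd_f2_interp hψ hz,
    qd_f1_f1_interp hψ hz hd hd', qd_f2_f1_interp hψ hz hd, qd_f2_f2_interp hψ hz,
    transv, hess2d_eq]
  simp only [e1, e2, e3, zero_smul, add_zero, mul_zero, add_sub_cancel_left, sqn_smul]
  have n0 := sqn_nonneg (z (0, t) - z (0, 0))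
  have n1 := sqn_nonneg (qd f1 (qd f1 z) (0, t))
  have n2 := sqn_nonneg (qd f2 z (0, t))
  have n3 := sqn_nonneg (qd f2 (qd f2 z) (0, t))
  have n4 := sqn_nonneg (qd f2 (qd f1 z) (0, t))
  have c1 : (P⁻¹ * ψ' (s / P)) ^ 2 ≤ B * (P⁻¹ * P⁻¹) := by
    rw [mul_pow, mul_comm, ← sq]; gcongr
  have c2 : (P⁻¹ ^ 2 * ψ'' (s / P)) ^ 2 ≤ B * (P⁻¹ * P⁻¹) := by
    calc (P⁻¹ ^ 2 * ψ'' (s / P)) ^ 2 = ψ'' (s / P) ^ 2 * (P⁻¹ * P⁻¹) * (P⁻¹ * P⁻¹) := by ring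
      _ ≤ B * (P⁻¹ * P⁻¹) * (1 * 1) := by gcongr
      _ = _ := by ring
  have c3 : (P⁻¹ * ψ' (s / P)) ^ 2 ≤ B := by
    refine c1.trans ?_
    calc B * (P⁻¹ * P⁻¹) ≤ B * (1 * 1) := by gcongr
      _ = B := by ring
  have d1 := mul_le_mul_of_nonneg_right c1 n0
  have d2 := mul_le_mul_of_nonneg_right c2 n0
  have d3 := mul_le_mul_of_nonneg_right c3 n2
  have d4 := mul_le_mul_of_nonneg_right b1 n2
  have d5 := mul_le_mul_of_nonneg_right b1 n3
  have m1 := mul_nonneg hB0.le n1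
  have m2 := mul_nonneg hB0.le n2
  have m3 := mul_nonneg hB0.le n3
  have m4 := mul_nonneg hB0.le n4
  have m0 := mul_nonneg (mul_nonneg hB0.le (mul_nonneg hP0.le hP0.le)) n0
  linarith

/-- Pointwise bound near the interface. -/
theorem devi_interp_near (hψ : ContDiff ℝ 2 ψ) (hz : ContDiff ℝ 2 z) (hP : 1 ≤ P) (hB : 1 ≤ B)
    (hd : ∀ x, HasDerivAt ψ (ψ' x) x) (hd' : ∀ x, HasDerivAt ψ' (ψ'' x) x)
    (hbd : ∀ x, (ψ x) ^ 2 ≤ B ∧ (ψ' x) ^ 2 ≤ B ∧ (ψ'' x) ^ 2 ≤ B) (s t : ℝ) :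
    devi α (interp ψ P α z) (s, t) ≤
      100 * B * (P⁻¹ * P⁻¹ * sqn (z (0, t) - z (0, 0)) + transv z (0, t)
        + sqn (z (s, t) - s • α - z (0, t)) + sqn (qd f1 z (s, t) - α) + transv z (s, t)) := by
  obtain ⟨a1, a2, a3⟩ := hbd s
  obtain ⟨b1, b2, b3⟩ := hbd (s / P)
  have hP1 : P⁻¹ ≤ 1 := inv_le_one_of_one_le₀ hP
  have hP0 : 0 < P⁻¹ := by positivity
  have hB0 : 0 < B := by positivity
  rw [devi, transv, hess2d_eq, qd_f1_interp hψ hz hd, qd_f2_interp hψ hz,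
    qd_f1_f1_interp hψ hz hd hd', qd_f2_f1_interp hψ hz hd, qd_f2_f2_interp hψ hz,
    transv, transv, hess2d_eq, hess2d_eq]
  rw [add_four_sub]
  have t1 := sqn_three_le ((P⁻¹ * ψ' (s / P)) • (z (0, t) - z (0, 0)))
    (ψ' s • (z (s, t) - s • α - z (0, t))) (ψ s • (qd f1 z (s, t) - α))
  have t2 := sqn_add_le (ψ (s / P) • qd f2 z (0, t)) (ψ s • (qd f2 z (s, t) - qd f2 z (0, t)))
  have t3 := sqn_four_le ((P⁻¹ ^ 2 * ψ'' (s / P)) • (z (0, t) - z (0, 0)))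
    (ψ'' s • (z (s, t) - s • α - z (0, t))) ((2 * ψ' s) • (qd f1 z (s, t) - α))
    (ψ s • qd f1 (qd f1 z) (s, t))
  have t4 := sqn_three_le ((P⁻¹ * ψ' (s / P)) • qd f2 z (0, t))
    (ψ' s • (qd f2 z (s, t) - qd f2 z (0, t))) (ψ s • qd f2 (qd f1 z) (s, t))
  have t5 := sqn_add_le (ψ (s / P) • qd f2 (qd f2 z) (0, t))
    (ψ s • (qd f2 (qd f2 z) (s, t) - qd f2 (qd f2 z) (0, t)))
  simp only [sqn_smul] at t1 t2 t3 t4 t5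
  have r1 := sqn_sub_le (qd f2 z (s, t)) (qd f2 z (0, t))
  have r2 := sqn_sub_le (qd f2 (qd f2 z) (s, t)) (qd f2 (qd f2 z) (0, t))
  have n0 := sqn_nonneg (z (0, t) - z (0, 0))
  have n1 := sqn_nonneg (qd f1 (qd f1 z) (0, t))
  have n2 := sqn_nonneg (qd f2 z (0, t))
  have n3 := sqn_nonneg (qd f2 (qd f2 z) (0, t))
  have n4 := sqn_nonneg (qd f2 (qd f1 z) (0, t))
  have n5 := sqn_nonneg (qd f1 (qd f1 z) (s, t))
  have n6 := sqn_nonneg (qd f2 z (s, t))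
  have n7 := sqn_nonneg (qd f2 (qd f2 z) (s, t))
  have n8 := sqn_nonneg (qd f2 (qd f1 z) (s, t))
  have n9 := sqn_nonneg (z (s, t) - s • α - z (0, t))
  have n10 := sqn_nonneg (qd f1 z (s, t) - α)
  have n11 := sqn_nonneg (qd f2 z (s, t) - qd f2 z (0, t))
  have n12 := sqn_nonneg (qd f2 (qd f2 z) (s, t) - qd f2 (qd f2 z) (0, t))
  have c1 : (P⁻¹ * ψ' (s / P)) ^ 2 ≤ B * (P⁻¹ * P⁻¹) := by
    rw [mul_pow, mul_comm, ← sq]; gcongr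
  have c2 : (P⁻¹ ^ 2 * ψ'' (s / P)) ^ 2 ≤ B * (P⁻¹ * P⁻¹) := by
    calc (P⁻¹ ^ 2 * ψ'' (s / P)) ^ 2 = ψ'' (s / P) ^ 2 * (P⁻¹ * P⁻¹) * (P⁻¹ * P⁻¹) := by ring
      _ ≤ B * (P⁻¹ * P⁻¹) * (1 * 1) := by gcongr
      _ = _ := by ring
  have c3 : (P⁻¹ * ψ' (s / P)) ^ 2 ≤ B := by
    refine c1.trans ?_
    calc B * (P⁻¹ * P⁻¹) ≤ B * (1 * 1) := by gcongr
      _ = B := by ring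
  have c4 : (2 * ψ' s) ^ 2 ≤ 4 * B := by nlinarith
  have d1 := mul_le_mul_of_nonneg_right c1 n0
  have d2 := mul_le_mul_of_nonneg_right c2 n0
  have d3 := mul_le_mul_of_nonneg_right c3 n2
  have d4 := mul_le_mul_of_nonneg_right b1 n2
  have d5 := mul_le_mul_of_nonneg_right b1 n3
  have d6 := mul_le_mul_of_nonneg_right c4 n10
  have d7 := mul_le_mul_of_nonneg_right a1 n10
  have d8 := mul_le_mul_of_nonneg_right a2 n9
  have d9 := mul_le_mul_of_nonneg_right a3 n9
  have d10 := mul_le_mul_of_nonneg_right a1 n11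
  have d11 := mul_le_mul_of_nonneg_right a2 n11
  have d12 := mul_le_mul_of_nonneg_right a1 n12
  have d13 := mul_le_mul_of_nonneg_right a1 n5
  have d14 := mul_le_mul_of_nonneg_right a1 n8
  have q1 := mul_le_mul_of_nonneg_left r1 hB0.le
  have q2 := mul_le_mul_of_nonneg_left r2 hB0.le
  have m0 := mul_nonneg (mul_nonneg hB0.le (mul_nonneg hP0.le hP0.le)) n0
  have m1 := mul_nonneg hB0.le n1
  have m2 := mul_nonneg hB0.le n2
  have m3 := mul_nonneg hB0.le n3
  have m4 := mul_nonneg hB0.le n4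
  have m5 := mul_nonneg hB0.le n5
  have m6 := mul_nonneg hB0.le n6
  have m7 := mul_nonneg hB0.le n7
  have m8 := mul_nonneg hB0.le n8
  have m9 := mul_nonneg hB0.le n9
  have m10 := mul_nonneg hB0.le n10
  linarith

end Bounds

theorem sqn_f1_f1_le_transv (z : Pt2 → V3) (y : Pt2) : sqn (qd f1 (qd f1 z) y) ≤ transv z y := by
  have h1 := sqn_nonneg (qd f2 (qd f1 z) y)
  have h2 := sqn_nonneg (qd f2 (qd f2 z) y)
  have h3 := sqn_nonneg (qd f2 z y)
  rw [transv, hess2d_eq]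
  linarith

theorem sqn_f2_le_transv (z : Pt2 → V3) (y : Pt2) : sqn (qd f2 z y) ≤ transv z y :=
  le_add_of_nonneg_right (hess2d_nonneg _ _)

theorem integral_mono_cont {f g : ℝ → ℝ} (hf : Continuous f) (hg : Continuous g) {a b : ℝ}
    (hab : a ≤ b) (h : ∀ x ∈ Icc a b, f x ≤ g x) : ∫ x in a..b, f x ≤ ∫ x in a..b, g x :=
  intervalIntegral.integral_mono_on hab (hf.intervalIntegrable _ _) (hg.intervalIntegrable _ _) h

/-- A periodic map can be made affine to the right of `P`, at a cost controlled by its trace at `0`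
and its transversal energy in a strip of unit width. -/
theorem exists_truncation_zero : ∃ C > 0, ∀ (P : ℝ), 1 ≤ P → ∀ (z : Pt2 → V3) (α : V3),
    ContDiff ℝ 2 z → (∀ s t, z (s, t + P) = z (s, t)) →
    ∃ w : Pt2 → V3, ContDiff ℝ 2 w ∧ (∀ s t, w (s, t + P) = w (s, t)) ∧
      (∀ y : Pt2, y.1 ≤ 0 → w y = z y) ∧
      (∀ y : Pt2, P < y.1 → qd f1 w y = α ∧ qd f2 w y = 0) ∧
      ∫ s in 0..P, ∫ t in 0..P, devi α w (s, t) ≤ C * P * ((∫ t in 0..P, devi α z (0, t))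
        + ∫ s in 0..1, ∫ t in 0..P, transv z (s, t)) := by
  obtain ⟨ψ, ψ', ψ'', B, hψ, hB, hd, hd', hzero, hone, hbd⟩ := exists_cutoff
  have hB0 : 0 < B := by positivity
  refine ⟨1000 * B, by positivity, fun P hP z α hz hper => ?_⟩
  have hP0 : 0 < P := by positivity
  have hi := contDiff_interp hψ hz P α
  refine ⟨interp ψ P α z, hi, ?_, ?_, ?_, ?_⟩
  · intro s t
    simp only [interp, hper]
  · rintro ⟨s, t⟩ hs
    have h1 : ψ (s / P) = 1 := hzero _ (div_nonpos_of_nonpos_of_nonneg hs hP0.le)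
    have h2 : ψ s = 1 := hzero _ hs
    simp only [interp, h1, h2, one_smul]
    abel
  · rintro ⟨s, t⟩ hs
    have hs : P < s := hs
    obtain ⟨e1, e2, -⟩ := hone s (hP.trans hs.le)
    obtain ⟨e3, e4, -⟩ := hone (s / P) (by rw [le_div_iff₀ hP0]; linarith)
    rw [qd_f1_interp hψ hz hd, qd_f2_interp hψ hz]
    simp [e1, e2, e3, e4]
  set e₀ := ∫ t in 0..P, devi α z (0, t) with he₀
  set e₁ := ∫ s in 0..1, ∫ t in 0..P, transv z (s, t) with he₁
  have ct := continuous_transv hz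
  have cd := continuous_devi α hz
  have cw := continuous_devi α hi
  have c1 := (contDiff_one_qd hz f1).continuous
  have c2 := (contDiff_one_qd hz f2).continuous
  have c11 := continuous_qd_qd hz f1 f1
  have hzd := hz.differentiable (by simp)
  have hz1d := (contDiff_one_qd hz f1).differentiable (by simp)
  have cf : Continuous fun s => ∫ t in 0..P, transv z (s, t) := continuous_integral_snd ct 0 P
  have cF : Continuous fun s => ∫ t in 0..P, devi α (interp ψ P α z) (s, t) :=
    continuous_integral_snd cw 0 P
  have he₀0 : 0 ≤ e₀ := intervalIntegral.integral_nonneg hP0.le fun t _ => devi_nonneg _ _ _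
  have he₁0 : 0 ≤ e₁ := intervalIntegral.integral_nonneg zero_le_one fun s _ =>
    intervalIntegral.integral_nonneg hP0.le fun t _ => transv_nonneg _ _
  have htr : ∫ t in 0..P, transv z (0, t) ≤ e₀ :=
    integral_mono_cont (by fun_prop) (by fun_prop) hP0.le fun t _ =>
      le_add_of_nonneg_left (sqn_nonneg _)
  have hG : ∀ t ∈ Icc 0 P, P⁻¹ * P⁻¹ * sqn (z (0, t) - z (0, 0)) ≤ P⁻¹ * e₀ := by
    intro t ht
    have h1 := sqn_sub_le_integral (f := fun t => z (0, t)) (f' := fun t => qd f2 z (0, t))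
      (fun t => hasDerivAt_snd (hzd _)) (by fun_prop) ht.1 ht.2
    have h2 : ∫ t in 0..P, sqn (qd f2 z (0, t)) ≤ e₀ :=
      (integral_mono_cont (by fun_prop) (by fun_prop) hP0.le fun t _ =>
        sqn_f2_le_transv _ _).trans htr
    calc P⁻¹ * P⁻¹ * sqn (z (0, t) - z (0, 0)) ≤ P⁻¹ * P⁻¹ * (P * e₀) := by
          gcongr
          exact h1.trans (mul_le_mul_of_nonneg_left h2 hP0.le)
      _ = P⁻¹ * e₀ := by field_simp
  have hfar : ∀ s ∈ Icc 1 P, ∫ t in 0..P, devi α (interp ψ P α z) (s, t) ≤ 8 * B * e₀ := by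
    intro s hs
    calc _ ≤ ∫ t in 0..P, 4 * B * (P⁻¹ * e₀ + transv z (0, t)) := by
          refine integral_mono_cont (by fun_prop) (by fun_prop) hP0.le fun t ht => ?_
          refine (devi_interp_far hψ hz hP hB hd hd' hone hbd hs.1).trans ?_
          have := hG t ht
          gcongr
      _ = 4 * B * (e₀ + ∫ t in 0..P, transv z (0, t)) := by
          rw [intervalIntegral.integral_const_mul, intervalIntegral.integral_add
            (by simp) (Continuous.intervalIntegrable (by fun_prop) _ _),
            intervalIntegral.integral_const, smul_eq_mul, sub_zero, mul_inv_cancel_left₀ hP0.ne']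
      _ ≤ 4 * B * (e₀ + e₀) := by gcongr
      _ = _ := by ring
  let m : ℝ → ℝ := fun t => 2 * sqn (qd f1 z (0, t) - α)
    + 2 * ∫ x in 0..1, sqn (qd f1 (qd f1 z) (x, t))
  have cin : Continuous fun t => ∫ x in 0..1, sqn (qd f1 (qd f1 z) (x, t)) :=
    continuous_integral_snd (g := fun y : Pt2 => sqn (qd f1 (qd f1 z) (y.2, y.1)))
      (by fun_prop) 0 1
  have cm : Continuous m := by fun_prop
  have hm1 : ∀ s ∈ Icc (0 : ℝ) 1, ∀ t, sqn (qd f1 z (s, t) - α) ≤ m t := by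
    intro s hs t
    have h1 := sqn_sub_le_integral (f := fun s => qd f1 z (s, t))
      (f' := fun s => qd f1 (qd f1 z) (s, t)) (fun s => hasDerivAt_fst (hz1d _))
      (by fun_prop) hs.1 hs.2
    have h2 := sqn_add_le (qd f1 z (0, t) - α) (qd f1 z (s, t) - qd f1 z (0, t))
    rw [sub_add_sub_cancel'] at h2
    simp only [m]
    linarith
  have hm2 : ∀ s ∈ Icc (0 : ℝ) 1, ∀ t, sqn (z (s, t) - s • α - z (0, t)) ≤ m t := by
    intro s hs t
    have h1 := sqn_sub_le_integral (f := fun s => z (s, t) - s • α)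
      (f' := fun s => qd f1 z (s, t) - α) (fun s => ?_) (by fun_prop) hs.1 hs.2
    · rw [zero_smul, sub_zero, one_mul] at h1
      refine h1.trans ?_
      calc _ ≤ ∫ _ in (0 : ℝ)..1, m t :=
            integral_mono_cont (by fun_prop) (by fun_prop) zero_le_one fun x hx => hm1 x hx t
        _ = m t := by simp
    · have hα : HasDerivAt (fun x : ℝ => x • α) α s := by
        simpa using (hasDerivAt_id s).smul_const α
      exact (hasDerivAt_fst (hzd _)).sub hα
  have hmint : ∫ t in 0..P, m t ≤ 2 * e₀ + 2 * e₁ := by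
    have h1 : ∫ t in 0..P, sqn (qd f1 z (0, t) - α) ≤ e₀ :=
      integral_mono_cont (by fun_prop) (by fun_prop) hP0.le fun t _ =>
        le_add_of_nonneg_right (transv_nonneg _ _)
    have h2 : ∫ t in 0..P, ∫ x in 0..1, sqn (qd f1 (qd f1 z) (x, t)) ≤ e₁ := by
      rw [← integral_swap_of_continuous (g := fun y => sqn (qd f1 (qd f1 z) y)) (by fun_prop)]
      exact integral_mono_cont (continuous_integral_snd
        (g := fun y => sqn (qd f1 (qd f1 z) y)) (by fun_prop) _ _)
            cf zero_le_one fun s _ => integral_mono_cont (by fun_prop) (by fun_prop) hP0.le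
            fun t _ =>
          sqn_f1_f1_le_transv _ _
    simp only [m]
    rw [intervalIntegral.integral_add (Continuous.intervalIntegrable (by fun_prop) _ _)
      (Continuous.intervalIntegrable (by fun_prop) _ _), intervalIntegral.integral_const_mul,
      intervalIntegral.integral_const_mul]
    linarith
  have hnear : ∀ s ∈ Icc (0 : ℝ) 1, ∫ t in 0..P, devi α (interp ψ P α z) (s, t)
      ≤ 100 * B * (6 * e₀ + 4 * e₁ + ∫ t in 0..P, transv z (s, t)) := by
    intro s hs
    calc _ ≤ ∫ t in 0..P, 100 * B * ((P⁻¹ * e₀ + transv z (0, t)) + (2 * m t + transv z (s, t))) :=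
          by
            refine integral_mono_cont (by fun_prop) (by fun_prop) hP0.le fun t ht => ?_
            refine (devi_interp_near hψ hz hP hB hd hd' hbd s t).trans ?_
            have h1 := hG t ht
            have h2 := hm1 s hs t
            have h3 := hm2 s hs t
            refine mul_le_mul_of_nonneg_left ?_ (by positivity)
            linarith
      _ = 100 * B * ((e₀ + ∫ t in 0..P, transv z (0, t))
            + (2 * (∫ t in 0..P, m t) + ∫ t in 0..P, transv z (s, t))) := by
          rw [intervalIntegral.integral_const_mul, intervalIntegral.integral_add,
            intervalIntegral.integral_add, intervalIntegral.integral_add,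
            intervalIntegral.integral_const_mul 2, intervalIntegral.integral_const, smul_eq_mul,
            sub_zero, mul_inv_cancel_left₀ hP0.ne']
          all_goals exact Continuous.intervalIntegrable (by fun_prop) _ _
      _ ≤ _ := by
          refine mul_le_mul_of_nonneg_left ?_ (by positivity)
          linarith
  have hii : ∀ x y, IntervalIntegrable
      (fun s => ∫ t in 0..P, devi α (interp ψ P α z) (s, t)) volume x y :=
    fun x y => cF.intervalIntegrable x y
  rw [← intervalIntegral.integral_add_adjacent_intervals (hii 0 1) (hii 1 P)]
  have g1 : ∫ s in (0 : ℝ)..1, ∫ t in 0..P, devi α (interp ψ P α z) (s, t)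
      ≤ 100 * B * (6 * e₀ + 5 * e₁) := by
    refine (integral_mono_cont cF (by fun_prop) zero_le_one hnear).trans_eq ?_
    rw [intervalIntegral.integral_const_mul, intervalIntegral.integral_add (by simp)
      (cf.intervalIntegrable _ _), intervalIntegral.integral_const, ← he₁, smul_eq_mul]
    ring
  have g2 : ∫ s in 1..P, ∫ t in 0..P, devi α (interp ψ P α z) (s, t) ≤ (P - 1) * (8 * B * e₀) := by
    refine (integral_mono_cont cF (by fun_prop) hP hfar).trans_eq ?_
    rw [intervalIntegral.integral_const, smul_eq_mul]
  have k0 : B * e₀ ≤ P * (B * e₀) := le_mul_of_one_le_left (by positivity) hP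
  have k1 : B * e₁ ≤ P * (B * e₁) := le_mul_of_one_le_left (by positivity) hP
  have k2 := mul_nonneg hB0.le he₀0
  have k3 := mul_nonneg hB0.le he₁0
  nlinarith

/-- Truncation on the side of the line `y.1 = s₀` determined by the sign `κ`. -/
theorem exists_truncation : ∃ C > 0, ∀ (P : ℝ), 1 ≤ P → ∀ (z : Pt2 → V3) (α : V3) (s₀ κ : ℝ),
    κ ^ 2 = 1 → ContDiff ℝ 2 z → (∀ s t, z (s, t + P) = z (s, t)) →
    ∃ w : Pt2 → V3, ContDiff ℝ 2 w ∧ (∀ s t, w (s, t + P) = w (s, t)) ∧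
      (∀ y : Pt2, κ * (y.1 - s₀) ≤ 0 → w y = z y) ∧
      (∀ y : Pt2, P < κ * (y.1 - s₀) → qd f1 w y = α ∧ qd f2 w y = 0) ∧
      ∫ s in 0..P, ∫ t in 0..P, devi α w (s₀ + κ * s, t)
        ≤ C * P * ((∫ t in 0..P, devi α z (s₀, t))
          + ∫ s in 0..1, ∫ t in 0..P, transv z (s₀ + κ * s, t)) := by
  obtain ⟨C, hC, H⟩ := exists_truncation_zero
  refine ⟨C, hC, fun P hP z α s₀ κ hκ hz hper => ?_⟩
  have key (v : Pt2 → V3) (hv : ContDiff ℝ 2 v) (k m : ℝ) (hk : k ^ 2 = 1) :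
      let v' : Pt2 → V3 := fun y => (1 : ℝ) • v (k * y.1 + m, 1 * y.2 + 0)
      ContDiff ℝ 2 v' ∧ (∀ s t, qd f1 v' (s, t) = k • qd f1 v (k * s + m, t)) ∧
      (∀ s t, qd f2 v' (s, t) = qd f2 v (k * s + m, t)) ∧
      (∀ s t, transv v' (s, t) = transv v (k * s + m, t)) ∧
      ∀ β s t, devi (k • β) v' (s, t) = devi β v (k * s + m, t) := by
    intro v'
    have hvd := hv.differentiable (by simp)
    have hqd (e : Pt2) : Differentiable ℝ (qd e v) :=
      (contDiff_one_qd hv e).differentiable (by simp)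
    have q1 : qd f1 v' = fun y => (1 * k) • qd f1 v (k * y.1 + m, 1 * y.2 + 0) :=
      funext fun y => qd_affine_f1 hvd _ _ _ _ _ y
    have q2 : qd f2 v' = fun y => ((1 : ℝ) * 1) • qd f2 v (k * y.1 + m, 1 * y.2 + 0) :=
      funext fun y => qd_affine_f2 hvd _ _ _ _ _ y
    have ht : ∀ s t, transv v' (s, t) = transv v (k * s + m, t) := by
      intro s t
      rw [transv, transv, hess2d_eq, hess2d_eq, q1, q2, qd_affine_f1 (hqd f1),
        qd_affine_f2 (hqd f1), qd_affine_f2 (hqd f2)]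
      simp only [sqn_smul, one_mul, mul_one, one_pow, add_zero, hk, mul_pow]
    refine ⟨?_, ?_, ?_, ht, ?_⟩
    · have : ContDiff ℝ 2 fun y : Pt2 => (k * y.1 + m, 1 * y.2 + 0) := by fun_prop
      exact (hv.comp this).const_smul (1 : ℝ)
    · intro s t; rw [q1]; simp
    · intro s t; rw [q2]; simp
    · intro β s t
      rw [devi, devi, ht, q1]
      simp only [one_mul, add_zero, ← smul_sub, sqn_smul, hk]
  obtain ⟨hc, a1, a2, a3, a4⟩ := key z hz κ s₀ hκ
  obtain ⟨w, hw, hwp, hw0, hwP, hwE⟩ := H P hP _ (κ • α) hc (by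
    intro s t
    simp only [one_smul, one_mul, add_zero, hper])
  obtain ⟨hc', b1, b2, b3, b4⟩ := key w hw κ (-(κ * s₀)) hκ
  refine ⟨_, hc', ?_, ?_, ?_, ?_⟩
  · intro s t
    simp only [one_smul, one_mul, add_zero, hwp]
  · rintro ⟨s, t⟩ hs
    simp only [one_smul, one_mul, add_zero]
    rw [hw0 _ (by simp only; linarith)]
    simp only [one_smul, one_mul, add_zero]
    congr 2
    linear_combination (s - s₀) * hκ
  · rintro ⟨s, t⟩ hs
    have := hwP (κ * s + -(κ * s₀), t) (by simp only at hs ⊢; linarith)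
    rw [b1, b2, this.1, this.2, smul_smul, ← sq, hκ, one_smul]
    exact ⟨rfl, rfl⟩
  · have e1 : ∀ s t, devi α (fun y => (1 : ℝ) • w (κ * y.1 + -(κ * s₀), 1 * y.2 + 0))
        (s₀ + κ * s, t) = devi (κ • α) w (s, t) := by
      intro s t
      have h1 := b4 (κ • α) (s₀ + κ * s) t
      rw [smul_smul, ← sq, hκ, one_smul] at h1
      rw [h1]
      congr 2
      linear_combination s * hκ
    simp only [e1]
    simp only [a3, a4] at hwE
    have e2 : ∀ s, κ * s + s₀ = s₀ + κ * s := fun s => add_comm _ _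
    simpa only [e2, mul_zero, add_zero, zero_add] using hwE

/-- Euclidean inner product on ℝ³. -/
def vdot (v w : V3) : ℝ := ∑ i, v i * w i

theorem vdot_sq_le (v w : V3) : vdot v w ^ 2 ≤ sqn v * sqn w :=
  Finset.sum_mul_sq_le_sq_mul_sq _ _ _

@[fun_prop]
theorem continuous_vdot (w : V3) : Continuous fun v => vdot v w := by unfold vdot; fun_prop

theorem vdot_sub (u v w : V3) : vdot (u - v) w = vdot u w - vdot v w := by
  simp [vdot, sub_mul, Finset.sum_sub_distrib]

theorem vdot_add (u v w : V3) : vdot (u + v) w = vdot u w + vdot v w := by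
  simp [vdot, add_mul, Finset.sum_add_distrib]

theorem vdot_smul (r : ℝ) (v w : V3) : vdot (r • v) w = r * vdot v w := by
  simp [vdot, Finset.mul_sum, mul_assoc]

theorem vdot_self (v : V3) : vdot v v = sqn v := by simp [vdot, sqn, sq]

theorem abs_vdot_le (v w : V3) : |vdot v w| ≤ vnorm v * vnorm w := by
  have h := vdot_sq_le v w
  rw [← vnorm_sq, ← vnorm_sq, ← mul_pow] at h
  exact abs_le_of_sq_le_sq h (mul_nonneg (vnorm_nonneg _) (vnorm_nonneg _))

theorem hasDerivAt_vdot {f : ℝ → V3} {f' : V3} {x : ℝ} (h : HasDerivAt f f' x) (w : V3) :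
    HasDerivAt (fun x => vdot (f x) w) (vdot f' w) x :=
  HasDerivAt.fun_sum fun i _ => ((hasDerivAt_pi.1 h i).mul_const (w i))

theorem exists_mul_le_integral {g : ℝ → ℝ} (hg : Continuous g) {b c : ℝ} (hbc : b ≤ c) :
    ∃ s ∈ Icc b c, (c - b) * g s ≤ ∫ x in b..c, g x := by
  obtain ⟨s, hs, hmin⟩ := (isCompact_Icc (a := b) (b := c)).exists_isMinOn
    (nonempty_Icc.2 hbc) hg.continuousOn
  refine ⟨s, hs, ?_⟩
  have := integral_mono_cont (continuous_const (y := g s)) hg hbc fun x hx => hmin hx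
  simpa using this

theorem integral_mono_interval_cont {g : ℝ → ℝ} (hg : Continuous g) (h0 : ∀ x, 0 ≤ g x)
    {a b c d : ℝ} (hca : c ≤ a) (hab : a ≤ b) (hbd : b ≤ d) :
    ∫ x in a..b, g x ≤ ∫ x in c..d, g x :=
  intervalIntegral.integral_mono_interval hca hab hbd (Eventually.of_forall h0)
    (hg.intervalIntegrable _ _)

namespace QuadBounds

variable {W : M33 → ℝ} {a : V3} {c C : ℝ} {z : Pt2 → V3} {P : ℝ} {s₀ κ : ℝ}

theorem hess2d_le_dens (hW : QuadBounds W a c C) (z : Pt2 → V3) (y : Pt2) :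
    hess2d z y ≤ dens W z y := le_add_of_nonneg_left (hW.nonneg _ _)

theorem transv_le (hW : QuadBounds W a c C) (z : Pt2 → V3) (y : Pt2) :
    transv z y ≤ (c⁻¹ + 1) * dens W z y := by
  have h1 := hW.sqn_le (qd f1 z y) (qd f2 z y)
  have h2 := mul_nonneg (inv_nonneg.2 hW.c_pos.le) (hess2d_nonneg z y)
  have h3 := hW.nonneg (qd f1 z y) (qd f2 z y)
  simp only [transv, dens, W2]
  linarith

theorem dens_le_devi (hW : QuadBounds W a c C) (hκ : κ ^ 2 = 1) (z : Pt2 → V3) (y : Pt2) :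
    dens W z y ≤ (C + 1) * devi (κ • a) z y := by
  have h0 := hess2d_nonneg z y
  have h1 := sqn_nonneg (qd f1 z y - κ • a)
  have h2 := sqn_nonneg (qd f2 z y)
  have h3 := mul_nonneg hW.C_pos.le h0
  have h4 : W ![qd f1 z y, 0, qd f2 z y] ≤ C * (sqn (qd f1 z y - κ • a) + sqn (qd f2 z y)) := by
    rcases sq_eq_one_iff.1 hκ with rfl | rfl
    · simpa using hW.le_of_pos (p := qd f1 z y) (q := qd f2 z y)
    · simpa using hW.le_of_neg (p := qd f1 z y) (q := qd f2 z y)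
  simp only [devi, transv, dens, W2]
  linarith

theorem vdot_le (hW : QuadBounds W a c C) (hκ : κ ^ 2 = 1) (p q : V3) :
    κ * vdot p a ≤ 2 * sqn a + c⁻¹ * W ![p, 0, q] := by
  have key : ∀ r : V3, sqn r = sqn a → κ * vdot p a ≤ 2 * sqn a + sqn (p - r) := by
    intro r hr
    have h1 : vdot p a = vdot (p - r) a + vdot r a := by rw [← vdot_add, sub_add_cancel]
    have h2 : κ * vdot (p - r) a ≤ (sqn (p - r) + sqn a) / 2 := by
      have := vdot_sq_le (p - r) a
      have h := sqn_nonneg (p - r)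
      have h' := sqn_nonneg a
      refine le_of_sq_le_sq' ?_ (by positivity)
      rw [mul_pow, hκ]
      nlinarith [sq_nonneg (sqn (p - r) - sqn a)]
    have h3 : κ * vdot r a ≤ sqn a := by
      have := vdot_sq_le r a
      refine le_of_sq_le_sq' ?_ (sqn_nonneg a)
      rw [mul_pow, hκ]
      rw [hr] at this
      linarith [sq (sqn a)]
    have h := sqn_nonneg (p - r)
    have h' := sqn_nonneg a
    rw [h1, mul_add]
    linarith
  have h1 := key a rfl
  have h2 := key (-a) (sqn_neg a)
  rw [sub_neg_eq_add] at h2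
  have h3 : min (sqn (p - a)) (sqn (p + a)) ≤ c⁻¹ * W ![p, 0, q] := by
    rw [inv_mul_eq_div, le_div_iff₀' hW.c_pos]
    refine le_trans ?_ (hW.lower p q)
    have := hW.c_pos
    gcongr
    linarith [sqn_nonneg q]
  rcases min_choice (sqn (p - a)) (sqn (p + a)) with h | h <;> rw [h] at h3 <;> linarith
  where le_of_sq_le_sq' {x y : ℝ} (h : x ^ 2 ≤ y ^ 2) (hy : 0 ≤ y) : x ≤ y :=
    (le_abs_self x).trans (abs_le_of_sq_le_sq h hy)

theorem le_of_vdot_small (hW : QuadBounds W a c C) (ha : a ≠ 0) {p : V3} (q : V3)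
    (hp : vdot p a ^ 2 ≤ (sqn a / 2) ^ 2) : c * (sqn a / 4) ≤ W ![p, 0, q] := by
  have hA := sqn_pos ha
  have := abs_le_of_sq_le_sq' hp (by positivity)
  refine le_trans ?_ (hW.lower p q)
  have hc := hW.c_pos
  gcongr
  have h1 := vdot_sq_le (p - a) a
  have h2 := vdot_sq_le (p + a) a
  rw [vdot_sub, vdot_self] at h1
  rw [vdot_add, vdot_self] at h2
  have h3 : sqn a / 4 ≤ sqn (p - a) := by
    by_contra! h
    nlinarith
  have h4 : sqn a / 4 ≤ sqn (p + a) := by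
    by_contra! h
    nlinarith
  exact (le_min h3 h4).trans (le_add_of_nonneg_right (sqn_nonneg q))

theorem devi_le_of_vdot_nonneg (hW : QuadBounds W a c C) (hκ : κ ^ 2 = 1) {y : Pt2}
    (h : 0 ≤ κ * vdot (qd f1 z y) a) : devi (κ • a) z y ≤ (c⁻¹ + 1) * dens W z y := by
  have key : ∀ p : V3, sqn (p + a) - sqn (p - a) = 4 * vdot p a := by
    intro p
    simp only [sqn, vdot, Finset.mul_sum, ← Finset.sum_sub_distrib, Pi.add_apply, Pi.sub_apply]
    exact Finset.sum_congr rfl fun i _ => by ring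
  have h1 := key (qd f1 z y)
  have h2 := hW.lower (qd f1 z y) (qd f2 z y)
  have h3 : min (sqn (qd f1 z y - a)) (sqn (qd f1 z y + a)) = sqn (qd f1 z y - κ • a) := by
    rcases sq_eq_one_iff.1 hκ with rfl | rfl
    · rw [min_eq_left (by linarith), one_smul]
    · rw [min_eq_right (by linarith), neg_one_smul, sub_neg_eq_add]
  rw [h3, ← le_div_iff₀' hW.c_pos, ← inv_mul_eq_div] at h2
  have h4 := mul_nonneg (inv_nonneg.2 hW.c_pos.le) (hess2d_nonneg z y)
  have h5 := hW.nonneg (qd f1 z y) (qd f2 z y)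
  simp only [devi, transv, dens, W2]
  linarith

/-- If the energy on a segment is small, then the first derivative stays on one side there. -/
theorem vdot_nonneg_of_small (hW : QuadBounds W a c C) (ha : a ≠ 0) (hz : ContDiff ℝ 2 z)
    (hP : 1 ≤ P) (hper : ∀ s t, z (s, t + P) = z (s, t))
    (hsmall : ∫ t in 0..P, dens W z (s₀, t) < min 1 c * (sqn a / 4))
    (hpos : 0 < ∫ t in 0..P, κ * vdot (qd f1 z (s₀, t)) a) (t : ℝ) :
    0 ≤ κ * vdot (qd f1 z (s₀, t)) a := by
  have hP0 : 0 < P := by positivity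
  have hA := sqn_pos ha
  have c1 := (contDiff_one_qd hz f1).continuous
  have c12 := continuous_qd_qd hz f1 f2
  have cdens := continuous_dens hW.cont hz
  by_contra! hneg
  obtain ⟨t₁, ht₁⟩ : ∃ t₁, 0 < κ * vdot (qd f1 z (s₀, t₁)) a := by
    by_contra! h
    have := integral_mono_cont (f := fun t => κ * vdot (qd f1 z (s₀, t)) a) (g := fun _ => 0)
      (by fun_prop) (by fun_prop) hP0.le fun t _ => h t
    simp only [intervalIntegral.integral_zero] at this
    linarith
  obtain ⟨t₀, ht₀⟩ : ∃ t₀, κ * vdot (qd f1 z (s₀, t₀)) a = 0 :=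
    mem_range_of_exists_le_of_exists_ge (f := fun t => κ * vdot (qd f1 z (s₀, t)) a)
      (by fun_prop) ⟨t, hneg.le⟩ ⟨t₁, ht₁.le⟩
  have hκ : κ ≠ 0 := by rintro rfl; simp at ht₁
  replace ht₀ : vdot (qd f1 z (s₀, t₀)) a = 0 := by simpa [hκ] using ht₀
  set f := ∫ t in 0..P, dens W z (s₀, t) with hf
  have hfshift : ∫ t in 0..P, dens W z (s₀, t₀ + t) = f := by
    have hp : Function.Periodic (fun t => dens W z (s₀, t)) P := dens_periodic W hper _
    rw [intervalIntegral.integral_comp_add_left (fun t => dens W z (s₀, t)), add_zero,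
      hp.intervalIntegral_add_eq t₀ 0, zero_add]
  have hf1 : ∫ t in (0 : ℝ)..1, dens W z (s₀, t₀ + t) ≤ f := by
    rw [← hfshift]
    exact integral_mono_interval_cont (by fun_prop) (fun _ => hW.dens_nonneg _ _) le_rfl
      zero_le_one hP
  have hsm1 : f < sqn a / 4 := hsmall.trans_le
    (mul_le_of_le_one_left (by positivity) (min_le_left _ _))
  have hsm2 : f < c * (sqn a / 4) := hsmall.trans_le
    (mul_le_mul_of_nonneg_right (min_le_right _ _) (by positivity))
  have hsmalldot : ∀ x ∈ Icc (0 : ℝ) 1,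
      vdot (qd f1 z (s₀, t₀ + x)) a ^ 2 ≤ (sqn a / 2) ^ 2 := by
    intro x hx
    have h1 := sqn_sub_le_integral (f := fun x => qd f1 z (s₀, t₀ + x))
      (f' := fun x => qd f2 (qd f1 z) (s₀, t₀ + x)) (fun x =>
        (hasDerivAt_snd ((contDiff_one_qd hz f1).differentiable (by simp) _)).comp_const_add t₀ x)
      (by fun_prop) hx.1 hx.2
    have h2 : ∫ x in (0 : ℝ)..1, sqn (qd f2 (qd f1 z) (s₀, t₀ + x)) ≤ f := by
      refine le_trans (integral_mono_cont (by fun_prop) (by fun_prop) zero_le_one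
        fun x _ => ?_) hf1
      refine le_trans ?_ (hW.hess2d_le_dens z _)
      rw [hess2d_eq]
      have := sqn_nonneg (qd f1 (qd f1 z) (s₀, t₀ + x))
      have := sqn_nonneg (qd f2 (qd f2 z) (s₀, t₀ + x))
      have := sqn_nonneg (qd f2 (qd f1 z) (s₀, t₀ + x))
      linarith
    have h3 := vdot_sq_le (qd f1 z (s₀, t₀ + x) - qd f1 z (s₀, t₀)) a
    rw [vdot_sub, ht₀, sub_zero] at h3
    simp only [add_zero, one_mul] at h1
    nlinarith
  have : c * (sqn a / 4) ≤ f := by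
    refine le_trans ?_ hf1
    have := integral_mono_cont (f := fun _ => c * (sqn a / 4))
      (g := fun t => dens W z (s₀, t₀ + t)) (by fun_prop) (by fun_prop) zero_le_one fun x hx =>
        (hW.le_of_vdot_small ha (qd f2 z (s₀, t₀ + x)) (hsmalldot x hx)).trans
          (le_add_of_nonneg_right (hess2d_nonneg _ _))
    simpa using this
  linarith

end QuadBounds

/-- A good vertical line at which to cut off: on it the first derivative of `z` is close to the
well `κ • a`, and the energy on it and on the adjacent unit strip is small. -/
theorem QuadBounds.exists_good_line {W : M33 → ℝ} {a : V3} {c C : ℝ} (hW : QuadBounds W a c C)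
    (ha : a ≠ 0) {E : ℝ} (hE : 0 ≤ E) :
    ∃ K₁ > 0, ∃ C₃ > 0, ∃ ω > 0, ω ≤ 1 / 24 ∧ ∀ (P R κ : ℝ) (z : Pt2 → V3), κ ^ 2 = 1 → 1 ≤ P →
      P ≤ ω * R → ContDiff ℝ 2 z → (∀ s t, z (s, t + P) = z (s, t)) →
      ∫ s in 0..3 * R / 8, ∫ t in 0..P, dens W z (κ * s, t) ≤ P * E →
      K₁ * (R ^ 2)⁻¹ * ∫ s in 0..3 * R / 8, ∫ t in 0..P, vnorm (z (κ * s, t) - s • a) ≤ P * E →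
      ∃ s₀ ∈ Icc (R / 8) (R / 3),
        (∫ t in 0..P, devi (κ • a) z (κ * s₀, t)) +
          ∫ s in 0..1, ∫ t in 0..P, transv z (κ * s₀ + κ * s, t) ≤ C₃ * (P / R) := by
  have hA := sqn_pos ha
  have hn : 0 < vnorm a := by
    refine (vnorm_nonneg a).lt_of_ne fun h => ?_
    rw [← vnorm_sq, ← h] at hA
    simp at hA
  have hc := hW.c_pos
  set m : ℝ := min 1 c with hm
  have hmpos : 0 < m := lt_min one_pos hc
  refine ⟨1152 * (E + 1) / vnorm a, by positivity, (c⁻¹ + 1) * (192 * (E + 1)), by positivity,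
    min (1 / 24) (min (c * sqn a / (96 * (E + 1))) (m * sqn a / (800 * (E + 1)))), by positivity,
    min_le_left _ _, ?_⟩
  intro P R κ z hκ hP hPR hz hper hen herr
  set ω := min (1 / 24) (min (c * sqn a / (96 * (E + 1))) (m * sqn a / (800 * (E + 1)))) with hω
  have hω0 : 0 < ω := by positivity
  have hω1 : ω ≤ 1 / 24 := min_le_left _ _
  have hω2 : ω * (96 * (E + 1)) ≤ c * sqn a := by
    rw [← le_div_iff₀ (by positivity)]
    exact (min_le_right _ _).trans (min_le_left _ _)
  have hω3 : ω * (800 * (E + 1)) ≤ m * sqn a := by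
    rw [← le_div_iff₀ (by positivity)]
    exact (min_le_right _ _).trans (min_le_right _ _)
  have hP0 : 0 < P := by positivity
  have hR0 : 0 < R := by
    by_contra! h
    nlinarith
  have hR : 24 ≤ R := by nlinarith
  have czf := hz.continuous
  have c1 := (contDiff_one_qd hz f1).continuous
  have cdens := continuous_dens hW.cont hz
  have ctr := continuous_transv hz
  have cdev := continuous_devi (κ • a) hz
  set f : ℝ → ℝ := fun s => ∫ t in 0..P, dens W z (κ * s, t) with hf
  set err : ℝ → ℝ := fun s => ∫ t in 0..P, vnorm (z (κ * s, t) - s • a) with herrdef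
  set D : ℝ → ℝ := fun s => ∫ t in 0..P, κ * vdot (qd f1 z (κ * s, t)) a with hD
  have cf : Continuous f := continuous_integral_snd (g := fun y : Pt2 => dens W z (κ * y.1, y.2))
    (by fun_prop) 0 P
  have cerr : Continuous err := continuous_integral_snd
    (g := fun y : Pt2 => vnorm (z (κ * y.1, y.2) - y.1 • a)) (by fun_prop) 0 P
  have cD : Continuous D := continuous_integral_snd
    (g := fun y : Pt2 => κ * vdot (qd f1 z (κ * y.1, y.2)) a) (by fun_prop) 0 P
  have f0 : ∀ s, 0 ≤ f s := fun s =>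
    intervalIntegral.integral_nonneg hP0.le fun t _ => hW.dens_nonneg _ _
  have err0 : ∀ s, 0 ≤ err s := fun s =>
    intervalIntegral.integral_nonneg hP0.le fun t _ => vnorm_nonneg _
  set fs : ℝ → ℝ := fun s => ∫ x in (0 : ℝ)..1, f (s + x) with hfs
  have cfs : Continuous fs := continuous_integral_snd (g := fun y : Pt2 => f (y.1 + y.2))
    (by fun_prop) 0 1
  have fs0 : ∀ s, 0 ≤ fs s := fun s =>
    intervalIntegral.integral_nonneg zero_le_one fun t _ => f0 _
  have herrI : ∀ p q, 0 ≤ p → p ≤ q → q ≤ 3 * R / 8 → R / 24 ≤ q - p →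
      ∃ s ∈ Icc p q, err s * vnorm a ≤ P * R * sqn a / 48 := by
    intro p q hp hpq hq hqp
    obtain ⟨s, hs, h⟩ := exists_mul_le_integral cerr hpq
    refine ⟨s, hs, ?_⟩
    have h1 : ∫ s in p..q, err s ≤ ∫ s in 0..3 * R / 8, err s :=
      integral_mono_interval_cont cerr err0 hp hpq hq
    have h2 : R / 24 * err s ≤ (q - p) * err s := mul_le_mul_of_nonneg_right hqp (err0 s)
    have h3 : 1152 * (E + 1) / vnorm a * (R ^ 2)⁻¹ * (R / 24 * err s) ≤ P * E :=
      le_trans (mul_le_mul_of_nonneg_left (h2.trans (h.trans h1)) (by positivity)) herr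
    have h4 : 1152 * (E + 1) / vnorm a * (R ^ 2)⁻¹ * (R / 24 * err s)
        = (E + 1) * (48 * err s / (vnorm a * R)) := by field_simp; ring
    rw [h4] at h3
    have h5 : (E + 1) * (48 * err s / (vnorm a * R)) ≤ (E + 1) * P := by linarith
    have h6 := le_of_mul_le_mul_left h5 (by positivity)
    rw [div_le_iff₀ (by positivity)] at h6
    rw [← vnorm_sq]
    nlinarith
  obtain ⟨b, hb, hberr⟩ := herrI (R / 8) (R / 6) (by linarith) (by linarith) (by linarith)
    (by linarith)
  obtain ⟨d, hd, hderr⟩ := herrI (R / 4) (R / 3) (by linarith) (by linarith) (by linarith)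
    (by linarith)
  have hbd : b ≤ d := by linarith [hb.2, hd.1]
  have hV : ∀ s, |(∫ t in 0..P, vdot (z (κ * s, t)) a) - s * (P * sqn a)| ≤ err s * vnorm a := by
    intro s
    have h1 : (∫ t in 0..P, vdot (z (κ * s, t)) a) - s * (P * sqn a)
        = ∫ t in 0..P, vdot (z (κ * s, t) - s • a) a := by
      simp only [vdot_sub, vdot_smul, vdot_self]
      rw [intervalIntegral.integral_sub (Continuous.intervalIntegrable (by fun_prop) _ _)
        (Continuous.intervalIntegrable (by fun_prop) _ _)]
      simp
    rw [h1, herrdef, ← intervalIntegral.integral_mul_const]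
    refine (intervalIntegral.abs_integral_le_integral_abs hP0.le).trans ?_
    exact integral_mono_cont (by fun_prop) (by fun_prop) hP0.le fun t _ => abs_vdot_le _ _
  have hDint : ∫ s in b..d, D s
      = (∫ t in 0..P, vdot (z (κ * d, t)) a) - ∫ t in 0..P, vdot (z (κ * b, t)) a := by
    rw [hD, integral_swap_of_continuous (g := fun y : Pt2 => κ * vdot (qd f1 z (κ * y.1, y.2)) a)
      (by fun_prop), ← intervalIntegral.integral_sub
        (Continuous.intervalIntegrable (by fun_prop) _ _)
        (Continuous.intervalIntegrable (by fun_prop) _ _)]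
    refine intervalIntegral.integral_congr fun t _ => ?_
    refine intervalIntegral.integral_eq_sub_of_hasDerivAt (f := fun s => vdot (z (κ * s, t)) a)
      (fun s _ => ?_) (Continuous.intervalIntegrable (by fun_prop) _ _)
    have h1 := (hasDerivAt_fst (hz.differentiable (by simp) (κ * s, t))).scomp s
      ((hasDerivAt_id s).const_mul κ)
    refine (hasDerivAt_vdot h1 a).congr_deriv ?_
    rw [vdot_smul, mul_one]
  have hDlow : P * R * sqn a / 24 ≤ ∫ s in b..d, D s := by
    rw [hDint]
    have h1 := (abs_le.1 (hV b)).2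
    have h2 := (abs_le.1 (hV d)).1
    have h3 : R / 12 * (P * sqn a) ≤ (d - b) * (P * sqn a) := by
      gcongr
      linarith [hb.2, hd.1]
    linarith
  have hsub : ∀ p q, 0 ≤ p → p ≤ q → q ≤ 3 * R / 8 → ∫ s in p..q, f s ≤ P * E :=
    fun p q hp hpq hq => (integral_mono_interval_cont cf f0 hp hpq hq).trans hen
  have hg1 : ∫ s in b..d, f s ≤ P * E := hsub b d (by linarith [hb.1]) hbd (by linarith [hd.2])
  have hg2 : ∫ s in b..d, fs s ≤ P * E := by
    rw [hfs, integral_swap_of_continuous (g := fun y : Pt2 => f (y.1 + y.2)) (by fun_prop)]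
    have := integral_mono_cont (f := fun x => ∫ s in b..d, f (s + x)) (g := fun _ => P * E)
      (continuous_integral_snd (g := fun y : Pt2 => f (y.2 + y.1)) (by fun_prop) b d)
      continuous_const zero_le_one (fun x hx => ?_)
    · simpa using this
    · rw [intervalIntegral.integral_comp_add_right]
      exact hsub _ _ (by linarith [hb.1, hx.1]) (by linarith) (by linarith [hd.2, hx.2])
  set l : ℝ := R * sqn a / (48 * (E + 1)) with hl
  have hlpos : 0 < l := by positivity
  obtain ⟨s₀, hs₀, hDs⟩ : ∃ s ∈ Icc b d, l * (f s + fs s) < D s := by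
    by_contra! h
    have h1 := integral_mono_cont cD (g := fun s => l * (f s + fs s)) (by fun_prop) hbd h
    rw [intervalIntegral.integral_const_mul, intervalIntegral.integral_add
      (cf.intervalIntegrable _ _) (cfs.intervalIntegrable _ _)] at h1
    have h2 : l * ((∫ s in b..d, f s) + ∫ s in b..d, fs s) ≤ l * (2 * (P * E)) := by
      gcongr
      linarith
    have h3 : l * (2 * (P * E)) < P * R * sqn a / 24 := by
      have : l * (2 * (P * E)) = P * R * sqn a / 24 * (E / (E + 1)) := by
        rw [hl]; field_simp; ring
      rw [this]
      refine mul_lt_of_lt_one_right (by positivity) ?_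
      rw [div_lt_one (by positivity)]
      linarith
    linarith
  have hDup : D s₀ ≤ 2 * sqn a * P + c⁻¹ * f s₀ := by
    have h1 := integral_mono_cont (f := fun t => κ * vdot (qd f1 z (κ * s₀, t)) a)
      (g := fun t => 2 * sqn a + c⁻¹ * dens W z (κ * s₀, t)) (by fun_prop) (by fun_prop) hP0.le
      (fun t _ => (hW.vdot_le hκ _ (qd f2 z (κ * s₀, t))).trans (by
        gcongr
        exact le_add_of_nonneg_right (hess2d_nonneg _ _)))
    refine h1.trans (le_of_eq ?_)
    rw [intervalIntegral.integral_add (Continuous.intervalIntegrable (by fun_prop) _ _)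
      (Continuous.intervalIntegrable (by fun_prop) _ _), intervalIntegral.integral_const_mul]
    simp
    ring
  have hl2 : 2 * c⁻¹ ≤ l := by
    rw [hl, le_div_iff₀ (by positivity), mul_comm 2, mul_assoc, inv_mul_le_iff₀ hc]
    have h1 : 1 ≤ ω * R := hP.trans hPR
    have h2 : ω * (96 * (E + 1)) * R ≤ c * sqn a * R := by gcongr
    have h3 : 1 * (96 * (E + 1)) ≤ (ω * R) * (96 * (E + 1)) := by gcongr
    linarith
  have hsum : f s₀ + fs s₀ ≤ 192 * (E + 1) * (P / R) := by
    have h1 : c⁻¹ * f s₀ ≤ l / 2 * (f s₀ + fs s₀) := by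
      have := f0 s₀
      have := fs0 s₀
      gcongr
      · linarith
      · linarith
    have h2 : l / 2 * (f s₀ + fs s₀) ≤ 2 * sqn a * P := by linarith
    have h3 : l / 2 * (192 * (E + 1) * (P / R)) = 2 * sqn a * P := by
      rw [hl]; field_simp; ring
    rw [← h3] at h2
    exact le_of_mul_le_mul_left h2 (by positivity)
  have hsmall : f s₀ < m * (sqn a / 4) := by
    have h1 : P / R ≤ ω := by rwa [div_le_iff₀ hR0]
    have h2 : 192 * (E + 1) * (P / R) ≤ 192 * (E + 1) * ω := by gcongr
    have h3 : 0 < (E + 1) * ω := by positivity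
    linarith [fs0 s₀]
  have hpos : 0 < D s₀ := lt_of_le_of_lt
    (mul_nonneg hlpos.le (add_nonneg (f0 _) (fs0 _))) hDs
  have hnn := hW.vdot_nonneg_of_small ha hz hP hper hsmall hpos
  refine ⟨s₀, ⟨hb.1.trans hs₀.1, hs₀.2.trans hd.2⟩, ?_⟩
  have hfin1 : ∫ t in 0..P, devi (κ • a) z (κ * s₀, t) ≤ (c⁻¹ + 1) * f s₀ := by
    rw [hf, ← intervalIntegral.integral_const_mul]
    exact integral_mono_cont (by fun_prop) (by fun_prop) hP0.le fun t _ =>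
      hW.devi_le_of_vdot_nonneg hκ (hnn t)
  have hfin2 : ∫ s in (0 : ℝ)..1, ∫ t in 0..P, transv z (κ * s₀ + κ * s, t)
      ≤ (c⁻¹ + 1) * fs s₀ := by
    rw [hfs, ← intervalIntegral.integral_const_mul]
    refine integral_mono_cont (continuous_integral_snd
      (g := fun y : Pt2 => transv z (κ * s₀ + κ * y.1, y.2)) (by fun_prop) 0 P)
      (by fun_prop) zero_le_one fun s _ => ?_
    rw [hf, ← intervalIntegral.integral_const_mul]
    refine integral_mono_cont (by fun_prop) (by fun_prop) hP0.le fun t _ => ?_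
    rw [← mul_add]
    exact hW.transv_le z _
  calc _ ≤ (c⁻¹ + 1) * (f s₀ + fs s₀) := by linarith
    _ ≤ (c⁻¹ + 1) * (192 * (E + 1) * (P / R)) := by gcongr
    _ = _ := by ring

theorem qd_congr_nhds {v w : Pt2 → V3} {y : Pt2} (h : v =ᶠ[𝓝 y] w) (e : Pt2) :
    qd e v =ᶠ[𝓝 y] qd e w :=
  h.eventuallyEq_nhds.mono fun _ hx => qd_congr hx e

theorem hess2d_congr {v w : Pt2 → V3} {y : Pt2} (h : v =ᶠ[𝓝 y] w) : hess2d v y = hess2d w y := by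
  simp only [hess2d, qd_congr (qd_congr_nhds h f1), qd_congr (qd_congr_nhds h f2)]

theorem dens_congr (W : M33 → ℝ) {v w : Pt2 → V3} {y : Pt2} (h : v =ᶠ[𝓝 y] w) :
    dens W v y = dens W w y := by
  simp only [dens, W2, qd_congr h, hess2d_congr h]

theorem transv_congr {v w : Pt2 → V3} {y : Pt2} (h : v =ᶠ[𝓝 y] w) :
    transv v y = transv w y := by
  simp only [transv, qd_congr h, hess2d_congr h]

theorem devi_congr (α : V3) {v w : Pt2 → V3} {y : Pt2} (h : v =ᶠ[𝓝 y] w) :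
    devi α v y = devi α w y := by
  simp only [devi, qd_congr h, transv_congr h]

/-- A periodic map of a wide strip which is close to the piecewise affine reference map can be
turned into an admissible transition at small cost. -/
theorem QuadBounds.kinfZero_le_of_energy {W : M33 → ℝ} {a : V3} {c C : ℝ}
    (hW : QuadBounds W a c C) (ha : a ≠ 0) {E : ℝ} (hE : 0 ≤ E) :
    ∃ K₁ > 0, ∃ C' > 0, ∃ ω > 0, ∀ (P R : ℝ) (z : Pt2 → V3), 1 ≤ P → P ≤ ω * R →
      ContDiff ℝ 2 z → (∀ s t, z (s, t + P) = z (s, t)) →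
      ∫ s in -(3 * R / 8)..3 * R / 8, ∫ t in 0..P, dens W z (s, t) ≤ P * E →
      K₁ * (R ^ 2)⁻¹ * ∫ s in -(3 * R / 8)..3 * R / 8, ∫ t in 0..P, vnorm (z (s, t) - |s| • a)
        ≤ P * E →
      KinfZero W a ≤ ENNReal.ofReal (E + C' * (P / R)) := by
  obtain ⟨K₁, hK₁, C₃, hC₃, ω, hω, hω', hsel⟩ := hW.exists_good_line ha hE
  obtain ⟨CT, hCT, htrunc⟩ := exists_truncation
  have hC := hW.C_pos
  refine ⟨K₁, hK₁, 2 * ((C + 1) * (CT * C₃)), by positivity, ω, hω, ?_⟩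
  intro P R z hP hPR hz hper hen herr
  have hP0 : 0 < P := by positivity
  have hR0 : 0 < R := by
    by_contra! h
    nlinarith
  have hR : 24 ≤ R := by nlinarith
  have czf := hz.continuous
  have cdz := continuous_dens hW.cont hz
  have key : ∀ κ : ℝ, κ ^ 2 = 1 → ∀ g : Pt2 → ℝ, Continuous g → (∀ y, 0 ≤ g y) →
      ∫ s in 0..3 * R / 8, ∫ t in 0..P, g (κ * s, t)
        ≤ ∫ s in -(3 * R / 8)..3 * R / 8, ∫ t in 0..P, g (s, t) := by
    intro κ hκ g hg g0
    have cG := continuous_integral_snd hg 0 P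
    have G0 : ∀ s, 0 ≤ ∫ t in 0..P, g (s, t) := fun s =>
      intervalIntegral.integral_nonneg hP0.le fun t _ => g0 _
    rcases sq_eq_one_iff.1 hκ with rfl | rfl
    · simp only [one_mul]
      exact integral_mono_interval_cont cG G0 (by linarith) (by linarith) le_rfl
    · simp only [neg_one_mul]
      rw [intervalIntegral.integral_comp_neg (fun s => ∫ t in 0..P, g (s, t)), neg_zero]
      exact integral_mono_interval_cont cG G0 le_rfl (by linarith) (by linarith)
  have hline : ∀ κ : ℝ, κ ^ 2 = 1 → ∃ s₀ ∈ Icc (R / 8) (R / 3),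
      (∫ t in 0..P, devi (κ • a) z (κ * s₀, t)) +
        ∫ s in 0..1, ∫ t in 0..P, transv z (κ * s₀ + κ * s, t) ≤ C₃ * (P / R) := by
    intro κ hκ
    refine hsel P R κ z hκ hP hPR hz hper ((key κ hκ _ cdz fun y => hW.dens_nonneg _ _).trans hen)
        ?_
    refine le_trans (mul_le_mul_of_nonneg_left ?_ (by positivity)) herr
    have h1 := key κ hκ (fun y => vnorm (z y - |y.1| • a)) (by fun_prop) fun y => vnorm_nonneg _
    refine le_trans (le_of_eq ?_) h1
    refine intervalIntegral.integral_congr fun s hs => ?_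
    rw [uIcc_of_le (by linarith)] at hs
    have h2 : |κ * s| = s := by
      rcases sq_eq_one_iff.1 hκ with rfl | rfl
      · rw [one_mul, abs_of_nonneg hs.1]
      · rw [neg_one_mul, abs_neg, abs_of_nonneg hs.1]
    simp only [h2]
  obtain ⟨s₁, hs₁, hl₁⟩ := hline 1 (by norm_num)
  obtain ⟨s₂, hs₂, hl₂⟩ := hline (-1) (by norm_num)
  rw [one_smul, one_mul] at hl₁
  rw [neg_one_smul, neg_one_mul] at hl₂
  set p := -s₂ with hp
  have hpq : p < s₁ := by linarith [hs₁.1, hs₂.1]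
  obtain ⟨w, hw, hwper, hwz, hwr, hwe⟩ := htrunc P hP z a s₁ 1 (by norm_num) hz hper
  have ew : ∀ y : Pt2, y.1 < s₁ → w =ᶠ[𝓝 y] z := fun y hy => by
    filter_upwards [(isOpen_lt continuous_fst continuous_const).mem_nhds hy] with x hx
    exact hwz x (by linarith [show x.1 < s₁ from hx])
  obtain ⟨v, hv, hvper, hvw, hvl, hve⟩ := htrunc P hP w (-a) p (-1) (by norm_num) hw hwper
  have ev : ∀ y : Pt2, p < y.1 → v =ᶠ[𝓝 y] w := fun y hy => by
    filter_upwards [(isOpen_lt continuous_const continuous_fst).mem_nhds hy] with x hx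
    exact hvw x (by linarith [show p < x.1 from hx])
  have cdv := continuous_dens hW.cont hv
  have cdw := continuous_dens hW.cont hw
  have cew := continuous_devi a hw
  have cev := continuous_devi (-a) hv
  have cGv : Continuous fun s => ∫ t in 0..P, dens W v (s, t) := continuous_integral_snd cdv 0 P
  have hres : ∀ r x y, r ≤ x → x ≤ y → ∫ s in r..y, ∫ t in 0..P, dens W v (s, t)
      = (∫ s in r..x, ∫ t in 0..P, dens W v (s, t)) + ∫ s in x..y, ∫ t in 0..P, dens W v (s, t) :=
    fun r x y _ _ => (intervalIntegral.integral_add_adjacent_intervals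
      (cGv.intervalIntegrable _ _) (cGv.intervalIntegrable _ _)).symm
  have hfin := kinfZero_le_of_transition (S₁ := p - P) (S₂ := s₁ + P) hW hv hP0 (by linarith) hvper
    (fun y hy => ?_) (fun y hy => hvl y (by linarith))
  swap
  · have := hwr y (by linarith)
    rwa [qd_congr (ev y (by linarith)), qd_congr (ev y (by linarith))]
  refine hfin.trans (ENNReal.ofReal_le_ofReal ?_)
  rw [hres (p - P) p (s₁ + P) (by linarith) (by linarith),
    hres p s₁ (s₁ + P) (by linarith) (by linarith)]
  have hmid : ∫ s in p..s₁, ∫ t in 0..P, dens W v (s, t) ≤ P * E := by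
    have h1 := integral_mono_interval_cont (continuous_integral_snd cdz 0 P)
      (fun s => intervalIntegral.integral_nonneg hP0.le fun t _ => hW.dens_nonneg z (s, t))
      (a := p) (b := s₁) (c := -(3 * R / 8)) (d := 3 * R / 8)
      (by linarith [hs₂.2]) hpq.le (by linarith [hs₁.2])
    refine le_trans (le_of_eq ?_) (h1.trans hen)
    refine intervalIntegral.integral_congr_ae ?_
    have : ∀ᵐ s : ℝ, s ≠ s₁ := by simp [ae_iff]
    filter_upwards [this] with s hs hs'
    rw [uIoc_of_le hpq.le] at hs'
    refine intervalIntegral.integral_congr fun t _ => ?_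
    have h2 : s < s₁ := lt_of_le_of_ne hs'.2 hs
    exact (dens_congr W (ev (s, t) hs'.1)).trans (dens_congr W (ew (s, t) h2))
  have hB : CT * P * (C₃ * (P / R)) = P * (CT * C₃ * (P / R)) := by ring
  have hright : ∫ s in s₁..s₁ + P, ∫ t in 0..P, dens W v (s, t)
      ≤ (C + 1) * (P * (CT * C₃ * (P / R))) := by
    have h0 : ∫ s in s₁..s₁ + P, ∫ t in 0..P, dens W v (s, t)
        = ∫ s in 0..P, ∫ t in 0..P, dens W w (s₁ + s, t) := by
      have h := intervalIntegral.integral_comp_add_left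
        (fun s => ∫ t in 0..P, dens W v (s, t)) s₁ (a := 0) (b := P)
      rw [add_zero] at h
      rw [← h]
      refine intervalIntegral.integral_congr fun s hs => ?_
      rw [uIcc_of_le hP0.le] at hs
      refine intervalIntegral.integral_congr fun t _ => ?_
      exact dens_congr W (ev (s₁ + s, t) (by simpa using by linarith [hs.1]))
    rw [h0, ← hB]
    have h1 : ∫ s in 0..P, ∫ t in 0..P, dens W w (s₁ + s, t)
        ≤ ∫ s in 0..P, ∫ t in 0..P, (C + 1) * devi a w (s₁ + 1 * s, t) := by
      refine integral_mono_cont (continuous_integral_snd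
        (g := fun y : Pt2 => dens W w (s₁ + y.1, y.2)) (by fun_prop) 0 P)
        (continuous_integral_snd
        (g := fun y : Pt2 => (C + 1) * devi a w (s₁ + 1 * y.1, y.2)) (by fun_prop) 0 P) hP0.le
        fun s _ => integral_mono_cont (by fun_prop) (by fun_prop) hP0.le fun t _ => ?_
      have := hW.dens_le_devi (κ := 1) (by norm_num) w (s₁ + s, t)
      rw [one_smul] at this
      rwa [one_mul]
    refine h1.trans ?_
    simp only [intervalIntegral.integral_const_mul]
    refine mul_le_mul_of_nonneg_left (hwe.trans ?_) (by positivity)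
    exact mul_le_mul_of_nonneg_left hl₁ (by positivity)
  have hleft : ∫ s in p - P..p, ∫ t in 0..P, dens W v (s, t)
      ≤ (C + 1) * (P * (CT * C₃ * (P / R))) := by
    have h0 : ∫ s in p - P..p, ∫ t in 0..P, dens W v (s, t)
        = ∫ s in 0..P, ∫ t in 0..P, dens W v (p + -1 * s, t) := by
      have h := intervalIntegral.integral_comp_sub_left
        (fun s => ∫ t in 0..P, dens W v (s, t)) p (a := 0) (b := P)
      rw [sub_zero] at h
      rw [← h]
      simp only [neg_one_mul, ← sub_eq_add_neg]
    rw [h0, ← hB]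
    have h1 : ∫ s in 0..P, ∫ t in 0..P, dens W v (p + -1 * s, t)
        ≤ ∫ s in 0..P, ∫ t in 0..P, (C + 1) * devi (-a) v (p + -1 * s, t) := by
      refine integral_mono_cont (continuous_integral_snd
        (g := fun y : Pt2 => dens W v (p + -1 * y.1, y.2)) (by fun_prop) 0 P)
        (continuous_integral_snd
        (g := fun y : Pt2 => (C + 1) * devi (-a) v (p + -1 * y.1, y.2)) (by fun_prop) 0 P) hP0.le
        fun s _ => integral_mono_cont (by fun_prop) (by fun_prop) hP0.le fun t _ => ?_
      have := hW.dens_le_devi (κ := -1) (by norm_num) v (p + -1 * s, t)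
      rwa [neg_one_smul] at this
    refine h1.trans ?_
    simp only [intervalIntegral.integral_const_mul]
    refine mul_le_mul_of_nonneg_left (hve.trans ?_) (by positivity)
    refine mul_le_mul_of_nonneg_left (le_trans (le_of_eq ?_) hl₂) (by positivity)
    congr 1
    · exact intervalIntegral.integral_congr fun t _ => devi_congr _ (ew (p, t) hpq)
    · refine intervalIntegral.integral_congr fun s hs => ?_
      rw [uIcc_of_le zero_le_one] at hs
      refine intervalIntegral.integral_congr fun t _ => transv_congr (ew (p + -1 * s, t) ?_)
      simp only
      linarith [hs.1]
  rw [inv_mul_le_iff₀ hP0]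
  linarith

/-- A smooth odd nondecreasing switch from `-1` to `1`. -/
theorem exists_switch : ∃ (ζ ζ' : ℝ → ℝ) (B : ℝ), 1 ≤ B ∧ Continuous ζ' ∧
    (∀ x, HasDerivAt ζ (ζ' x) x) ∧ (∀ x, |ζ' x| ≤ B) ∧ (∀ x, ζ (-x) = -ζ x) ∧ (∀ x, |ζ x| ≤ 1) ∧
    (∀ x, 0 ≤ x → 0 ≤ ζ x) ∧ (∀ x, 1 ≤ x → ζ x = 1) := by
  set ζ : ℝ → ℝ := fun x => Real.smoothTransition x - Real.smoothTransition (-x) with hζ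
  have hsm : ContDiff ℝ 1 ζ := Real.smoothTransition.contDiff.sub
    (Real.smoothTransition.contDiff.comp contDiff_neg)
  have hpos : ∀ x, 0 ≤ x → ζ x = Real.smoothTransition x := fun x hx => by
    simp [hζ, Real.smoothTransition.zero_of_nonpos (neg_nonpos.2 hx)]
  have hodd : ∀ x, ζ (-x) = -ζ x := fun x => by simp [hζ]
  have hone : ∀ x, 1 ≤ x → ζ x = 1 := fun x hx => by
    rw [hpos x (by linarith), Real.smoothTransition.one_of_one_le hx]
  have hcont : Continuous (deriv ζ) := hsm.continuous_deriv le_rfl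
  obtain ⟨B, hB⟩ := (isCompact_Icc (a := (-1 : ℝ)) (b := 1)).exists_bound_of_continuousOn
    hcont.continuousOn
  refine ⟨ζ, deriv ζ, max B 1, le_max_right _ _, hcont,
    fun x => (hsm.differentiable (by simp) x).hasDerivAt, fun x => ?_, hodd, fun x => ?_,
    fun x hx => ?_, hone⟩
  · by_cases hx : x ∈ Icc (-1 : ℝ) 1
    · exact (hB x hx).trans (le_max_left _ _)
    · have : deriv ζ x = 0 := by
        rw [mem_Icc, not_and_or, not_le, not_le] at hx
        rcases hx with hx | hx
        · have : ζ =ᶠ[𝓝 x] fun _ => -1 := by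
            filter_upwards [Iio_mem_nhds hx] with y hy
            rw [mem_Iio] at hy
            have := hone (-y) (by linarith)
            rw [hodd] at this
            linarith
          rw [this.deriv_eq, deriv_const]
        · have : ζ =ᶠ[𝓝 x] fun _ => 1 := by
            filter_upwards [Ioi_mem_nhds hx] with y hy
            exact hone y (le_of_lt hy)
          rw [this.deriv_eq, deriv_const]
      rw [this, abs_zero]
      exact zero_le_one.trans (le_max_right _ _)
  · have h1 := Real.smoothTransition.nonneg x
    have h2 := Real.smoothTransition.le_one x
    have h3 := Real.smoothTransition.nonneg (-x)
    have h4 := Real.smoothTransition.le_one (-x)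
    rw [abs_le]
    simp only [hζ]
    constructor <;> linarith
  · rw [hpos x hx]
    exact Real.smoothTransition.nonneg x

/-- A periodic zigzag of period `2 * M` with slopes `1` and `-1` off layers of fixed length. -/
theorem exists_zigzag : ∃ l > 0, ∀ M : ℝ, 2 * l < M → ∃ Θ Θ' Θ'' : ℝ → ℝ,
    ContDiff ℝ 2 Θ ∧ (∀ x, HasDerivAt Θ (Θ' x) x) ∧ (∀ x, HasDerivAt Θ' (Θ'' x) x) ∧
    (∀ x, Θ (x + 2 * M) = Θ x) ∧ (∀ x, Θ x ∈ Icc 0 M) ∧ (∀ x, |Θ' x| ≤ 1) ∧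
    (∀ x, |Θ'' x| ≤ 1) ∧
    (∃ d, ∀ x ∈ Ioo l (M - l), Θ' x = 1 ∧ Θ'' x = 0 ∧ Θ x = x + d) ∧
    (∃ d, ∀ x ∈ Ioo (M + l) (2 * M - l), Θ' x = -1 ∧ Θ'' x = 0 ∧ Θ x = d - x) := by
  obtain ⟨ζ, ζ', B, hB, hζ'c, hζ', hζ'B, hodd, habs, hpos, hone⟩ := exists_switch
  have hB0 : 0 < B := by linarith
  have hpi := Real.pi_pos
  refine ⟨Real.pi * B / 2, by positivity, fun M hM => ?_⟩
  set l := Real.pi * B / 2 with hl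
  have hl0 : 0 < l := by positivity
  have hM0 : 0 < M := by linarith
  set S : ℝ → ℝ := fun x => M / (Real.pi * B) * Real.sin (Real.pi * x / M) with hS
  have hSder : ∀ x, HasDerivAt S (B⁻¹ * Real.cos (Real.pi * x / M)) x := by
    intro x
    have h1 : HasDerivAt (fun x => Real.pi * x / M) (Real.pi / M) x := by
      simpa using ((hasDerivAt_id x).const_mul Real.pi).div_const M
    refine ((h1.sin).const_mul (M / (Real.pi * B))).congr_deriv ?_
    field_simp
  have hSadd : ∀ x, S (x + M) = -S x := by
    intro x
    have : Real.pi * (x + M) / M = Real.pi * x / M + Real.pi := by field_simp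
    simp only [hS, this, Real.sin_add_pi]
    ring
  have hSref : ∀ x, S (M - x) = S x := by
    intro x
    have : Real.pi * (M - x) / M = Real.pi - Real.pi * x / M := by field_simp
    simp only [hS, this, Real.sin_pi_sub]
  have hSnonneg : ∀ x ∈ Icc 0 M, 0 ≤ S x := by
    intro x hx
    refine mul_nonneg (by positivity) (Real.sin_nonneg_of_nonneg_of_le_pi ?_ ?_)
    · have := hx.1
      positivity
    · rw [div_le_iff₀ hM0]
      exact mul_le_mul_of_nonneg_left hx.2 hpi.le
  have hShalf : ∀ x, l ≤ x → x ≤ M / 2 → 1 ≤ S x := by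
    intro x h1 h2
    have h0 : 0 ≤ x := by linarith
    have h3 := Real.mul_le_sin (x := Real.pi * x / M) (by positivity) (by
      rw [div_le_iff₀ hM0]
      nlinarith)
    have h4 : M / (Real.pi * B) * (2 / Real.pi * (Real.pi * x / M)) ≤ S x := by
      simp only [hS]
      gcongr
    have h5 : M / (Real.pi * B) * (2 / Real.pi * (Real.pi * x / M)) = x / l := by
      rw [hl]; field_simp
    rw [h5] at h4
    exact ((one_le_div hl0).2 h1).trans h4
  have hSone : ∀ x ∈ Ioo l (M - l), 1 ≤ S x := by
    intro x hx
    rcases le_total x (M / 2) with h | h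
    · exact hShalf x hx.1.le h
    · rw [← hSref]
      exact hShalf _ (by linarith [hx.2]) (by linarith)
  set g : ℝ → ℝ := fun x => ζ (S x) with hg
  set g' : ℝ → ℝ := fun x => ζ' (S x) * (B⁻¹ * Real.cos (Real.pi * x / M)) with hg'
  have hgder : ∀ x, HasDerivAt g (g' x) x := fun x => (hζ' (S x)).comp x (hSder x)
  have hScont : Continuous S := by fun_prop
  have hζc : Continuous ζ := continuous_iff_continuousAt.2 fun x => (hζ' x).continuousAt
  have hgc : Continuous g := hζc.comp hScont
  have hg'c : Continuous g' := by fun_prop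
  set Θ : ℝ → ℝ := fun x => ∫ y in 0..x, g y with hΘ
  have hΘder : ∀ x, HasDerivAt Θ (g x) x := fun x => hgc.integral_hasStrictDerivAt 0 x |>.hasDerivAt
  have hgadd : ∀ x, g (x + M) = -g x := fun x => by simp only [hg, hSadd, hodd]
  have hgnn : ∀ x ∈ Icc 0 M, 0 ≤ g x := fun x hx => hpos _ (hSnonneg x hx)
  have hgi : ∀ p q, IntervalIntegrable g volume p q := fun p q => hgc.intervalIntegrable p q
  have hΘ0 : Θ 0 = 0 := intervalIntegral.integral_same
  have hΘadd : ∀ x, Θ (x + M) = Θ M - Θ x := by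
    intro x
    simp only [hΘ]
    rw [← intervalIntegral.integral_add_adjacent_intervals (hgi 0 M) (hgi M (x + M))]
    have h := intervalIntegral.integral_comp_add_right g M (a := 0) (b := x)
    rw [zero_add] at h
    rw [← h]
    simp only [hgadd, intervalIntegral.integral_neg]
    ring
  have hΘper : ∀ x, Θ (x + 2 * M) = Θ x := by
    intro x
    rw [show x + 2 * M = x + M + M by ring, hΘadd, hΘadd]
    ring
  have hΘsub : ∀ x y, 0 ≤ x → x ≤ y → y ≤ M → 0 ≤ Θ y - Θ x ∧ Θ y - Θ x ≤ y - x := by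
    intro x y hx hxy hy
    have h1 : Θ y - Θ x = ∫ t in x..y, g t :=
      intervalIntegral.integral_interval_sub_left (hgi 0 y) (hgi 0 x)
    rw [h1]
    refine ⟨intervalIntegral.integral_nonneg hxy fun t ht => hgnn t ⟨by linarith [ht.1],
      by linarith [ht.2]⟩, ?_⟩
    have := integral_mono_cont (g := fun _ => 1) hgc (by fun_prop) hxy
      fun t _ => (abs_le.1 (habs (S t))).2
    simpa using this
  have hΘIcc : ∀ x, Θ x ∈ Icc 0 M := by
    intro x
    have hp : Function.Periodic Θ (2 * M) := hΘper
    obtain ⟨y, hy, hxy⟩ := hp.exists_mem_Ico₀ (by linarith) x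
    rw [hxy]
    rcases le_total y M with h | h
    · have := hΘsub 0 y le_rfl hy.1 h
      rw [hΘ0] at this
      exact ⟨by linarith, by linarith⟩
    · have h1 := hΘadd (y - M)
      rw [sub_add_cancel] at h1
      have h2 := hΘsub (y - M) M (by linarith) (by linarith [hy.2]) le_rfl
      rw [h1]
      exact ⟨by linarith, by linarith⟩
  have hflat : ∀ x ∈ Ioo l (M - l), g x = 1 := fun x hx => hone _ (hSone x hx)
  have hflat' : ∀ x ∈ Ioo l (M - l), g' x = 0 := by
    intro x hx
    have h1 : g =ᶠ[𝓝 x] fun _ => 1 := by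
      filter_upwards [isOpen_Ioo.mem_nhds hx] with y hy using hflat y hy
    exact (hgder x).unique ((hasDerivAt_const x 1).congr_of_eventuallyEq h1)
  have hflatΘ : ∀ x ∈ Ioo l (M - l), Θ x = x + (Θ (M / 2) - M / 2) := by
    intro x hx
    have h1 : Θ x - Θ (M / 2) = ∫ t in M / 2..x, g t :=
      intervalIntegral.integral_interval_sub_left (hgi 0 x) (hgi 0 (M / 2))
    have h2 : ∫ t in M / 2..x, g t = ∫ t in M / 2..x, (1 : ℝ) := by
      refine intervalIntegral.integral_congr fun t ht => hflat t ?_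
      exact (ordConnected_Ioo.uIcc_subset ⟨by linarith, by linarith⟩ hx) ht
    rw [h2, intervalIntegral.integral_const, smul_eq_mul, mul_one] at h1
    linarith
  have hshift : ∀ x ∈ Ioo (M + l) (2 * M - l), x - M ∈ Ioo l (M - l) := fun x hx =>
    ⟨by linarith [hx.1], by linarith [hx.2]⟩
  have hg'add : ∀ x, g' (x + M) = -g' x := by
    intro x
    have h1 : HasDerivAt (fun x => g (x + M)) (g' (x + M)) x := (hgder (x + M)).comp_add_const x M
    have h2 : HasDerivAt (fun x => g (x + M)) (-g' x) x := by
      simp only [hgadd]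
      exact (hgder x).fun_neg
    exact h1.unique h2
  have hΘc : ContDiff ℝ 2 Θ := by
    have e1 : deriv Θ = g := funext fun x => (hΘder x).deriv
    have e2 : deriv g = g' := funext fun x => (hgder x).deriv
    rw [show (2 : WithTop ℕ∞) = 1 + 1 by norm_num, contDiff_succ_iff_deriv]
    refine ⟨fun x => (hΘder x).differentiableAt, by simp, ?_⟩
    rw [e1, contDiff_one_iff_deriv, e2]
    exact ⟨fun x => (hgder x).differentiableAt, hg'c⟩
  refine ⟨Θ, g, g', hΘc, hΘder, hgder, hΘper, hΘIcc, fun x => habs _, fun x => ?_,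
    ⟨_, fun x hx => ⟨hflat x hx, hflat' x hx, hflatΘ x hx⟩⟩,
    ⟨Θ M - (Θ (M / 2) - M / 2) + M, fun x hx => ?_⟩⟩
  · simp only [hg', abs_mul, abs_inv, abs_of_pos hB0]
    have h1 := hζ'B (S x)
    have h2 := Real.abs_cos_le_one (Real.pi * x / M)
    calc _ ≤ B * (B⁻¹ * 1) := by gcongr
      _ = 1 := by field_simp
  · have hx' := hshift x hx
    have h1 := hgadd (x - M)
    have h2 := hg'add (x - M)
    have h3 := hΘadd (x - M)
    rw [sub_add_cancel] at h1 h2 h3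
    rw [h1, h2, h3, hflat _ hx', hflat' _ hx', hflatΘ _ hx']
    refine ⟨rfl, neg_zero, by ring⟩

/-- A smooth map of the line into `(-1/2, 1/2)` which is the identity near the origin. -/
theorem exists_squeeze : ∃ ρ : ℝ → ℝ, ContDiff ℝ 2 ρ ∧ (∀ x, |ρ x| < 1 / 2) ∧
    ∀ x, |x| < 3 / 8 → ρ x = x := by
  set χ : ℝ → ℝ := fun x => Real.smoothTransition (64 * (3 / 16 - x ^ 2)) with hχ
  have hc : ContDiff ℝ 2 χ := Real.smoothTransition.contDiff.comp (by fun_prop)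
  refine ⟨fun x => χ x * x, hc.mul contDiff_id, fun x => ?_, fun x hx => ?_⟩
  · have h0 : 0 ≤ χ x := Real.smoothTransition.nonneg _
    have h1 : χ x ≤ 1 := Real.smoothTransition.le_one _
    rcases lt_or_ge (|x|) (1 / 2) with h | h
    · rw [abs_mul, abs_of_nonneg h0]
      exact (mul_le_of_le_one_left (abs_nonneg x) h1).trans_lt h
    · have : χ x = 0 := Real.smoothTransition.zero_of_nonpos (by nlinarith [sq_abs x])
      simp [this]
  · have : χ x = 1 := Real.smoothTransition.one_of_one_le (by nlinarith [sq_abs x, abs_nonneg x])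
    simp [this]

section FoldCalculus

variable {v : Pt2 → V3} {Θ Θ' Θ'' : ℝ → ℝ} {β s t : ℝ}

theorem hasDerivAt_fold (hm : DifferentiableAt ℝ v (s, Θ t + β)) (hΘ : HasDerivAt Θ (Θ' t) t) :
    HasDerivAt (fun x => v (s, Θ x + β)) (Θ' t • qd f2 v (s, Θ t + β)) t :=
  HasDerivAt.scomp (g₁ := fun x => v (s, x)) (h := fun x => Θ x + β) t (hasDerivAt_snd hm)
    (hΘ.add_const β)

theorem qd_f1_fold (hm : DifferentiableAt ℝ v (s, Θ t + β)) (hΘ : HasDerivAt Θ (Θ' t) t) :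
    qd f1 (fun y => v (y.1, Θ y.2 + β)) (s, t) = qd f1 v (s, Θ t + β) := by
  refine qd_f1_eq ?_ (hasDerivAt_fst hm)
  have h1 : DifferentiableAt ℝ Θ t := hΘ.differentiableAt
  exact DifferentiableAt.comp (s, t) (g := v) (f := fun y : Pt2 => (y.1, Θ y.2 + β)) hm
      (by fun_prop)

theorem qd_f2_fold (hm : DifferentiableAt ℝ v (s, Θ t + β)) (hΘ : HasDerivAt Θ (Θ' t) t) :
    qd f2 (fun y => v (y.1, Θ y.2 + β)) (s, t) = Θ' t • qd f2 v (s, Θ t + β) := by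
  refine qd_f2_eq ?_ (hasDerivAt_fold hm hΘ)
  have h1 : DifferentiableAt ℝ Θ t := hΘ.differentiableAt
  exact DifferentiableAt.comp (s, t) (g := v) (f := fun y : Pt2 => (y.1, Θ y.2 + β)) hm
      (by fun_prop)

theorem differentiableAt_fold (hm : DifferentiableAt ℝ v (s, Θ t + β))
    (hΘ : HasDerivAt Θ (Θ' t) t) :
    DifferentiableAt ℝ (fun y : Pt2 => v (y.1, Θ y.2 + β)) (s, t) := by
  have h1 : DifferentiableAt ℝ Θ t := hΘ.differentiableAt
  exact DifferentiableAt.comp (s, t) (g := v) (f := fun y : Pt2 => (y.1, Θ y.2 + β)) hm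
      (by fun_prop)

theorem contDiffOn_qd {U : Set Pt2} (hU : IsOpen U) (hv : ContDiffOn ℝ 2 v U) (e : Pt2) :
    ContDiffOn ℝ 1 (qd e v) U := by
  have h1 : ContDiffOn ℝ 1 (fderiv ℝ v) U := hv.fderiv_of_isOpen hU (by norm_num)
  exact h1.clm_apply contDiffOn_const

theorem differentiableAt_qd {U : Set Pt2} (hU : IsOpen U) (hv : ContDiffOn ℝ 2 v U) (e : Pt2)
    {y : Pt2} (hy : y ∈ U) : DifferentiableAt ℝ (qd e v) y :=
  ((contDiffOn_qd hU hv e).differentiableOn (by simp)).differentiableAt (hU.mem_nhds hy)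

theorem continuousOn_qd_qd {U : Set Pt2} (hU : IsOpen U) (hv : ContDiffOn ℝ 2 v U) (e e' : Pt2) :
    ContinuousOn (qd e' (qd e v)) U :=
  ((contDiffOn_qd hU hv e).continuousOn_fderiv_of_isOpen hU (by simp)).clm_apply
    continuousOn_const

variable {U : Set Pt2}

theorem fold_mem_nhds (hU : IsOpen U) (hΘ : ∀ x, HasDerivAt Θ (Θ' x) x)
    (hy : (s, Θ t + β) ∈ U) : ∀ᶠ y : Pt2 in 𝓝 (s, t), (y.1, Θ y.2 + β) ∈ U := by
  have hc : Continuous Θ := continuous_iff_continuousAt.2 fun x => (hΘ x).continuousAt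
  have hm : Continuous fun y : Pt2 => (y.1, Θ y.2 + β) := by fun_prop
  exact (hU.preimage hm).mem_nhds hy

theorem fold_derivatives (hU : IsOpen U) (hv : ContDiffOn ℝ 2 v U)
    (hΘ : ∀ x, HasDerivAt Θ (Θ' x) x) (hΘ' : ∀ x, HasDerivAt Θ' (Θ'' x) x)
    (hy : (s, Θ t + β) ∈ U) :
    let z : Pt2 → V3 := fun y => v (y.1, Θ y.2 + β)
    let m : Pt2 := (s, Θ t + β)
    qd f1 z (s, t) = qd f1 v m ∧ qd f2 z (s, t) = Θ' t • qd f2 v m ∧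
    qd f1 (qd f1 z) (s, t) = qd f1 (qd f1 v) m ∧
    qd f2 (qd f1 z) (s, t) = Θ' t • qd f2 (qd f1 v) m ∧
    qd f2 (qd f2 z) (s, t) = Θ' t • Θ' t • qd f2 (qd f2 v) m + Θ'' t • qd f2 v m := by
  intro z m
  have hd : ∀ y ∈ U, DifferentiableAt ℝ v y := fun y hy =>
    (hv.differentiableOn (by simp)).differentiableAt (hU.mem_nhds hy)
  have hn := fold_mem_nhds hU hΘ hy
  have e1 : qd f1 z =ᶠ[𝓝 (s, t)] fun y => qd f1 v (y.1, Θ y.2 + β) :=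
    hn.mono fun y hy => qd_f1_fold (hd _ hy) (hΘ _)
  have e2 : qd f2 z =ᶠ[𝓝 (s, t)] fun y => Θ' y.2 • qd f2 v (y.1, Θ y.2 + β) :=
    hn.mono fun y hy => qd_f2_fold (hd _ hy) (hΘ _)
  have d1 := differentiableAt_qd hU hv f1 hy
  have d2 := differentiableAt_qd hU hv f2 hy
  refine ⟨e1.eq_of_nhds, e2.eq_of_nhds, ?_, ?_, ?_⟩
  · rw [qd_congr e1]
    exact qd_f1_fold d1 (hΘ t)
  · rw [qd_congr e1]
    exact qd_f2_fold d1 (hΘ t)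
  · rw [qd_congr e2]
    have h1 : DifferentiableAt ℝ Θ' t := (hΘ' t).differentiableAt
    have h2 := differentiableAt_fold d2 (hΘ t)
    refine qd_f2_eq ?_ ?_
    · exact (DifferentiableAt.comp (s, t) (g := Θ') (f := Prod.snd) h1
        differentiableAt_snd).fun_smul
        h2
    · exact (hΘ' t).fun_smul (hasDerivAt_fold d2 (hΘ t))

end FoldCalculus

namespace QuadBounds

variable {W : M33 → ℝ} {a : V3} {c C : ℝ} {v : Pt2 → V3} {Θ Θ' Θ'' : ℝ → ℝ} {β s t : ℝ}
  {U : Set Pt2}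

theorem dens_fold_flat (hsym : ∀ ξ : M33, W ![ξ 0, ξ 1, -(ξ 2)] = W ξ) (hU : IsOpen U)
    (hv : ContDiffOn ℝ 2 v U) (hΘ : ∀ x, HasDerivAt Θ (Θ' x) x)
    (hΘ' : ∀ x, HasDerivAt Θ' (Θ'' x) x) (hy : (s, Θ t + β) ∈ U) (h1 : Θ' t ^ 2 = 1)
    (h2 : Θ'' t = 0) :
    dens W (fun y => v (y.1, Θ y.2 + β)) (s, t) = dens W v (s, Θ t + β) := by
  obtain ⟨q1, q2, q11, q21, q22⟩ := fold_derivatives hU hv hΘ hΘ' hy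
  have hs := hsym ![qd f1 v (s, Θ t + β), 0, qd f2 v (s, Θ t + β)]
  simp only [Matrix.cons_val] at hs
  have h3 : (Θ' t * Θ' t) = 1 := by rw [← sq, h1]
  simp only [dens, W2, hess2d_eq, q1, q2, q11, q21, q22, h2, zero_smul, add_zero, smul_smul, h3,
    one_smul, sqn_smul, h1, one_mul]
  rcases sq_eq_one_iff.1 h1 with h | h
  · rw [h, one_smul]
  · rw [h, neg_one_smul, hs]

theorem dens_fold_le (hW : QuadBounds W a c C) (hU : IsOpen U)
    (hv : ContDiffOn ℝ 2 v U) (hΘ : ∀ x, HasDerivAt Θ (Θ' x) x)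
    (hΘ' : ∀ x, HasDerivAt Θ' (Θ'' x) x) (hy : (s, Θ t + β) ∈ U) (h1 : |Θ' t| ≤ 1)
    (h2 : |Θ'' t| ≤ 1) :
    dens W (fun y => v (y.1, Θ y.2 + β)) (s, t)
      ≤ (C * c⁻¹ + 2 * c⁻¹ + 2) * dens W v (s, Θ t + β) := by
  obtain ⟨q1, q2, q11, q21, q22⟩ := fold_derivatives hU hv hΘ hΘ' hy
  have hc := hW.c_pos
  have hC := hW.C_pos
  have g1 : Θ' t ^ 2 ≤ 1 := (sq_le_one_iff_abs_le_one _).2 h1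
  have g2 : Θ'' t ^ 2 ≤ 1 := (sq_le_one_iff_abs_le_one _).2 h2
  simp only [dens, W2, hess2d_eq, q1, q2, q11, q21, q22]
  set p := qd f1 v (s, Θ t + β)
  set q := qd f2 v (s, Θ t + β)
  set x := qd f1 (qd f1 v) (s, Θ t + β)
  set y := qd f2 (qd f1 v) (s, Θ t + β)
  set w := qd f2 (qd f2 v) (s, Θ t + β)
  have hx := sqn_nonneg x
  have hy := sqn_nonneg y
  have hw := sqn_nonneg w
  have hq := sqn_nonneg q
  have hWn := hW.nonneg p q
  have i1 : W ![p, 0, Θ' t • q] ≤ C * c⁻¹ * W ![p, 0, q] := by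
    have h3 := hW.lower p q
    rw [← le_div_iff₀' hc, ← inv_mul_eq_div] at h3
    refine (hW.upper p (Θ' t • q)).trans ?_
    rw [mul_assoc]
    refine mul_le_mul_of_nonneg_left (le_trans ?_ h3) hC.le
    rw [sqn_smul]
    nlinarith
  have i2 := hW.sqn_le p q
  have i3 : sqn (Θ' t • y) ≤ sqn y := by
    rw [sqn_smul]; nlinarith
  have i4 : sqn (Θ' t • Θ' t • w + Θ'' t • q) ≤ 2 * sqn w + 2 * sqn q := by
    refine (sqn_add_le _ _).trans ?_
    simp only [sqn_smul]
    nlinarith [mul_nonneg (sq_nonneg (Θ' t)) hw]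
  have k0 : 0 ≤ C * c⁻¹ + 2 * c⁻¹ := by positivity
  have k1 := mul_nonneg k0 hx
  have k2 := mul_nonneg k0 hy
  have k3 := mul_nonneg k0 hw
  nlinarith

end QuadBounds

/-- Averaging over translations. -/
theorem exists_shift_lintegral_le {φ : ℝ → ℝ≥0∞} (hφ : Measurable φ) {Θ : ℝ → ℝ}
    (hΘ : Continuous Θ) (L : Set ℝ) {b d : ℝ} (hbd : b < d) :
    ∃ β ∈ Ioo b d, ∫⁻ τ in L, φ (Θ τ + β) ≤ volume L * (∫⁻ σ, φ σ) / ENNReal.ofReal (d - b) := by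
  have hmeas : Measurable (Function.uncurry fun β τ => φ (Θ τ + β)) :=
    hφ.comp (by fun_prop : Measurable fun x : ℝ × ℝ => Θ x.2 + x.1)
  have hvol : volume (Ioo b d) = ENNReal.ofReal (d - b) := Real.volume_Ioo
  obtain ⟨β, hβ, h⟩ := exists_le_setLAverage (μ := volume) (s := Ioo b d)
    (f := fun β => ∫⁻ τ in L, φ (Θ τ + β)) (by rw [hvol]; simpa using hbd) (by simp [hvol])
    hmeas.lintegral_prod_right'.aemeasurable
  refine ⟨β, hβ, h.trans ?_⟩
  rw [setLAverage_eq, hvol]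
  gcongr
  rw [lintegral_lintegral_swap hmeas.aemeasurable]
  calc _ ≤ ∫⁻ _ in L, ∫⁻ σ, φ σ := by
        refine lintegral_mono fun τ => (setLIntegral_le_lintegral _ _).trans ?_
        simp only [add_comm (Θ τ)]
        rw [lintegral_add_right_eq_self φ]
    _ = _ := by rw [lintegral_const, Measure.restrict_apply_univ, mul_comm]

theorem volume_layers_le (l M : ℝ) :
    volume (Icc 0 l ∪ (Icc (M - l) (M + l) ∪ Icc (2 * M - l) (2 * M)))
      ≤ ENNReal.ofReal l + (ENNReal.ofReal (2 * l) + ENNReal.ofReal l) := by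
  refine (measure_union_le _ _).trans (add_le_add ?_ ((measure_union_le _ _).trans
    (add_le_add ?_ ?_))) <;> rw [Real.volume_Icc] <;> exact ENNReal.ofReal_le_ofReal (by linarith)

theorem measurable_indicator_dens {W : M33 → ℝ} (hW : Continuous W) {v : Pt2 → V3} {U : Set Pt2}
    (hU : IsOpen U) (hv : ContDiffOn ℝ 2 v U) (k : ℝ) (a : V3) :
    Measurable (U.indicator fun y =>
        ENNReal.ofReal (dens W v y + k * vnorm (v y - |y.1| • a))) := by
  classical
  have h0 := hv.continuousOn
  have h1 := (contDiffOn_qd hU hv f1).continuousOn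
  have h2 := (contDiffOn_qd hU hv f2).continuousOn
  have h11 := continuousOn_qd_qd hU hv f1 f1
  have h12 := continuousOn_qd_qd hU hv f1 f2
  have h22 := continuousOn_qd_qd hU hv f2 f2
  have hw : ContinuousOn (W2 W v) U := by
    refine hW.comp_continuousOn (continuousOn_pi.2 fun j => ?_)
    fin_cases j
    · exact h1
    · exact continuousOn_const
    · exact h2
  have hh : ContinuousOn (hess2d v) U := by
    simp only [funext (hess2d_eq v)]
    fun_prop
  have hg : ContinuousOn (fun y =>
      ENNReal.ofReal (dens W v y + k * vnorm (v y - |y.1| • a))) U := by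
    refine ENNReal.continuous_ofReal.comp_continuousOn ((hw.add hh).add ?_)
    fun_prop
  rw [← piecewise_eq_indicator]
  exact hg.measurable_piecewise continuousOn_const hU.measurableSet

theorem isOpen_rect (R H : ℝ) : IsOpen (Rect R H) := isOpen_Ioo.prod isOpen_Ioo

/-- Folding a map of a rectangle into a periodic map of a strip. -/
theorem QuadBounds.exists_fold {W : M33 → ℝ} {a : V3} {c C : ℝ} (hW : QuadBounds W a c C)
    (hsym : ∀ ξ : M33, W ![ξ 0, ξ 1, -(ξ 2)] = W ξ) :
    ∃ l > 0, ∃ D > 0, ∀ (R H M k X : ℝ) (v : Pt2 → V3), 0 < R → 2 * l < M → M < H → 0 ≤ k →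
      0 ≤ X → ContDiffOn ℝ 2 v (Rect R H) →
      ∫⁻ y in Rect R H, ENNReal.ofReal (dens W v y + k * vnorm (v y - |y.1| • a))
        ≤ ENNReal.ofReal X →
      ∃ z, ContDiff ℝ 2 z ∧ (∀ s t, z (s, t + 2 * M) = z (s, t)) ∧
        ∫ s in -(3 * R / 8)..3 * R / 8, ∫ t in 0..2 * M,
          (dens W z (s, t) + k * vnorm (z (s, t) - |s| • a)) ≤ 2 * X + D * (X / (H - M)) := by
  obtain ⟨l, hl, hzig⟩ := exists_zigzag
  obtain ⟨ρ, hρ, hρlt, hρid⟩ := exists_squeeze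
  have hc := hW.c_pos
  have hC := hW.C_pos
  set C₁ := C * c⁻¹ + 2 * c⁻¹ + 2 with hC₁
  have hC₁1 : 1 ≤ C₁ := by
    have : 0 ≤ C * c⁻¹ + 2 * c⁻¹ := by positivity
    linarith
  refine ⟨l, hl, C₁ * (4 * l), by positivity, ?_⟩
  intro R H M k X v hR hlM hMH hk hX hv hvX
  obtain ⟨Θ, Θ', Θ'', hΘc, hΘ, hΘ', hper, hIcc, habs, habs', ⟨d₁, hflat₁⟩, ⟨d₂, hflat₂⟩⟩ :=
    hzig M hlM
  have hM : 0 < M := by linarith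
  set Φ : Pt2 → ℝ≥0∞ := (Rect R H).indicator
    fun y => ENNReal.ofReal (dens W v y + k * vnorm (v y - |y.1| • a)) with hΦ
  have hΦm : Measurable Φ := measurable_indicator_dens hW.cont (isOpen_rect R H) hv k a
  set φ : ℝ → ℝ≥0∞ := fun σ => ∫⁻ s, Φ (s, σ) with hφ
  have hφm : Measurable φ := hΦm.lintegral_prod_left'
  have hφX : ∫⁻ σ, φ σ ≤ ENNReal.ofReal X := by
    rw [hφ, ← lintegral_prod_symm' Φ hΦm, ← Measure.volume_eq_prod, hΦ,
      lintegral_indicator (isOpen_rect R H).measurableSet]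
    exact hvX
  set L : Set ℝ := Icc 0 l ∪ (Icc (M - l) (M + l) ∪ Icc (2 * M - l) (2 * M)) with hL
  obtain ⟨β, hβ, hβL⟩ := exists_shift_lintegral_le hφm hΘc.continuous L
    (b := -(H / 2)) (d := H / 2 - M) (by linarith)
  set z : Pt2 → V3 := fun y => v (R * ρ (y.1 / R), Θ y.2 + β) with hz
  have hmem : ∀ s t, |s| < R / 2 → (s, Θ t + β) ∈ Rect R H := by
    intro s t hs
    have := hIcc t
    rw [abs_lt] at hs
    exact ⟨⟨by linarith [hs.1], hs.2⟩, ⟨by linarith [this.1, hβ.1], by linarith [this.2, hβ.2]⟩⟩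
  have hzc : ContDiff ℝ 2 z := by
    refine hv.comp_contDiff (f := fun y : Pt2 => (R * ρ (y.1 / R), Θ y.2 + β)) ?_ fun y => ?_
    · refine ContDiff.prodMk ?_ ?_
      · exact contDiff_const.mul (hρ.comp (contDiff_fst.div_const R))
      · exact (hΘc.comp contDiff_snd).add contDiff_const
    · refine hmem _ _ ?_
      rw [abs_mul, abs_of_pos hR]
      have := hρlt (y.1 / R)
      nlinarith
  have hid : ∀ s, |s| < 3 * R / 8 → R * ρ (s / R) = s := by
    intro s hs
    rw [hρid _ (by rw [abs_div, abs_of_pos hR, div_lt_iff₀ hR]; linarith)]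
    field_simp
  have hzfold : ∀ s t, |s| < 3 * R / 8 → z =ᶠ[𝓝 (s, t)] fun y => v (y.1, Θ y.2 + β) := by
    intro s t hs
    have ho : IsOpen {y : Pt2 | |y.1| < 3 * R / 8} :=
      isOpen_lt (by fun_prop) continuous_const
    filter_upwards [ho.mem_nhds hs] with y hy
    simp only [hz, hid _ hy]
  set g : Pt2 → ℝ := fun y => dens W z y + k * vnorm (z y - |y.1| • a) with hg
  have hgc : Continuous g := by
    have h1 := continuous_dens hW.cont hzc
    have h2 := hzc.continuous
    fun_prop
  have hg0 : ∀ y, 0 ≤ g y := fun y =>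
    add_nonneg (hW.dens_nonneg _ _) (mul_nonneg hk (vnorm_nonneg _))
  set S : Set ℝ := Ioo (-(3 * R / 8)) (3 * R / 8) with hS
  have hSabs : ∀ s ∈ S, |s| < 3 * R / 8 := fun s hs => abs_lt.2 hs
  have hflatpt : ∀ s ∈ S, ∀ t, Θ' t ^ 2 = 1 → Θ'' t = 0 →
      ENNReal.ofReal (g (s, t)) ≤ Φ (s, Θ t + β) := by
    intro s hs t h1 h2
    have hs' := hSabs s hs
    have hm := hmem s t (by linarith)
    rw [hΦ, indicator_of_mem hm]
    refine ENNReal.ofReal_le_ofReal (le_of_eq ?_)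
    simp only [hg]
    rw [dens_congr W (hzfold s t hs'), (hzfold s t hs').eq_of_nhds,
      dens_fold_flat hsym (isOpen_rect R H) hv hΘ hΘ' hm h1 h2]
  have hpt : ∀ s ∈ S, ∀ t, ENNReal.ofReal (g (s, t)) ≤ ENNReal.ofReal C₁ * Φ (s, Θ t + β) := by
    intro s hs t
    have hs' := hSabs s hs
    have hm := hmem s t (by linarith)
    rw [hΦ, indicator_of_mem hm, ← ENNReal.ofReal_mul (by linarith)]
    refine ENNReal.ofReal_le_ofReal ?_
    simp only [hg]
    rw [dens_congr W (hzfold s t hs'), (hzfold s t hs').eq_of_nhds, mul_add]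
    refine add_le_add (hW.dens_fold_le (isOpen_rect R H) hv hΘ hΘ' hm (habs t) (habs' t)) ?_
    exact le_mul_of_one_le_left (mul_nonneg hk (vnorm_nonneg _)) hC₁1
  refine ⟨z, hzc, fun s t => by simp only [hz, hper], ?_⟩
  have hXd : 0 ≤ X / (H - M) := div_nonneg hX (by linarith)
  have hD : 0 ≤ C₁ * (4 * l) * (X / (H - M)) := by positivity
  have hrect := lintegral_rect_eq hgc hg0 (a := -(3 * R / 8)) (b := 3 * R / 8) (c := 0)
    (d := 2 * M) (by linarith) (by linarith)
  refine (ENNReal.ofReal_le_ofReal_iff (by positivity)).1 ?_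
  rw [← hrect, Measure.volume_eq_prod, setLIntegral_prod_symm _ (by fun_prop)]
  have hcover : Ioo 0 (2 * M) ⊆ Ioo l (M - l) ∪ (Ioo (M + l) (2 * M - l) ∪ L) := by
    intro t ht
    by_contra! h
    simp only [hL, mem_union, mem_Ioo, mem_Icc, not_or, not_and_or, not_lt, not_le] at h ht
    obtain ⟨h1, h2, h3, h4, h5⟩ := h
    rcases h1 with h1 | h1 <;> rcases h2 with h2 | h2 <;> rcases h3 with h3 | h3 <;>
      rcases h4 with h4 | h4 <;> rcases h5 with h5 | h5 <;> linarith [ht.1, ht.2]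
  set G : ℝ → ℝ≥0∞ := fun t => ∫⁻ s in S, ENNReal.ofReal (g (s, t)) with hG
  have hSm : MeasurableSet S := measurableSet_Ioo
  have hGflat : ∀ t, Θ' t ^ 2 = 1 → Θ'' t = 0 → G t ≤ φ (Θ t + β) := fun t h1 h2 =>
    (setLIntegral_mono' hSm fun s hs => hflatpt s hs t h1 h2).trans (setLIntegral_le_lintegral _ _)
  have hG1 : ∫⁻ t in Ioo l (M - l), G t ≤ ENNReal.ofReal X := by
    refine le_trans ?_ hφX
    rw [← lintegral_add_right_eq_self φ (d₁ + β)]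
    refine (setLIntegral_mono' measurableSet_Ioo fun t ht => ?_).trans
      (setLIntegral_le_lintegral _ _)
    obtain ⟨h1, h2, h3⟩ := hflat₁ t ht
    rw [← add_assoc, ← h3]
    exact hGflat t (by rw [h1]; norm_num) h2
  have hG2 : ∫⁻ t in Ioo (M + l) (2 * M - l), G t ≤ ENNReal.ofReal X := by
    refine le_trans ?_ hφX
    rw [← lintegral_sub_left_eq_self φ (d₂ + β)]
    refine (setLIntegral_mono' measurableSet_Ioo fun t ht => ?_).trans
      (setLIntegral_le_lintegral _ _)
    obtain ⟨h1, h2, h3⟩ := hflat₂ t ht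
    rw [show d₂ + β - t = Θ t + β by rw [h3]; ring]
    exact hGflat t (by rw [h1]; norm_num) h2
  have hG3 : ∫⁻ t in L, G t ≤ ENNReal.ofReal (C₁ * (4 * l) * (X / (H - M))) := by
    have hle : ∀ t, G t ≤ ENNReal.ofReal C₁ * φ (Θ t + β) := fun t => by
      refine (setLIntegral_mono' hSm fun s hs => hpt s hs t).trans
        ((setLIntegral_le_lintegral _ _).trans ?_)
      rw [lintegral_const_mul' _ _ ENNReal.ofReal_ne_top]
    refine (lintegral_mono hle).trans ?_
    rw [lintegral_const_mul' _ _ ENNReal.ofReal_ne_top]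
    have hvol : volume L ≤ ENNReal.ofReal (4 * l) := by
      refine (volume_layers_le l M).trans (le_of_eq ?_)
      rw [← ENNReal.ofReal_add (by positivity) (by positivity),
        ← ENNReal.ofReal_add (by positivity) (by positivity)]
      congr 1
      ring
    have h1 : volume L * (∫⁻ σ, φ σ) / ENNReal.ofReal (H / 2 - M - -(H / 2))
        ≤ ENNReal.ofReal (4 * l * (X / (H - M))) := by
      rw [show H / 2 - M - -(H / 2) = H - M by ring, ← mul_div_assoc,
        ENNReal.ofReal_div_of_pos (by linarith), ENNReal.ofReal_mul (by positivity)]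
      gcongr
    rw [mul_assoc, ENNReal.ofReal_mul (by positivity)]
    gcongr
    exact hβL.trans h1
  calc _ ≤ ∫⁻ t in Ioo l (M - l) ∪ (Ioo (M + l) (2 * M - l) ∪ L), G t := lintegral_mono_set hcover
    _ ≤ (∫⁻ t in Ioo l (M - l), G t) + ((∫⁻ t in Ioo (M + l) (2 * M - l), G t) + ∫⁻ t in L, G t) :=
      (lintegral_union_le _ _ _).trans (add_le_add le_rfl (lintegral_union_le _ _ _))
    _ ≤ ENNReal.ofReal X + (ENNReal.ofReal X
          + ENNReal.ofReal (C₁ * (4 * l) * (X / (H - M)))) := by gcongr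
    _ = _ := by
      rw [← ENNReal.ofReal_add hX hD, ← ENNReal.ofReal_add hX (by positivity)]
      congr 1
      ring

theorem contDiffOn_pd {u : Pt → V3} {U : Set Pt} (hU : IsOpen U) (hu : ContDiffOn ℝ 2 u U)
    (e : Pt) : ContDiffOn ℝ 1 (pd e u) U := by
  have h1 : ContDiffOn ℝ 1 (fderiv ℝ u) U := hu.fderiv_of_isOpen hU (by norm_num)
  exact h1.clm_apply contDiffOn_const

theorem continuousOn_pd_pd {u : Pt → V3} {U : Set Pt} (hU : IsOpen U) (hu : ContDiffOn ℝ 2 u U)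
    (e e' : Pt) : ContinuousOn (pd e' (pd e u)) U :=
  ((contDiffOn_pd hU hu e).continuousOn_fderiv_of_isOpen hU (by simp)).clm_apply
    continuousOn_const

theorem isOpen_Q3 : IsOpen Q3 := isOpen_Ioo.prod (isOpen_Ioo.prod isOpen_Ioo)

theorem vnorm_smul (r : ℝ) (v : V3) : vnorm (r • v) = |r| * vnorm v := by
  change √(sqn (r • v)) = |r| * √(sqn v)
  rw [sqn_smul, Real.sqrt_mul (sq_nonneg _), Real.sqrt_sq_eq_abs]

/-- The plane `x₂ = x` in anisotropically rescaled coordinates. -/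
def slicePt (ε η x : ℝ) (y : Pt2) : Pt := (ε * y.1, x, η * y.2)

theorem contDiff_slicePt (ε η x : ℝ) : ContDiff ℝ 2 (slicePt ε η x) := by
  unfold slicePt
  fun_prop

theorem qd_slice {w : Pt → V3} {ε η x : ℝ} {y : Pt2}
    (hw : DifferentiableAt ℝ w (slicePt ε η x y)) (r : ℝ) :
    qd f1 (fun y => r • w (slicePt ε η x y)) y = (r * ε) • pd e1 w (slicePt ε η x y) ∧
    qd f2 (fun y => r • w (slicePt ε η x y)) y = (r * η) • pd e3 w (slicePt ε η x y) := by
  have hj : HasFDerivAt (slicePt ε η x)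
      ((ε • ContinuousLinearMap.fst ℝ ℝ ℝ).prod
        ((0 : Pt2 →L[ℝ] ℝ).prod (η • ContinuousLinearMap.snd ℝ ℝ ℝ))) y := by
    unfold slicePt
    refine HasFDerivAt.prodMk (hasFDerivAt_fst.const_mul ε)
      ((hasFDerivAt_const x y).prodMk (hasFDerivAt_snd.const_mul η))
  have h := (hw.hasFDerivAt.comp y hj).const_smul r
  have h' : fderiv ℝ (fun y => r • w (slicePt ε η x y)) y = _ := h.fderiv
  simp only [qd, pd, h']
  have x1 : ((ε, 0, 0) : Pt) = ε • e1 := by simp [e1]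
  have x3 : ((0, 0, η) : Pt) = η • e3 := by simp [e3]
  constructor
  · simp [f1, x1, mul_smul]
  · simp [f2, x3, mul_smul]

/-- The part of the energy density seen by a plane `x₂ = const`. -/
noncomputable def sliceDens (W : M33 → ℝ) (h ε : ℝ) (u : Pt → V3) (x : Pt) : ℝ :=
  ε⁻¹ * W ![pd e1 u x, 0, h⁻¹ • pd e3 u x] +
    ε * (sqn (pd e1 (pd e1 u) x) + 2 * (h⁻¹) ^ 2 * sqn (pd e3 (pd e1 u) x)
      + (h⁻¹) ^ 4 * sqn (pd e3 (pd e3 u) x))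

theorem sliceDens_le {W : M33 → ℝ} (h4 : H4 W) {h ε : ℝ} (hε : 0 < ε) (u : Pt → V3) (x : Pt) :
    sliceDens W h ε u x ≤ ε⁻¹ * W (gradh h u x) + ε * hessh h u x := by
  have := h4 (gradh h u x)
  simp only [gradh, Matrix.cons_val_zero, Matrix.cons_val] at this
  simp only [sliceDens, hessh, vnorm_sq, gradh]
  have k1 := sqn_nonneg (pd e2 (pd e2 u) x)
  have k2 := sqn_nonneg (pd e2 (pd e1 u) x)
  have k3 := mul_nonneg (sq_nonneg h⁻¹) (sqn_nonneg (pd e3 (pd e2 u) x))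
  refine add_le_add (by gcongr) (mul_le_mul_of_nonneg_left ?_ hε.le)
  linarith

theorem dens_slice {W : M33 → ℝ} {u : Pt → V3} (hu : ContDiffOn ℝ 2 u Q3) {h ε x : ℝ}
    (hε : 0 < ε) {y : Pt2} (hy : slicePt ε (ε / h) x y ∈ Q3) :
    dens W (fun y => ε⁻¹ • u (slicePt ε (ε / h) x y)) y
      = ε * sliceDens W h ε u (slicePt ε (ε / h) x y) := by
  have hev : ∀ᶠ y in 𝓝 y, slicePt ε (ε / h) x y ∈ Q3 :=
    (isOpen_Q3.preimage (contDiff_slicePt ε (ε / h) x).continuous).mem_nhds hy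
  have hd : ∀ {z}, z ∈ Q3 → DifferentiableAt ℝ u z := fun hz =>
    (hu.differentiableOn (by simp)).differentiableAt (isOpen_Q3.mem_nhds hz)
  have hd' : ∀ e {z}, z ∈ Q3 → DifferentiableAt ℝ (pd e u) z := fun e {z} hz =>
    ((contDiffOn_pd isOpen_Q3 hu e).differentiableOn (by simp)).differentiableAt
      (isOpen_Q3.mem_nhds hz)
  have g1 : qd f1 (fun y => ε⁻¹ • u (slicePt ε (ε / h) x y)) =ᶠ[𝓝 y]
      fun y => (1 : ℝ) • pd e1 u (slicePt ε (ε / h) x y) := by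
    filter_upwards [hev] with z hz
    rw [(qd_slice (hd hz) _).1, inv_mul_cancel₀ hε.ne']
  have g2 : qd f2 (fun y => ε⁻¹ • u (slicePt ε (ε / h) x y)) =ᶠ[𝓝 y]
      fun y => h⁻¹ • pd e3 u (slicePt ε (ε / h) x y) := by
    filter_upwards [hev] with z hz
    rw [(qd_slice (hd hz) _).2]
    congr 1
    field_simp
  simp only [dens, W2, hess2d_eq, g1.eq_of_nhds, g2.eq_of_nhds, qd_congr g1, qd_congr g2,
    (qd_slice (hd' e1 hy) 1).1, (qd_slice (hd' e1 hy) 1).2, (qd_slice (hd' e3 hy) h⁻¹).2]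
  simp only [sliceDens, sqn_smul, one_smul]
  field_simp

theorem measurable_indicator_sliceDens {W : M33 → ℝ} (hW : Continuous W) {u : Pt → V3}
    (hu : ContDiffOn ℝ 2 u Q3) (h ε k : ℝ) (a : V3) :
    Measurable (Q3.indicator fun x =>
      ENNReal.ofReal (sliceDens W h ε u x) +
          ENNReal.ofReal k * ENNReal.ofReal (vnorm (u x - u0 a x))) := by
  classical
  have hU := isOpen_Q3
  have h0 := hu.continuousOn
  have h1 := (contDiffOn_pd hU hu e1).continuousOn
  have h3 := (contDiffOn_pd hU hu e3).continuousOn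
  have h11 := continuousOn_pd_pd hU hu e1 e1
  have h13 := continuousOn_pd_pd hU hu e1 e3
  have h33 := continuousOn_pd_pd hU hu e3 e3
  have hw : ContinuousOn (fun x => W ![pd e1 u x, 0, h⁻¹ • pd e3 u x]) Q3 := by
    refine hW.comp_continuousOn (continuousOn_pi.2 fun j => ?_)
    fin_cases j
    · exact h1
    · exact continuousOn_const
    · exact h3.const_smul h⁻¹
  have hg : ContinuousOn (fun x => ENNReal.ofReal (sliceDens W h ε u x)) Q3 := by
    refine ENNReal.continuous_ofReal.comp_continuousOn ?_
    unfold sliceDens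
    fun_prop
  have hn : ContinuousOn (fun x => ENNReal.ofReal (vnorm (u x - u0 a x))) Q3 := by
    refine ENNReal.continuous_ofReal.comp_continuousOn ?_
    unfold u0 ub0
    fun_prop
  have hn' :=
    (ENNReal.continuous_const_mul (a := ENNReal.ofReal k) ofReal_ne_top).comp_continuousOn hn
  rw [← piecewise_eq_indicator]
  exact (hg.add hn').measurable_piecewise continuousOn_const hU.measurableSet

theorem lintegral_comp_mul_left {φ : ℝ → ℝ≥0∞} (hφ : Measurable φ) {r : ℝ} (hr : 0 < r) :
    ∫⁻ s, φ (r * s) = ENNReal.ofReal r⁻¹ * ∫⁻ s, φ s := by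
  rw [← lintegral_map hφ (measurable_const_mul r), Real.map_volume_mul_left hr.ne',
    lintegral_smul_measure, abs_of_pos (inv_pos.2 hr), smul_eq_mul]

theorem exists_slice_lintegral_le {φ : Pt → ℝ≥0∞} (hφ : Measurable φ) {ε η : ℝ} (hε : 0 < ε)
    (hη : 0 < η) :
    ∃ x ∈ II, ∫⁻ y, φ (slicePt ε η x y)
      ≤ ENNReal.ofReal ε⁻¹ * (ENNReal.ofReal η⁻¹ * ∫⁻ x, φ x) := by
  have hm : Measurable fun z : ℝ × Pt2 => φ (z.2.1, z.1, z.2.2) := hφ.comp (by fun_prop)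
  have hvol : volume II = 1 := by
    rw [II, Real.volume_Ioo]; norm_num
  obtain ⟨x, hx, h⟩ := exists_le_setLAverage (μ := volume) (s := II)
    (f := fun x => ∫⁻ y : Pt2, φ (y.1, x, y.2)) (by simp [hvol]) (by simp [hvol])
    (hm.lintegral_prod_right' (ν := (volume : Measure Pt2))).aemeasurable
  refine ⟨x, hx, ?_⟩
  have hx' : ∫⁻ y : Pt2, φ (y.1, x, y.2) ≤ ∫⁻ x, φ x := by
    refine h.trans ?_
    rw [setLAverage_eq, hvol, div_one]
    refine (setLIntegral_le_lintegral _ _).trans_eq ?_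
    calc ∫⁻ x, ∫⁻ y : Pt2, φ (y.1, x, y.2)
        = ∫⁻ x, ∫⁻ s, ∫⁻ t, φ (s, x, t) := by
          refine lintegral_congr fun x => ?_
          rw [Measure.volume_eq_prod]
          exact lintegral_prod _
              (hφ.comp (by fun_prop : Measurable
              fun y : Pt2 => ((y.1, x, y.2) : Pt))).aemeasurable
      _ = ∫⁻ s, ∫⁻ x, ∫⁻ t, φ (s, x, t) := by
          refine lintegral_lintegral_swap ?_
          have h3 : Measurable fun z : (ℝ × ℝ) × ℝ => φ (z.1.2, z.1.1, z.2) := hφ.comp (by fun_prop)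
          exact h3.lintegral_prod_right'.aemeasurable
      _ = ∫⁻ s, ∫⁻ y : Pt2, φ (s, y) := by
          refine lintegral_congr fun s => ?_
          rw [Measure.volume_eq_prod]
          exact (lintegral_prod _
              (hφ.comp (by fun_prop : Measurable
              fun y : Pt2 => ((s, y) : Pt))).aemeasurable).symm
      _ = ∫⁻ x, φ x := by
          rw [Measure.volume_eq_prod ℝ (ℝ × ℝ)]
          exact (lintegral_prod _ hφ.aemeasurable).symm
  refine le_trans (le_of_eq ?_) (mul_le_mul_right (mul_le_mul_right hx' _) _)
  have hψ : Measurable fun y : Pt2 => φ (y.1, x, y.2) := hφ.comp (by fun_prop)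
  rw [Measure.volume_eq_prod, lintegral_prod _ (by
    exact (hφ.comp (contDiff_slicePt ε η x).continuous.measurable).aemeasurable),
    lintegral_prod _ hψ.aemeasurable]
  have e1 : ∀ s, ∫⁻ t, φ (slicePt ε η x (s, t)) = ENNReal.ofReal η⁻¹ * ∫⁻ t, φ (ε * s, x, t) :=
    fun s => lintegral_comp_mul_left (φ := fun t => φ (ε * s, x, t)) (hφ.comp (by fun_prop)) hη
  simp only [e1]
  have hk := hψ.lintegral_prod_right' (ν := volume)
  rw [lintegral_const_mul' _ _ ofReal_ne_top]
  rw [lintegral_comp_mul_left (φ := fun s => ∫⁻ t, φ (s, x, t)) hk hε]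
  rw [mul_left_comm]

/-- Some plane `x₂ = const` carries at most the average energy. -/
theorem QuadBounds.exists_slice {W : M33 → ℝ} {a : V3} {c C : ℝ} (hW : QuadBounds W a c C)
    (h4 : H4 W) {h ε k X : ℝ} (hh : 0 < h) (hε : 0 < ε) (hk : 0 ≤ k) {u : Pt → V3}
    (hu : ContDiffOn ℝ 2 u Q3)
    (hX : F W h ε u Q3
      + ENNReal.ofReal k * ∫⁻ x in Q3, ENNReal.ofReal (vnorm (u x - u0 a x)) ≤ ENNReal.ofReal X) :
    ∃ v : Pt2 → V3, ContDiffOn ℝ 2 v (Rect ε⁻¹ (h / ε)) ∧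
      ∫⁻ y in Rect ε⁻¹ (h / ε),
        ENNReal.ofReal (dens W v y + k * ((ε⁻¹) ^ 2)⁻¹ * vnorm (v y - |y.1| • a))
          ≤ ENNReal.ofReal (h / ε * X) := by
  have hη : 0 < ε / h := by positivity
  set φ := Q3.indicator fun x =>
      ENNReal.ofReal (sliceDens W h ε u x) + ENNReal.ofReal k * ENNReal.ofReal (vnorm (u x - u0 a x))
          with hφ
  have hmeas : Measurable φ := measurable_indicator_sliceDens hW.cont hu h ε k a
  have hφX : ∫⁻ x, φ x ≤ ENNReal.ofReal X := by
    refine le_trans ?_ hX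
    rw [hφ, lintegral_indicator isOpen_Q3.measurableSet, F,
      ← lintegral_const_mul' _ _ ofReal_ne_top]
    have hn : ContinuousOn (fun x => ENNReal.ofReal (vnorm (u x - u0 a x))) Q3 := by
      have h0 := hu.continuousOn
      refine ENNReal.continuous_ofReal.comp_continuousOn ?_
      unfold u0 ub0
      fun_prop
    rw [lintegral_add_right' _
      ((hn.aemeasurable isOpen_Q3.measurableSet).const_mul (ENNReal.ofReal k))]
    gcongr with x
    exact sliceDens_le h4 hε u x
  obtain ⟨x, hx, hle⟩ := exists_slice_lintegral_le hmeas hε hη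
  have hmem : ∀ y ∈ Rect ε⁻¹ (h / ε), slicePt ε (ε / h) x y ∈ Q3 := by
    rintro ⟨s, t⟩ ⟨⟨hs1, hs2⟩, ht1, ht2⟩
    have es : ε * (ε⁻¹ / 2) = 1 / 2 := by field_simp
    have et : ε / h * (h / ε / 2) = 1 / 2 := by field_simp
    have k1 := mul_lt_mul_of_pos_left hs1 hε
    have k2 := mul_lt_mul_of_pos_left hs2 hε
    have k3 := mul_lt_mul_of_pos_left ht1 hη
    have k4 := mul_lt_mul_of_pos_left ht2 hη
    rw [mul_neg, es] at k1
    rw [es] at k2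
    rw [mul_neg, et] at k3
    rw [et] at k4
    exact ⟨⟨k1, k2⟩, hx, ⟨k3, k4⟩⟩
  refine ⟨fun y => ε⁻¹ • u (slicePt ε (ε / h) x y), ?_, ?_⟩
  · exact (hu.comp (contDiff_slicePt _ _ _).contDiffOn hmem).const_smul ε⁻¹
  calc _ ≤ ∫⁻ y in Rect ε⁻¹ (h / ε), ENNReal.ofReal ε * φ (slicePt ε (ε / h) x y) := by
        refine setLIntegral_mono' (isOpen_rect _ _).measurableSet fun y hy => ?_
        have hyQ := hmem y hy
        rw [dens_slice hu hε hyQ, hφ, indicator_of_mem hyQ, ← ofReal_mul hk]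
        have hs : 0 ≤ sliceDens W h ε u (slicePt ε (ε / h) x y) := by
          have := hW.nonneg (pd e1 u (slicePt ε (ε / h) x y))
              (h⁻¹ • pd e3 u (slicePt ε (ε / h) x y))
          have k1 := sqn_nonneg (pd e1 (pd e1 u) (slicePt ε (ε / h) x y))
          have k2 := sqn_nonneg (pd e3 (pd e1 u) (slicePt ε (ε / h) x y))
          have k3 := sqn_nonneg (pd e3 (pd e3 u) (slicePt ε (ε / h) x y))
          unfold sliceDens
          positivity
        rw [← ofReal_add hs (mul_nonneg hk (vnorm_nonneg _)), ← ofReal_mul hε.le]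
        refine ENNReal.ofReal_le_ofReal (le_of_eq ?_)
        have hd : ε⁻¹ • u (slicePt ε (ε / h) x y) - |y.1| • a
            = ε⁻¹ • (u (slicePt ε (ε / h) x y) - u0 a (slicePt ε (ε / h) x y)) := by
          simp only [u0, ub0, slicePt, abs_mul, abs_of_pos hε, smul_sub, smul_smul]
          rw [inv_mul_cancel_left₀ hε.ne']
        rw [hd]
        rw [vnorm_smul, abs_of_pos (inv_pos.2 hε)]
        field_simp
    _ ≤ ∫⁻ y, ENNReal.ofReal ε * φ (slicePt ε (ε / h) x y) := setLIntegral_le_lintegral _ _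
    _ = ENNReal.ofReal ε * ∫⁻ y, φ (slicePt ε (ε / h) x y) := 
        lintegral_const_mul' _ _ ofReal_ne_top
    _ ≤ ENNReal.ofReal ε * (ENNReal.ofReal ε⁻¹ *
        (ENNReal.ofReal (ε / h)⁻¹ * ENNReal.ofReal X)) := by
        gcongr
        exact hle.trans (by gcongr)
    _ = _ := by
        rw [← ofReal_mul (by positivity), ← ofReal_mul (by positivity), ← ofReal_mul hε.le]
        congr 1
        field_simp

theorem QuadBounds.kinfZero_le_of_thin {W : M33 → ℝ} {a : V3} {c C : ℝ} (hW : QuadBounds W a c C)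
    (ha : a ≠ 0) (h4 : H4 W) (hsym : ∀ ξ : M33, W ![ξ 0, ξ 1, -(ξ 2)] = W ξ) {L δ : ℝ}
    (hL : 0 ≤ L) (hδ : 0 < δ) :
    ∃ k > 0, ∃ C' > 0, ∃ ω > 0, ∃ N : ℝ, ∀ (h ε : ℝ) (u : Pt → V3), 0 < h → 0 < ε → h ≤ ω →
      N ≤ h / ε → ContDiffOn ℝ 2 u Q3 →
      F W h ε u Q3 + ENNReal.ofReal k * ∫⁻ x in Q3, ENNReal.ofReal (vnorm (u x - u0 a x))
        ≤ ENNReal.ofReal (L + δ) →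
      KinfZero W a ≤ ENNReal.ofReal (L + 2 * δ + C' * h) := by
  have hE : 0 < L + 2 * δ := by linarith
  obtain ⟨k, hk, C', hC', ω, hω, henergy⟩ := hW.kinfZero_le_of_energy ha hE.le
  obtain ⟨l, hl, D, hD, hfold⟩ := hW.exists_fold hsym
  set T := (L + 3 / 2 * δ) / (L + 2 * δ) with hT
  have hT0 : 0 < T := by positivity
  have hT1 : T < 1 := by rw [hT, div_lt_one hE]; linarith
  have hTE : T * (L + 2 * δ) = L + 3 / 2 * δ := div_mul_cancel₀ _ hE.ne'
  refine ⟨k, hk, 2 * C', by positivity, ω / 2, by positivity,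
    max (1 / (2 * T)) (max ((2 * l + 1) / T) (D * (L + δ) / (1 - T) / δ)), ?_⟩
  intro h ε u hh hε hhω hN hu hF
  obtain ⟨hN1, hN2⟩ := max_le_iff.1 hN
  obtain ⟨hN2, hN3⟩ := max_le_iff.1 hN2
  obtain ⟨v, hv, hvX⟩ := hW.exists_slice h4 hh hε hk.le hu hF
  set H := h / ε with hH
  have hH0 : 0 < H := by positivity
  have hR : 0 < ε⁻¹ := inv_pos.2 hε
  rw [div_le_iff₀ (by positivity)] at hN1 hN2
  rw [div_le_iff₀ hδ] at hN3
  obtain ⟨z, hz, hper, hzX⟩ := hfold ε⁻¹ H (T * H) (k * ((ε⁻¹) ^ 2)⁻¹) (H * (L + δ)) v hR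
    (by linarith) (by nlinarith) (by positivity) (by positivity) hv hvX
  have hbound : 2 * (H * (L + δ)) + D * (H * (L + δ) / (H - T * H)) ≤
      2 * (T * H) * (L + 2 * δ) := by
    have h1T : 0 < 1 - T := by linarith
    have e1 : D * (H * (L + δ) / (H - T * H)) = D * (L + δ) / (1 - T) := by
      have : H - T * H = H * (1 - T) := by ring
      rw [this]
      field_simp
    have e2 : 2 * (T * H) * (L + 2 * δ) = 2 * H * (L + 3 / 2 * δ) := by rw [← hTE]; ring
    rw [e1, e2]
    linarith
  have hle := hzX.trans hbound
  have hzc := hz.continuous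
  have hdc : Continuous fun y : Pt2 => dens W z y := continuous_dens hW.cont hz
  have hnc : Continuous fun y : Pt2 => vnorm (z y - |y.1| • a) := by fun_prop
  have h38 : -(3 * ε⁻¹ / 8) ≤ 3 * ε⁻¹ / 8 := by linarith
  have h2M : (0 : ℝ) ≤ 2 * (T * H) := by positivity
  have hd0 : 0 ≤ ∫ s in -(3 * ε⁻¹ / 8)..3 * ε⁻¹ / 8, ∫ t in 0..2 * (T * H), dens W z (s, t) :=
    intervalIntegral.integral_nonneg h38 fun s _ =>
      intervalIntegral.integral_nonneg h2M fun t _ => hW.dens_nonneg z (s, t)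
  have hn0 : 0 ≤ ∫ s in -(3 * ε⁻¹ / 8)..3 * ε⁻¹ / 8, ∫ t in 0..2 * (T * H),
      vnorm (z (s, t) - |s| • a) :=
    intervalIntegral.integral_nonneg h38 fun s _ =>
      intervalIntegral.integral_nonneg h2M fun t _ => vnorm_nonneg _
  have hsplit : ∫ s in -(3 * ε⁻¹ / 8)..3 * ε⁻¹ / 8, ∫ t in 0..2 * (T * H),
        (dens W z (s, t) + k * ((ε⁻¹) ^ 2)⁻¹ * vnorm (z (s, t) - |s| • a))
      = (∫ s in -(3 * ε⁻¹ / 8)..3 * ε⁻¹ / 8, ∫ t in 0..2 * (T * H), dens W z (s, t))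
        + k * ((ε⁻¹) ^ 2)⁻¹ * ∫ s in -(3 * ε⁻¹ / 8)..3 * ε⁻¹ / 8, ∫ t in 0..2 * (T * H),
          vnorm (z (s, t) - |s| • a) := by
    rw [← intervalIntegral.integral_const_mul, ← intervalIntegral.integral_add]
    · refine intervalIntegral.integral_congr fun s _ => ?_
      rw [← intervalIntegral.integral_const_mul, ← intervalIntegral.integral_add]
      · exact Continuous.intervalIntegrable (by fun_prop) _ _
      · exact Continuous.intervalIntegrable
          ((hnc.comp (by fun_prop : Continuous fun t : ℝ => (s, t))).const_mul _) _ _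
    · exact (continuous_integral_snd hdc 0 _).intervalIntegrable _ _
    · exact ((continuous_integral_snd hnc 0 _).const_mul _).intervalIntegrable _ _
  rw [hsplit] at hle
  have hPR : 2 * (T * H) / ε⁻¹ ≤ 2 * h := by
    have : 2 * (T * H) / ε⁻¹ = T * (2 * h) := by
      rw [hH]; field_simp
    rw [this]
    nlinarith
  have hk0 : 0 ≤ k * ((ε⁻¹) ^ 2)⁻¹ := by positivity
  have hfin := henergy (2 * (T * H)) ε⁻¹ z (by linarith)
    (by rw [← div_le_iff₀ hR]; linarith) hz hper
    (by linarith [mul_nonneg hk0 hn0]) (by linarith)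
  refine hfin.trans (ENNReal.ofReal_le_ofReal ?_)
  have := mul_le_mul_of_nonneg_left hPR hC'.le
  linarith

/-- Corollary 6.6: for p = 2, λ = 0 and W symmetric in ξ₃,
K*_∞ ≥ K_∞. -/
theorem statement16 (A B : M33) (W : M33 → ℝ) (a : V3) (ha : a ≠ 0)
    (hWc : Continuous W) (h1 : H1 W A B) (h2 : H2 W 2) (h3 : H3 W A B 2) (h4 : H4 W)
    (hAB : A = -B) (hA0 : A 0 = a) (hA1 : A 1 = 0) (hA2 : A 2 = 0)
    (hsym : ∀ ξ : M33, W ![ξ 0, ξ 1, -(ξ 2)] = W ξ) :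
    KinfZero W a ≤ KstarInf W a (A 2) := by
  obtain rfl : B = -A := by rw [hAB, neg_neg]
  obtain ⟨c, C, hW⟩ := exists_quadBounds hWc h1 h2 h3 hA0 hA1 hA2
  refine le_sInf ?_
  rintro _ ⟨h, ε, u, hh, hε, hh0, -, hhε, hu, hconv, -, rfl⟩
  set L := liminf (fun n => F W (h n) (ε n) (u n) Q3) atTop with hL
  rcases eq_or_ne L ∞ with hLtop | hLtop
  · rw [hLtop]; exact le_top
  refine ENNReal.le_of_forall_pos_le_add fun δ hδ _ => ?_
  have hδ4 : (0 : ℝ) < δ / 4 := by positivity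
  obtain ⟨k, hk, C', hC', ω, hω, N, hthin⟩ :=
    hW.kinfZero_le_of_thin ha h4 hsym (L := L.toReal) toReal_nonneg hδ4
  have hlt : L < ENNReal.ofReal (L.toReal + δ / 8) := by
    rw [← ENNReal.ofReal_toReal hLtop, ENNReal.toReal_ofReal toReal_nonneg]
    exact (ENNReal.ofReal_lt_ofReal_iff (by positivity)).2 (by linarith)
  have hfreq : ∃ᶠ n in atTop, F W (h n) (ε n) (u n) Q3 < ENNReal.ofReal (L.toReal + δ / 8) :=
    frequently_lt_of_liminf_lt (by isBoundedDefault) hlt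
  have hL1 : ∀ᶠ n in atTop, ENNReal.ofReal k * ∫⁻ x in Q3, ENNReal.ofReal (vnorm (u n x - u0 a x))
      < ENNReal.ofReal (δ / 8) := by
    have := ENNReal.Tendsto.const_mul (a := ENNReal.ofReal k) hconv (Or.inr ofReal_ne_top)
    rw [mul_zero] at this
    exact this.eventually (gt_mem_nhds (by simpa using hδ))
  have hhC : ∀ᶠ n in atTop, h n < min ω (δ / 2 / C') :=
    hh0.eventually (gt_mem_nhds (by positivity))
  obtain ⟨n, hn, hn1, hn2, hn3⟩ :=
    (hfreq.and_eventually (hL1.and (hhC.and (hhε.eventually_ge_atTop N)))).exists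
  have hnC : C' * h n ≤ δ / 2 := by
    have := (hn2.trans_le (min_le_right _ _)).le
    rw [le_div_iff₀ hC'] at this
    linarith
  have hX : F W (h n) (ε n) (u n) Q3
      + ENNReal.ofReal k * ∫⁻ x in Q3, ENNReal.ofReal (vnorm (u n x - u0 a x))
      ≤ ENNReal.ofReal (L.toReal + δ / 4) := by
    refine (add_le_add hn.le hn1.le).trans_eq ?_
    rw [← ofReal_add (by positivity) (by positivity)]
    congr 1
    ring
  refine (hthin (h n) (ε n) (u n) (hh n) (hε n) (hn2.trans_le (min_le_left _ _)).le hn3 (hu n)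
    hX).trans ?_
  calc _ ≤ ENNReal.ofReal (L.toReal + δ) := ENNReal.ofReal_le_ofReal (by linarith)
    _ = L + δ := by
        rw [ENNReal.ofReal_add toReal_nonneg δ.coe_nonneg, ofReal_toReal hLtop, ofReal_coe_nnreal]
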